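/- arXiv:1701.03901 — 3 statements merged into one kernel-verified Lean document; each statement's English description precedes it below -/
import Mathlib

section
/- Let 𝒦 be a closed cone of cubic forms in n variables with real coefficients, i.e. a subset of the real vector space of cubic forms in n variables such that λc ∈ 𝒦 for all c ∈ 𝒦 and λ ≥ 0, and 𝒦 is closed. Set σ_𝒦 = 1 + max over nonzero c ∈ 𝒦 of the dimension of the singular locus of the projective hypersurface V(c) ⊆ ℙ^{n−1} (with the convention dim ∅ = −1), so that σ_𝒦 ∈ {0,…,n−1}. Then for every ε > 0 there is a constant C depending only on 𝒦 and ε such that for every nonzero c ∈ 𝒦 and every B ≥ 1, N^aux_c(B) ≤ C·B^{n+σ_𝒦+ε}. -/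
open MvPolynomial Matrix

/-- A cubic form in `n` variables is represented by its (symmetric) array of
coefficients `a`, the form being `c(x) = ∑_{i,j,k} a i j k · x_i x_j x_k`; the
space of such arrays carries the natural (product) topology of the
finite-dimensional real linear space of cubic forms.  For a symmetric array,
`∂³c/∂x_i∂x_j∂x_k = 6·a i j k`, so `‖c‖ = (1/6)·max |∂³c| = max_{i,j,k} |a i j k|`. -/
noncomputable def cubicSup {n : ℕ} (a : Fin n → Fin n → Fin n → ℝ) : ℝ :=
  ⨆ i : Fin n, ⨆ j : Fin n, ⨆ k : Fin n, |a i j k|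

/-- The normalised Hessian `H_c(x)`: since `∂²c/∂x_i∂x_j = 6·∑_k a i j k · x_k`
for a symmetric coefficient array, its `(i,j)` entry is
`(1/‖c‖)·6·∑_k a i j k · x_k`. -/
noncomputable def hessArr {n : ℕ} (a : Fin n → Fin n → Fin n → ℝ) (x : Fin n → ℝ) :
    Matrix (Fin n) (Fin n) ℝ :=
  Matrix.of fun i j => (cubicSup a)⁻¹ * (6 * ∑ k, a i j k * x k)

/-- The counting function `N^aux_c(B)`: the number of pairs `(x, y) ∈ ℤ^n × ℤ^n`
with `‖x‖_∞ ≤ B`, `‖y‖_∞ ≤ B` and `‖H_c(x)·y‖_∞ < B`. -/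
noncomputable def NauxArr {n : ℕ} (a : Fin n → Fin n → Fin n → ℝ) (B : ℝ) : ℕ :=
  Set.ncard {p : (Fin n → ℤ) × (Fin n → ℤ) |
    (∀ i, (|p.1 i| : ℝ) ≤ B) ∧ (∀ i, (|p.2 i| : ℝ) ≤ B) ∧
    (∀ i, |(hessArr a (fun j => (p.1 j : ℝ))).mulVec (fun j => (p.2 j : ℝ)) i| < B)}

/-- One plus the dimension of the singular locus of the projective hypersurface
`V(c) ⊆ ℙ^{n−1}` over ℂ (with `dim ∅ = −1`): the singular locus is cut out by the
vanishing of the gradient `∇c`, whose components are (up to the unit `3`) the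
quadrics `∑_{j,k} a i j k · X_j X_k`, and `1 + dim Sing V(c)` equals the Krull
dimension of the homogeneous coordinate ring of the affine cone over `Sing V(c)`. -/
noncomputable def onePlusDimSing {n : ℕ} (a : Fin n → Fin n → Fin n → ℝ) :
    WithBot ℕ∞ :=
  ringKrullDim (MvPolynomial (Fin n) ℂ ⧸
    Ideal.span (Set.range fun i : Fin n =>
      ∑ j : Fin n, ∑ k : Fin n,
        MvPolynomial.C ((a i j k : ℂ)) * MvPolynomial.X j * MvPolynomial.X k))


theorem height_max_mvpoly (n : ℕ) : ∀ (P : Ideal (MvPolynomial (Fin n) ℂ)), P.IsMaximal → P.height = n := by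
  induction n with
  | zero =>
    intro P hP
    have h1 := Ideal.height_le_ringKrullDim_of_ne_top hP.ne_top
    have := MvPolynomial.ringKrullDim_of_isNoetherianRing (R := ℂ) (ι := Fin 0)
    rw [this] at h1
    simp at h1
    simpa using h1
  | succ n ih =>
    intro P hP
    let e := (finSuccEquiv ℂ n).toRingEquiv
    have h2 : (P.comap e.symm).height = P.height := by
      exact RingEquiv.height_comap e.symm P
    rw [← h2]
    have hm : (P.comap e.symm).IsMaximal := Ideal.comap_isMaximal_of_equiv e.symm
    set Q := P.comap e.symm
    have hq : (Q.under (MvPolynomial (Fin n) ℂ)).IsMaximal :=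
      Polynomial.isMaximal_comap_C_of_isJacobsonRing Q
    have hlo : Q.LiesOver (Q.under (MvPolynomial (Fin n) ℂ)) := ⟨rfl⟩
    rw [Polynomial.height_eq_height_add_one (Q.under (MvPolynomial (Fin n) ℂ)) Q, ih _ hq]
    simp

/-- The trilinear form attached to a coefficient array. -/
noncomputable def tri {n : ℕ} (s : Fin n → Fin n → Fin n → ℝ)
    (x y z : EuclideanSpace ℝ (Fin n)) : ℝ :=
  ∑ i, ∑ j, ∑ k, s i j k * x i * y j * z k

theorem onb_sum {n : ℕ} (β : OrthonormalBasis (Fin n) ℝ (EuclideanSpace ℝ (Fin n))) (j k : Fin n) :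
    ∑ l, β l j * β l k = if j = k then 1 else 0 := by
  have h := β.sum_inner_mul_inner (EuclideanSpace.single j (1:ℝ)) (EuclideanSpace.single k (1:ℝ))
  simp [PiLp.inner_apply] at h
  rw [h]

theorem ring_expand {R : Type*} [CommRing R] {n : ℕ} (f : Fin n → Fin n → Fin n → R) (t : Fin n → R)
    (b : Fin n → Fin n → R) (L : Fin n → R) :
    ∑ i, t i * ∑ j, ∑ k, f i j k * (∑ l, b l j * L l) * (∑ m, b m k * L m) =
      ∑ l, ∑ m, (∑ i, ∑ j, ∑ k, f i j k * t i * b l j * b m k) * (L l * L m) := by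
  simp only [Finset.mul_sum, Finset.sum_mul]
  calc _ = ∑ i, ∑ j, ∑ l, ∑ m, ∑ k, f i j k * t i * b l j * b m k * (L l * L m) := by
        refine Finset.sum_congr rfl fun i _ => Finset.sum_congr rfl fun j _ => ?_
        calc _ = ∑ m, ∑ l, ∑ k, f i j k * t i * b l j * b m k * (L l * L m) := by
              rw [Finset.sum_comm]
              refine Finset.sum_congr rfl fun m _ => ?_
              rw [Finset.sum_comm]
              refine Finset.sum_congr rfl fun l _ => Finset.sum_congr rfl fun k _ => ?_
              ring
          _ = _ := Finset.sum_comm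
    _ = ∑ i, ∑ l, ∑ m, ∑ j, ∑ k, f i j k * t i * b l j * b m k * (L l * L m) := by
        refine Finset.sum_congr rfl fun i _ => ?_
        rw [Finset.sum_comm]
        refine Finset.sum_congr rfl fun l _ => ?_
        rw [Finset.sum_comm]
    _ = _ := by
        rw [Finset.sum_comm]
        refine Finset.sum_congr rfl fun l _ => ?_
        rw [Finset.sum_comm]

theorem exists_tri_ne_zero {n : ℕ} (s : Fin n → Fin n → Fin n → ℝ) (σ b : ℕ) (hb : σ + b < n)
    (hs : onePlusDimSing s ≤ ((σ : ℕ) : WithBot ℕ∞))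
    (τ β : OrthonormalBasis (Fin n) ℝ (EuclideanSpace ℝ (Fin n))) :
    ∃ i j k : Fin n, (i : ℕ) ≤ σ + b ∧ b ≤ (j : ℕ) ∧ b ≤ (k : ℕ) ∧ tri s (τ i) (β j) (β k) ≠ 0 := by
  by_contra hcon
  push Not at hcon
  let lin : Fin n → MvPolynomial (Fin n) ℂ := fun l => ∑ j, C ((β l j : ℝ) : ℂ) * X j
  let Q : Fin n → MvPolynomial (Fin n) ℂ := fun i => ∑ j : Fin n, ∑ k : Fin n,
        MvPolynomial.C ((s i j k : ℂ)) * MvPolynomial.X j * MvPolynomial.X k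
  let Qv : Fin n → MvPolynomial (Fin n) ℂ := fun l => ∑ i, C ((τ l i : ℝ) : ℂ) * Q i
  have key : ∀ (γ : OrthonormalBasis (Fin n) ℝ (EuclideanSpace ℝ (Fin n)))
      (F : Fin n → MvPolynomial (Fin n) ℂ) (j : Fin n),
      F j = ∑ l, C ((γ l j : ℝ) : ℂ) * ∑ i, C ((γ l i : ℝ) : ℂ) * F i := by
    intro γ F j
    simp only [Finset.mul_sum]
    rw [Finset.sum_comm]
    have : ∀ i, ∑ l, C ((γ l j : ℝ) : ℂ) * (C ((γ l i : ℝ) : ℂ) * F i)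
        = (if j = i then 1 else 0) * F i := by
      intro i
      have h := onb_sum γ j i
      have h2 : (∑ l, C ((γ l j : ℝ) : ℂ) * C ((γ l i : ℝ) : ℂ) : MvPolynomial (Fin n) ℂ)
        = C (((∑ l, γ l j * γ l i : ℝ)) : ℂ) := by
        push_cast
        simp only [map_sum, map_mul]
      rw [h] at h2
      simp only [← mul_assoc]
      rw [← Finset.sum_mul, h2]
      split_ifs <;> simp
    simp only [this]
    simp
  have hX : ∀ j, X j = ∑ l, C ((β l j : ℝ) : ℂ) * lin l := fun j => key β X j
  have hQ : ∀ j, Q j = ∑ l, C ((τ l j : ℝ) : ℂ) * Qv l := fun j => key τ Q j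
  have hQv : ∀ p, Qv p = ∑ l, ∑ m, C ((tri s (τ p) (β l) (β m) : ℝ) : ℂ) * (lin l * lin m) := by
    intro p
    have := ring_expand (fun i j k => (C ((s i j k : ℝ) : ℂ) : MvPolynomial (Fin n) ℂ))
      (fun i => C ((τ p i : ℝ) : ℂ)) (fun l j => C ((β l j : ℝ) : ℂ)) lin
    simp only [← hX] at this
    simp only [Qv, Q]
    rw [this]
    refine Finset.sum_congr rfl fun l _ => Finset.sum_congr rfl fun m _ => ?_
    congr 1
    simp only [tri]
    push_cast
    simp only [map_sum, map_mul]
  let S1 : Finset (MvPolynomial (Fin n) ℂ) := (Finset.univ.filter fun i : Fin n => σ + b < i).image Qv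
  let S2 : Finset (MvPolynomial (Fin n) ℂ) := (Finset.univ.filter fun i : Fin n => (i : ℕ) < b).image lin
  classical
  let S := S1 ∪ S2
  have hcard : S.card ≤ (n - (σ + b + 1)) + b := by
    refine (Finset.card_union_le _ _).trans (Nat.add_le_add ?_ ?_)
    · refine Finset.card_image_le.trans ?_
      have : (Finset.univ.filter fun i : Fin n => σ + b < i) = Finset.Ioi (⟨σ + b, hb⟩ : Fin n) := by
        ext i; simp [Fin.lt_def]
      rw [this, Fin.card_Ioi]
      simp; omega
    · refine Finset.card_image_le.trans ?_
      have : (Finset.univ.filter fun i : Fin n => (i : ℕ) < b) = Finset.Iio (⟨b, by omega⟩ : Fin n) := by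
        ext i; simp [Fin.lt_def]
      rw [this, Fin.card_Iio]
  have hlinmem : ∀ l : Fin n, (l : ℕ) < b → lin l ∈ Ideal.span (S : Set (MvPolynomial (Fin n) ℂ)) := by
    intro l hl
    apply Ideal.subset_span
    simp only [S, S2, Finset.coe_union, Finset.coe_image]
    right
    exact ⟨l, by simpa using hl, rfl⟩
  have hQvmem : ∀ p : Fin n, Qv p ∈ Ideal.span (S : Set (MvPolynomial (Fin n) ℂ)) := by
    intro p
    by_cases hp : σ + b < p
    · apply Ideal.subset_span
      simp only [S, S1, Finset.coe_union, Finset.coe_image]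
      left
      exact ⟨p, by simpa using hp, rfl⟩
    · rw [hQv]
      refine Ideal.sum_mem _ fun l _ => Ideal.sum_mem _ fun m _ => ?_
      by_cases hl : (l : ℕ) < b
      · exact Ideal.mul_mem_left _ _ (Ideal.mul_mem_right _ _ (hlinmem l hl))
      by_cases hm : (m : ℕ) < b
      · exact Ideal.mul_mem_left _ _ (Ideal.mul_mem_left _ _ (hlinmem m hm))
      rw [hcon p l m (by omega) (by omega) (by omega)]
      simp
  have hIG : Ideal.span (Set.range Q) ≤ Ideal.span (S : Set (MvPolynomial (Fin n) ℂ)) := by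
    rw [Ideal.span_le]
    rintro _ ⟨i, rfl⟩
    rw [SetLike.mem_coe, hQ]
    exact Ideal.sum_mem _ fun l _ => Ideal.mul_mem_left _ _ (hQvmem l)
  let P : Ideal (MvPolynomial (Fin n) ℂ) := RingHom.ker (constantCoeff (σ := Fin n) (R := ℂ))
  have hP : P.IsMaximal := RingHom.ker_isMaximal_of_surjective _ (fun z => ⟨C z, by simp⟩)
  have hSP : (S : Set (MvPolynomial (Fin n) ℂ)) ⊆ P := by
    intro f hf
    simp only [S, S1, S2, Finset.coe_union, Finset.coe_image] at hf
    rcases hf with ⟨l, _, rfl⟩ | ⟨l, _, rfl⟩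
    · simp [P, RingHom.mem_ker, Qv, Q]
    · simp [P, RingHom.mem_ker, lin]
  have h1 := Ideal.height_le_ringKrullDim_quotient_add_encard (S : Set (MvPolynomial (Fin n) ℂ)) hSP
  rw [height_max_mvpoly n P hP] at h1
  have h2 : ringKrullDim (MvPolynomial (Fin n) ℂ ⧸ Ideal.span (S : Set (MvPolynomial (Fin n) ℂ)))
      ≤ ringKrullDim (MvPolynomial (Fin n) ℂ ⧸ Ideal.span (Set.range Q)) :=
    ringKrullDim_le_of_surjective (Ideal.Quotient.factor hIG) (Ideal.Quotient.factor_surjective hIG)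
  have h3 : ringKrullDim (MvPolynomial (Fin n) ℂ ⧸ Ideal.span (S : Set (MvPolynomial (Fin n) ℂ))) ≤ (σ : ℕ) :=
    h2.trans hs
  rw [Set.encard_coe_eq_coe_finsetCard] at h1
  have h4 : (((n : ℕ∞)) : WithBot ℕ∞) ≤ ((σ + ((n - (σ + b + 1)) + b) : ℕ) : WithBot ℕ∞) := by
    refine h1.trans ?_
    push_cast
    refine add_le_add h3 ?_
    exact_mod_cast hcard
  have h5 : n ≤ σ + ((n - (σ + b + 1)) + b) := Nat.cast_le.mp (WithBot.coe_le_coe.mp h4)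
  omega

/-- Euclidean space, abbreviated. -/
abbrev Eu (n : ℕ) : Type := EuclideanSpace ℝ (Fin n)

/-- `tri` as a linear map in its first argument. -/
noncomputable def triL {n : ℕ} (s : Fin n → Fin n → Fin n → ℝ) (y z : Eu n) : Eu n →ₗ[ℝ] ℝ where
  toFun x := tri s x y z
  map_add' x x' := by
    simp [tri, mul_add, add_mul, Finset.sum_add_distrib]
  map_smul' r x := by
    simp only [tri, Finset.mul_sum, PiLp.smul_apply, smul_eq_mul, RingHom.id_apply]
    refine Finset.sum_congr rfl fun i _ => Finset.sum_congr rfl fun j _ =>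
      Finset.sum_congr rfl fun k _ => ?_
    ring

/-- Symmetric coefficient arrays. -/
def SymmArr {n : ℕ} (s : Fin n → Fin n → Fin n → ℝ) : Prop :=
  ∀ i j k, s i j k = s j i k ∧ s i j k = s i k j

theorem tri_swap12 {n : ℕ} {s : Fin n → Fin n → Fin n → ℝ} (hs : SymmArr s) (x y z : Eu n) :
    tri s x y z = tri s y x z := by
  unfold tri
  rw [Finset.sum_comm]
  refine Finset.sum_congr rfl fun i _ => Finset.sum_congr rfl fun j _ =>
      Finset.sum_congr rfl fun k _ => ?_
  rw [(hs i j k).1]; ring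

theorem tri_swap23 {n : ℕ} {s : Fin n → Fin n → Fin n → ℝ} (hs : SymmArr s) (x y z : Eu n) :
    tri s x y z = tri s x z y := by
  unfold tri
  refine Finset.sum_congr rfl fun i _ => ?_
  rw [Finset.sum_comm]
  refine Finset.sum_congr rfl fun j _ => Finset.sum_congr rfl fun k _ => ?_
  rw [(hs i j k).2]; ring

theorem tri_sub1 {n : ℕ} (s : Fin n → Fin n → Fin n → ℝ) (x x' y z : Eu n) :
    tri s (x - x') y z = tri s x y z - tri s x' y z := (triL s y z).map_sub x x'

theorem tri_add1 {n : ℕ} (s : Fin n → Fin n → Fin n → ℝ) (x x' y z : Eu n) :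
    tri s (x + x') y z = tri s x y z + tri s x' y z := (triL s y z).map_add x x'

theorem tri_smul1 {n : ℕ} (s : Fin n → Fin n → Fin n → ℝ) (r : ℝ) (x y z : Eu n) :
    tri s (r • x) y z = r * tri s x y z := (triL s y z).map_smul r x

theorem tri_sum1 {n : ℕ} (s : Fin n → Fin n → Fin n → ℝ) (S : Finset (Fin n)) (f : Fin n → Eu n)
    (y z : Eu n) : tri s (∑ i ∈ S, f i) y z = ∑ i ∈ S, tri s (f i) y z :=
  map_sum (triL s y z) f S

theorem tri_sub2 {n : ℕ} (s : Fin n → Fin n → Fin n → ℝ) (x y y' z : Eu n) :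
    tri s x (y - y') z = tri s x y z - tri s x y' z := by
  simp [tri, mul_sub, sub_mul, Finset.sum_sub_distrib]

theorem tri_sub3 {n : ℕ} (s : Fin n → Fin n → Fin n → ℝ) (x y z z' : Eu n) :
    tri s x y (z - z') = tri s x y z - tri s x y z' := by
  simp [tri, mul_sub, Finset.sum_sub_distrib]

theorem coord_le {n : ℕ} (x : Eu n) (i : Fin n) : |x i| ≤ ‖x‖ := by
  have := PiLp.norm_apply_le x i
  simpa using this

theorem tri_bound {n : ℕ} {s : Fin n → Fin n → Fin n → ℝ} (hs : ∀ i j k, |s i j k| ≤ 1)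
    (x y z : Eu n) : |tri s x y z| ≤ (n : ℝ) ^ 3 * ‖x‖ * ‖y‖ * ‖z‖ := by
  unfold tri
  have h : ∀ i j k, |s i j k * x i * y j * z k| ≤ ‖x‖ * ‖y‖ * ‖z‖ := by
    intro i j k
    rw [abs_mul, abs_mul, abs_mul]
    have h1 := coord_le x i
    have h2 := coord_le y j
    have h3 := coord_le z k
    calc |s i j k| * |x i| * |y j| * |z k| ≤ 1 * ‖x‖ * ‖y‖ * ‖z‖ := by
          gcongr
          exact hs i j k
      _ = _ := by ring
  calc _ ≤ ∑ i : Fin n, ∑ j : Fin n, ∑ k : Fin n, ‖x‖ * ‖y‖ * ‖z‖ := by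
        refine (Finset.abs_sum_le_sum_abs _ _).trans (Finset.sum_le_sum fun i _ => ?_)
        refine (Finset.abs_sum_le_sum_abs _ _).trans (Finset.sum_le_sum fun j _ => ?_)
        refine (Finset.abs_sum_le_sum_abs _ _).trans (Finset.sum_le_sum fun k _ => h i j k)
    _ = _ := by simp; ring

theorem exists_kappa {n : ℕ} (K1 : Set (Fin n → Fin n → Fin n → ℝ)) (hK : IsCompact K1)
    (σ b : ℕ) (hb : σ + b < n) (hs : ∀ s ∈ K1, onePlusDimSing s ≤ ((σ : ℕ) : WithBot ℕ∞)) :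
    ∃ κ : ℝ, 0 < κ ∧ ∀ s ∈ K1, ∀ τ β : OrthonormalBasis (Fin n) ℝ (Eu n),
      ∃ i j k : Fin n, (i : ℕ) ≤ σ + b ∧ b ≤ (j : ℕ) ∧ b ≤ (k : ℕ) ∧
        κ ≤ |tri s (τ i) (β j) (β k)| := by
  classical
  let O : Set (Fin n → Eu n) := {τ | Orthonormal ℝ τ}
  have hO : IsCompact O := by
    apply Metric.isCompact_of_isClosed_isBounded
    · have : O = ⋂ i, ⋂ j, {τ : Fin n → Eu n | inner ℝ (τ i) (τ j) = if i = j then (1:ℝ) else 0} := by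
        ext τ
        simp [O, orthonormal_iff_ite]
      rw [this]
      refine isClosed_iInter fun i => isClosed_iInter fun j => isClosed_eq ?_ continuous_const
      fun_prop
    · refine (Metric.isBounded_closedBall (x := (0 : Fin n → Eu n)) (r := 1)).subset ?_
      intro τ hτ
      rw [mem_closedBall_zero_iff, pi_norm_le_iff_of_nonneg zero_le_one]
      intro i
      exact (hτ.1 i).le
  let f : (Fin n → Fin n → Fin n → ℝ) × (Fin n → Eu n) × (Fin n → Eu n) → ℝ := fun q =>
    ∑ i : Fin n, ∑ j : Fin n, ∑ k : Fin n,
      if (i : ℕ) ≤ σ + b ∧ b ≤ (j : ℕ) ∧ b ≤ (k : ℕ) then |tri q.1 (q.2.1 i) (q.2.2 j) (q.2.2 k)| else 0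
  have hf : Continuous f := by
    refine continuous_finsetSum _ fun i _ => continuous_finsetSum _ fun j _ =>
      continuous_finsetSum _ fun k _ => ?_
    split_ifs
    · unfold tri
      fun_prop
    · fun_prop
  have hC : IsCompact (K1 ×ˢ O ×ˢ O) := hK.prod (hO.prod hO)
  have hbas : ∀ τ ∈ O, ∃ t : OrthonormalBasis (Fin n) ℝ (Eu n), ∀ i, t i = τ i := by
    intro τ hτ
    obtain ⟨t, ht⟩ := Orthonormal.exists_orthonormalBasis_extension_of_card_eq (𝕜 := ℝ) (E := Eu n)
      (ι := Fin n) (by simp) (v := τ) (s := Set.univ)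
      (hτ.comp (fun i : (Set.univ : Set (Fin n)) => (i : Fin n)) Subtype.val_injective)
    exact ⟨t, fun i => ht i (Set.mem_univ i)⟩
  have hpos : ∀ q ∈ K1 ×ˢ O ×ˢ O, 0 < f q := by
    rintro ⟨s, τ, β⟩ ⟨h1, h2, h3⟩
    obtain ⟨t, ht⟩ := hbas τ h2
    obtain ⟨u, hu⟩ := hbas β h3
    obtain ⟨i, j, k, hi, hj, hk, hne⟩ := exists_tri_ne_zero s σ b hb (hs s h1) t u
    have hnn : ∀ i j k : Fin n, 0 ≤ (if (i : ℕ) ≤ σ + b ∧ b ≤ (j : ℕ) ∧ b ≤ (k : ℕ) then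
      |tri s (τ i) (β j) (β k)| else 0) := by
      intro i j k
      split_ifs <;> positivity
    refine Finset.sum_pos' (fun i _ => Finset.sum_nonneg fun j _ => Finset.sum_nonneg fun k _ => hnn i j k)
      ⟨i, Finset.mem_univ _, ?_⟩
    refine Finset.sum_pos' (fun j _ => Finset.sum_nonneg fun k _ => hnn i j k)
      ⟨j, Finset.mem_univ _, ?_⟩
    refine Finset.sum_pos' (fun k _ => hnn i j k) ⟨k, Finset.mem_univ _, ?_⟩
    simp only [hi, hj, hk, and_self, if_true]
    rw [← ht, ← hu, ← hu]
    exact abs_pos.mpr hne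
  by_cases hne : (K1 ×ˢ O ×ˢ O).Nonempty
  · obtain ⟨q, hq, hmin⟩ := hC.exists_isMinOn hne hf.continuousOn
    have hn : (0 : ℝ) < n := by
      have : 0 < n := by omega
      exact_mod_cast this
    have hfq := hpos q hq
    have hmin' : ∀ r ∈ K1 ×ˢ O ×ˢ O, f q ≤ f r := isMinOn_iff.mp hmin
    clear hmin
    obtain ⟨c, hc⟩ : ∃ c, c = f q := ⟨_, rfl⟩
    rw [← hc] at hfq hmin'
    clear hc
    refine ⟨c / (2 * (n : ℝ) ^ 3), div_pos hfq (by positivity), ?_⟩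
    intro s h1 τ β
    by_contra hcon
    push Not at hcon
    have hmem : (s, (τ : Fin n → Eu n), (β : Fin n → Eu n)) ∈ K1 ×ˢ O ×ˢ O :=
      Set.mk_mem_prod h1 (Set.mk_mem_prod τ.orthonormal β.orthonormal)
    have hm : c ≤ f (s, (τ : Fin n → Eu n), (β : Fin n → Eu n)) := hmin' _ hmem
    have : f (s, (τ : Fin n → Eu n), (β : Fin n → Eu n)) ≤
        ∑ i : Fin n, ∑ j : Fin n, ∑ k : Fin n, c / (2 * (n : ℝ) ^ 3) := by
      refine Finset.sum_le_sum fun i _ => Finset.sum_le_sum fun j _ => Finset.sum_le_sum fun k _ => ?_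
      split_ifs with h
      · exact (hcon i j k h.1 h.2.1 h.2.2).le
      · positivity
    have h3 : ∑ i : Fin n, ∑ j : Fin n, ∑ k : Fin n, c / (2 * (n : ℝ) ^ 3) = c / 2 := by
      simp
      field_simp
    linarith
  · refine ⟨1, one_pos, ?_⟩
    intro s h1 τ β
    have hmem : (s, (τ : Fin n → Eu n), (β : Fin n → Eu n)) ∈ K1 ×ˢ O ×ˢ O :=
      Set.mk_mem_prod h1 (Set.mk_mem_prod τ.orthonormal β.orthonormal)
    exact absurd ⟨_, hmem⟩ hne

theorem exists_T {n : ℕ} (s : Fin n → Fin n → Fin n → ℝ) (m b : ℕ) (hm : m < n) (κ : ℝ)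
    (β : OrthonormalBasis (Fin n) ℝ (Eu n))
    (h : ∀ τ : OrthonormalBasis (Fin n) ℝ (Eu n),
      ∃ i j k : Fin n, (i : ℕ) ≤ m ∧ b ≤ (j : ℕ) ∧ b ≤ (k : ℕ) ∧
        κ ≤ |tri s (τ i) (β j) (β k)|) :
    ∃ τ : OrthonormalBasis (Fin n) ℝ (Eu n), ∀ t : Eu n,
      (∀ i : Fin n, (i : ℕ) < m → inner ℝ (τ i) t = (0:ℝ)) → t ≠ 0 →
      ∃ j k : Fin n, b ≤ (j : ℕ) ∧ b ≤ (k : ℕ) ∧ κ * ‖t‖ ≤ |tri s t (β j) (β k)| := by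
  classical
  let P : ℕ → Prop := fun p => ∃ τ : OrthonormalBasis (Fin n) ℝ (Eu n),
    ∀ i j k : Fin n, (i : ℕ) < p → b ≤ (j : ℕ) → b ≤ (k : ℕ) → |tri s (τ i) (β j) (β k)| < κ
  have hP0 : P 0 := ⟨β, fun i j k hi => absurd hi (Nat.not_lt_zero _)⟩
  have hPm : ¬ P (m + 1) := by
    rintro ⟨τ, hτ⟩
    obtain ⟨i, j, k, hi, hj, hk, hh⟩ := h τ
    exact absurd hh (not_le.mpr (hτ i j k (by omega) hj hk))
  have hex : ∃ p, p < m + 1 ∧ P p ∧ ¬ P (p + 1) := by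
    by_contra hcon
    push Not at hcon
    have : ∀ p, p ≤ m + 1 → P p := by
      intro p
      induction p with
      | zero => exact fun _ => hP0
      | succ p ih => exact fun hp => hcon p (by omega) (ih (by omega))
    exact hPm (this _ le_rfl)
  obtain ⟨p, hp, ⟨τ, hτ⟩, hnP⟩ := hex
  refine ⟨τ, fun t ht ht0 => ?_⟩
  by_contra hcon
  push Not at hcon
  apply hnP
  have htn : 0 < ‖t‖ := norm_pos_iff.mpr ht0
  let u : Eu n := ‖t‖⁻¹ • t
  have hu : ‖u‖ = 1 := by
    simp [u, norm_smul, htn.ne']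
  let pp : Fin n := ⟨p, by omega⟩
  let v : Fin n → Eu n := Function.update τ pp u
  have hv : Orthonormal ℝ (({i : Fin n | (i : ℕ) ≤ p} : Set (Fin n)).domRestrict v) := by
    rw [orthonormal_iff_ite]
    rintro ⟨i, hi⟩ ⟨j, hj⟩
    have hτo := orthonormal_iff_ite.mp τ.orthonormal
    simp only [Set.mem_ofPred_eq] at hi hj
    simp only [Set.domRestrict_apply, Subtype.mk.injEq, v]
    have hz : ∀ i : Fin n, (i : ℕ) ≤ p → i ≠ pp → inner ℝ (τ i) u = (0:ℝ) := by
      intro i hi hip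
      have hlt : (i : ℕ) < p := lt_of_le_of_ne hi (fun h => hip (Fin.ext h))
      simp only [u]
      rw [inner_smul_right, ht i (by omega), mul_zero]
    by_cases h1 : i = pp <;> by_cases h2 : j = pp
    · subst h1; subst h2
      simp [hu]
    · subst h1
      rw [Function.update_self, Function.update_of_ne h2, real_inner_comm, hz j hj h2, if_neg (Ne.symm h2)]
    · subst h2
      rw [Function.update_self, Function.update_of_ne h1, hz i hi h1, if_neg h1]
    · rw [Function.update_of_ne h1, Function.update_of_ne h2]
      exact hτo i j
  obtain ⟨τ', hτ'⟩ := hv.exists_orthonormalBasis_extension_of_card_eq (by simp)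
  refine ⟨τ', fun i j k hi hj hk => ?_⟩
  rw [hτ' i (by simp; omega)]
  by_cases h1 : i = pp
  · simp only [v, h1, Function.update_self, u]
    rw [tri_smul1, abs_mul, abs_inv, abs_norm]
    have := hcon j k hj hk
    rw [inv_mul_lt_iff₀ htn]
    linarith
  · simp only [v, Function.update_of_ne h1]
    have : (i : ℕ) ≠ p := fun h => h1 (Fin.ext h)
    exact hτ i j k (by omega) hj hk

/-- Eigen-data of the Hessian of `s` at `x`. -/
def EigAt {n : ℕ} (s : Fin n → Fin n → Fin n → ℝ) (x : Eu n)
    (v : OrthonormalBasis (Fin n) ℝ (Eu n)) (μ : Fin n → ℝ) : Prop :=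
  ∀ i z, tri s x (v i) z = μ i * inner ℝ (v i) z

theorem exists_eig {n : ℕ} {s : Fin n → Fin n → Fin n → ℝ} (hs : SymmArr s) (x : Eu n) :
    ∃ (v : OrthonormalBasis (Fin n) ℝ (Eu n)) (μ : Fin n → ℝ),
      (∀ i j, i ≤ j → |μ j| ≤ |μ i|) ∧ EigAt s x v μ := by
  let M : Matrix (Fin n) (Fin n) ℝ := Matrix.of fun k j => ∑ i, s i j k * x i
  have hM : M.IsHermitian := by
    ext k j
    simp only [M, Matrix.conjTranspose_apply, Matrix.of_apply, star_trivial]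
    refine Finset.sum_congr rfl fun i _ => ?_
    rw [(hs i k j).2]
  have hmain : EigAt s x hM.eigenvectorBasis hM.eigenvalues := by
    intro i z
    have h := hM.mulVec_eigenvectorBasis i
    have h2 : ∀ k, ∑ j, (∑ l, s l j k * x l) * hM.eigenvectorBasis i j
        = hM.eigenvalues i * hM.eigenvectorBasis i k := by
      intro k
      have := congrFun h k
      simpa [Matrix.mulVec, dotProduct, M] using this
    calc tri s x (hM.eigenvectorBasis i) z
        = ∑ k, (∑ j, (∑ l, s l j k * x l) * hM.eigenvectorBasis i j) * z k := by
          unfold tri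
          simp only [Finset.sum_mul]
          refine (Finset.sum_congr rfl fun i _ => Finset.sum_comm).trans ?_
          rw [Finset.sum_comm]
          refine Finset.sum_congr rfl fun k _ => ?_
          rw [Finset.sum_comm]
      _ = _ := by
          simp only [h2, PiLp.inner_apply, Finset.mul_sum]
          refine Finset.sum_congr rfl fun k _ => ?_
          simp
          ring
  let π : Equiv.Perm (Fin n) := Tuple.sort (fun i => - |hM.eigenvalues i|)
  have hmono := Tuple.monotone_sort (fun i => - |hM.eigenvalues i|)
  refine ⟨hM.eigenvectorBasis.reindex π.symm, fun i => hM.eigenvalues (π i), ?_, ?_⟩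
  · intro i j hij
    have := hmono hij
    simpa using this
  · intro i z
    simpa using hmain (π i) z

theorem eig_bound {n : ℕ} {s : Fin n → Fin n → Fin n → ℝ} (hs : ∀ i j k, |s i j k| ≤ 1) {x : Eu n}
    {v : OrthonormalBasis (Fin n) ℝ (Eu n)} {μ : Fin n → ℝ} (h : EigAt s x v μ) (i : Fin n) :
    |μ i| ≤ (n : ℝ) ^ 3 * ‖x‖ := by
  have h1 := h i (v i)
  have h2 := tri_bound hs x (v i) (v i)
  rw [h1] at h2
  simpa using h2

theorem inner_onb_le {n : ℕ} (v w : OrthonormalBasis (Fin n) ℝ (Eu n)) (i j : Fin n) :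
    |inner ℝ (v i) (w j)| ≤ (1:ℝ) := by
  have := abs_real_inner_le_norm (v i) (w j)
  simpa using this

theorem inner_onb_le' {n : ℕ} (v : OrthonormalBasis (Fin n) ℝ (Eu n)) (i : Fin n) (z : Eu n) :
    |inner ℝ (v i) z| ≤ ‖z‖ := by
  have := abs_real_inner_le_norm (v i) z
  simpa using this

theorem sum_fin_le {n : ℕ} (S : Finset (Fin n)) (f : Fin n → ℝ) (c : ℝ) (hc : 0 ≤ c)
    (h : ∀ i ∈ S, f i ≤ c) : ∑ i ∈ S, f i ≤ n * c := by
  calc ∑ i ∈ S, f i ≤ ∑ i ∈ S, c := Finset.sum_le_sum h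
    _ = S.card * c := by simp
    _ ≤ n * c := by
      gcongr
      simpa using Finset.card_le_univ S

theorem norm_sum_onb_le {n : ℕ} (v : OrthonormalBasis (Fin n) ℝ (Eu n)) (S : Finset (Fin n))
    (c : Fin n → ℝ) : ‖∑ i ∈ S, c i • v i‖ ≤ ∑ i ∈ S, |c i| := by
  refine (norm_sum_le _ _).trans (Finset.sum_le_sum fun i _ => ?_)
  simp [norm_smul]

theorem proj_lemma {n : ℕ} {s : Fin n → Fin n → Fin n → ℝ} (hs : SymmArr s)
    (hs1 : ∀ i j k, |s i j k| ≤ 1) (b : ℕ) (e g ρ : ℝ) (he : 0 ≤ e) (hg : 0 < g) (hρ : 0 ≤ ρ)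
    {x0 x : Eu n} {β v : OrthonormalBasis (Fin n) ℝ (Eu n)} {μ0 μ : Fin n → ℝ}
    (h0 : EigAt s x0 β μ0) (hx : EigAt s x v μ)
    (h0e : ∀ i : Fin n, b ≤ (i : ℕ) → |μ0 i| ≤ e)
    (hxe : ∀ i : Fin n, b ≤ (i : ℕ) → |μ i| ≤ e)
    (hxg : ∀ i : Fin n, (i : ℕ) < b → g ≤ |μ i|)
    (hd : ‖x - x0‖ ≤ ρ) (j : Fin n) (hj : b ≤ (j : ℕ)) :
    ∃ w : Eu n, ‖β j - w‖ ≤ n * ((e + (n : ℝ) ^ 3 * ρ) / g) ∧ ‖w‖ ≤ n ∧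
      ∀ z, |tri s x w z| ≤ n * (e * ‖z‖) := by
  classical
  let S : Finset (Fin n) := Finset.univ.filter fun i => b ≤ (i : ℕ)
  refine ⟨∑ i ∈ S, inner ℝ (v i) (β j) • v i, ?_, ?_, ?_⟩
  · have hsum : β j - ∑ i ∈ S, inner ℝ (v i) (β j) • v i
        = ∑ i ∈ Finset.univ.filter (fun i : Fin n => ¬ b ≤ (i : ℕ)), inner ℝ (v i) (β j) • v i := by
      rw [sub_eq_iff_eq_add, add_comm, Finset.sum_filter_add_sum_filter_not, v.sum_repr']
    rw [hsum]
    refine (norm_sum_onb_le v _ _).trans (sum_fin_le _ _ _ (by positivity) fun i hi => ?_)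
    simp only [Finset.mem_filter, Finset.mem_univ, true_and, not_le] at hi
    rw [le_div_iff₀ hg]
    have h1 : μ i * inner ℝ (v i) (β j) = μ0 j * inner ℝ (β j) (v i) + tri s (x - x0) (v i) (β j) := by
      rw [← hx i (β j), ← h0 j (v i), tri_swap23 hs x0 (β j) (v i), tri_sub1]
      ring
    have h2 : |μ0 j * inner ℝ (β j) (v i)| ≤ e := by
      rw [abs_mul]
      calc _ ≤ e * 1 := mul_le_mul (h0e j hj) (inner_onb_le _ _ _ _) (abs_nonneg _) he
        _ = e := mul_one e
    have h3 : |tri s (x - x0) (v i) (β j)| ≤ (n : ℝ) ^ 3 * ρ := by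
      refine (tri_bound hs1 _ _ _).trans ?_
      simp only [OrthonormalBasis.norm_eq_one, mul_one]
      gcongr
    calc |inner ℝ (v i) (β j)| * g ≤ |inner ℝ (v i) (β j)| * |μ i| := by
          gcongr
          exact hxg i hi
      _ = |μ i * inner ℝ (v i) (β j)| := by rw [abs_mul, mul_comm]
      _ ≤ _ := by
          rw [h1]
          exact (abs_add_le _ _).trans (add_le_add h2 h3)
  · refine (norm_sum_onb_le v _ _).trans ?_
    refine (sum_fin_le _ _ 1 zero_le_one fun i _ => inner_onb_le _ _ _ _).trans (by simp)
  · intro z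
    rw [tri_swap12 hs, tri_sum1]
    refine (Finset.abs_sum_le_sum_abs _ _).trans (sum_fin_le _ _ _ (by positivity) fun i hi => ?_)
    simp only [S, Finset.mem_filter, Finset.mem_univ, true_and] at hi
    rw [tri_smul1, tri_swap12 hs, hx i z, abs_mul, abs_mul]
    calc _ ≤ 1 * (e * ‖z‖) := by
          gcongr
          · exact inner_onb_le _ _ _ _
          · exact hxe i hi
          · exact inner_onb_le' _ _ _
      _ = _ := one_mul _

theorem step_dist {n : ℕ} {s : Fin n → Fin n → Fin n → ℝ} (hs : SymmArr s)
    (hs1 : ∀ i j k, |s i j k| ≤ 1) (b m : ℕ) (e g ρ κ : ℝ) (he : 0 ≤ e) (hg : 0 < g) (hρ : 0 ≤ ρ)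
    (hκ : 0 < κ)
    {x0 x x' : Eu n} {β v v' τ : OrthonormalBasis (Fin n) ℝ (Eu n)} {μ0 μ μ' : Fin n → ℝ}
    (h0 : EigAt s x0 β μ0) (hx : EigAt s x v μ) (hx' : EigAt s x' v' μ')
    (h0e : ∀ i : Fin n, b ≤ (i : ℕ) → |μ0 i| ≤ e)
    (hxe : ∀ i : Fin n, b ≤ (i : ℕ) → |μ i| ≤ e)
    (hxg : ∀ i : Fin n, (i : ℕ) < b → g ≤ |μ i|)
    (hxe' : ∀ i : Fin n, b ≤ (i : ℕ) → |μ' i| ≤ e)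
    (hxg' : ∀ i : Fin n, (i : ℕ) < b → g ≤ |μ' i|)
    (hd : ‖x - x0‖ ≤ ρ) (hd' : ‖x' - x0‖ ≤ ρ)
    (hη : (n : ℝ) ^ 3 * (n + 1) * (n * ((e + (n : ℝ) ^ 3 * ρ) / g)) ≤ κ / 2)
    (hT : ∀ t : Eu n, (∀ i : Fin n, (i : ℕ) < m → inner ℝ (τ i) t = (0:ℝ)) → t ≠ 0 →
      ∃ j k : Fin n, b ≤ (j : ℕ) ∧ b ≤ (k : ℕ) ∧ κ * ‖t‖ ≤ |tri s t (β j) (β k)|) :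
    κ * ‖x - x'‖ ≤ 2 * ((κ + (n : ℝ) ^ 3) *
      (∑ i ∈ Finset.univ.filter (fun i : Fin n => (i : ℕ) < m), |inner ℝ (τ i) (x - x')|)
        + 2 * (n : ℝ) ^ 2 * e) := by
  classical
  set t := x - x' with ht
  set η := n * ((e + (n : ℝ) ^ 3 * ρ) / g) with hηd
  have hη0 : 0 ≤ η := by positivity
  have hA : ∀ j k : Fin n, b ≤ (j : ℕ) → b ≤ (k : ℕ) →
      |tri s t (β j) (β k)| ≤ 2 * (n : ℝ) ^ 2 * e + κ / 2 * ‖t‖ := by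
    intro j k hj hk
    obtain ⟨w, hw1, hw2, hw3⟩ := proj_lemma hs hs1 b e g ρ he hg hρ h0 hx h0e hxe hxg hd j hj
    obtain ⟨w', hw1', hw2', hw3'⟩ := proj_lemma hs hs1 b e g ρ he hg hρ h0 hx' h0e hxe' hxg' hd' k hk
    have e1 : tri s t (β j) (β k) = tri s t (β j - w) (β k) + tri s t w (β k - w') + (tri s x w w' - tri s x' w w') := by
      rw [tri_sub2, tri_sub3, ← tri_sub1]
      ring
    have b1 : |tri s t (β j - w) (β k)| ≤ (n : ℝ) ^ 3 * ‖t‖ * η := by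
      refine (tri_bound hs1 _ _ _).trans ?_
      simp only [OrthonormalBasis.norm_eq_one, mul_one]
      gcongr
    have b2 : |tri s t w (β k - w')| ≤ (n : ℝ) ^ 3 * ‖t‖ * n * η := by
      refine (tri_bound hs1 _ _ _).trans ?_
      gcongr
    have b3 : |tri s x w w'| ≤ n * (e * n) := by
      refine (hw3 w').trans ?_
      gcongr
    have b4 : |tri s x' w w'| ≤ n * (e * n) := by
      rw [tri_swap23 hs]
      refine (hw3' w).trans ?_
      gcongr
    have b5 : (n : ℝ) ^ 3 * (n + 1) * η * ‖t‖ ≤ κ / 2 * ‖t‖ := by gcongr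
    rw [e1]
    have c1 := abs_add_le (tri s t (β j - w) (β k) + tri s t w (β k - w')) (tri s x w w' - tri s x' w w')
    have c2 := abs_add_le (tri s t (β j - w) (β k)) (tri s t w (β k - w'))
    have c3 := abs_sub (tri s x w w') (tri s x' w w')
    nlinarith
  set p : Eu n := ∑ i ∈ Finset.univ.filter (fun i : Fin n => (i : ℕ) < m), inner ℝ (τ i) t • τ i with hp
  set Sg := ∑ i ∈ Finset.univ.filter (fun i : Fin n => (i : ℕ) < m), |inner ℝ (τ i) t| with hS
  have hpn : ‖p‖ ≤ Sg := norm_sum_onb_le τ _ _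
  have hS0 : 0 ≤ Sg := Finset.sum_nonneg fun _ _ => abs_nonneg _
  have htq : ‖t‖ ≤ Sg + ‖t - p‖ := by
    calc ‖t‖ = ‖p + (t - p)‖ := by congr 1; abel
      _ ≤ ‖p‖ + ‖t - p‖ := norm_add_le _ _
      _ ≤ _ := by gcongr
  have hperp : ∀ i : Fin n, (i : ℕ) < m → inner ℝ (τ i) (t - p) = (0:ℝ) := by
    intro i hi
    rw [inner_sub_right, hp, inner_sum]
    simp only [inner_smul_right, orthonormal_iff_ite.mp τ.orthonormal]
    simp [hi]
  have hn3 : (0:ℝ) ≤ (n : ℝ) ^ 3 := by positivity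
  have hq : κ * ‖t - p‖ ≤ 2 * (n : ℝ) ^ 2 * e + κ / 2 * ‖t‖ + (n : ℝ) ^ 3 * Sg := by
    by_cases hz : t - p = 0
    · rw [hz]; simp only [norm_zero, mul_zero]; positivity
    · obtain ⟨j, k, hj, hk, hjk⟩ := hT (t - p) hperp hz
      refine hjk.trans ?_
      rw [tri_sub1]
      refine (abs_sub _ _).trans (add_le_add (hA j k hj hk) ?_)
      refine (tri_bound hs1 _ _ _).trans ?_
      simp only [OrthonormalBasis.norm_eq_one, mul_one]
      gcongr
  have : κ * ‖t‖ ≤ κ * (Sg + ‖t - p‖) := by gcongr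
  nlinarith

/-- `D` is covered by at most `N` cells of diameter at most `r`. -/
def Cov {n : ℕ} (D : Set (Eu n)) (N r : ℝ) : Prop :=
  ∃ (ι : Type) (_ : Fintype ι) (f : Eu n → ι), (Fintype.card ι : ℝ) ≤ N ∧
    ∀ x ∈ D, ∀ y ∈ D, f x = f y → ‖x - y‖ ≤ r

theorem Cov.mono {n : ℕ} {D : Set (Eu n)} {N N' r : ℝ} (h : Cov D N r) (hN : N ≤ N') : Cov D N' r := by
  obtain ⟨ι, hι, f, h1, h2⟩ := h
  exact ⟨ι, hι, f, h1.trans hN, h2⟩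

theorem Cov.trans {n : ℕ} {D : Set (Eu n)} {N N' r r' : ℝ} (h : Cov D N r) (hN' : 0 ≤ N')
    (h' : ∀ D' ⊆ D, (∀ x ∈ D', ∀ y ∈ D', ‖x - y‖ ≤ r) → Cov D' N' r') : Cov D (N * N') r' := by
  obtain ⟨ι, hι, f, h1, h2⟩ := h
  have h3 : ∀ i : ι, Cov {x | x ∈ D ∧ f x = i} N' r' := by
    intro i
    refine h' _ (fun x hx => hx.1) ?_
    intro x hx y hy
    exact h2 x hx.1 y hy.1 (hx.2.trans hy.2.symm)
  choose κ hκ g hg1 hg2 using h3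
  refine ⟨Σ i, κ i, inferInstance, fun x => ⟨f x, g (f x) x⟩, ?_, ?_⟩
  · rw [Fintype.card_sigma]
    push_cast
    calc ∑ i, (Fintype.card (κ i) : ℝ) ≤ ∑ i : ι, N' := Finset.sum_le_sum fun i _ => hg1 i
      _ = Fintype.card ι * N' := by simp
      _ ≤ N * N' := by gcongr
  · intro x hx y hy hxy
    rw [Sigma.mk.injEq] at hxy
    obtain ⟨h4, h5⟩ := hxy
    refine hg2 (f x) x ⟨hx, rfl⟩ y ⟨hy, h4.symm⟩ ?_
    rw [← h4] at h5
    exact eq_of_heq h5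

theorem grid1 {X : Type*} (φ : X → ℝ) (D : Set X) (R θ : ℝ) (hR : 0 ≤ R) (hθ : 0 < θ)
    (hD : ∀ x ∈ D, ∀ y ∈ D, |φ x - φ y| ≤ R) :
    ∃ (M : ℕ) (f : X → Fin M), (M : ℝ) ≤ 2 * R / θ + 1 ∧
      ∀ x ∈ D, ∀ y ∈ D, f x = f y → |φ x - φ y| ≤ θ := by
  rcases D.eq_empty_or_nonempty with rfl | ⟨x0, hx0⟩
  · refine ⟨1, fun _ => 0, ?_, by simp⟩
    have : 0 ≤ 2 * R / θ := by positivity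
    push_cast
    linarith
  · refine ⟨⌊2 * R / θ⌋₊ + 1, fun x => Fin.ofNat _ ⌊(φ x - φ x0 + R) / θ⌋₊, ?_, ?_⟩
    · push_cast
      have := Nat.floor_le (show 0 ≤ 2 * R / θ by positivity)
      linarith
    · have hb : ∀ x ∈ D, 0 ≤ (φ x - φ x0 + R) / θ ∧ ⌊(φ x - φ x0 + R) / θ⌋₊ < ⌊2 * R / θ⌋₊ + 1 := by
        intro x hx
        have h1 := abs_le.mp (hD x hx x0 hx0)
        refine ⟨div_nonneg (by linarith) hθ.le, ?_⟩
        rw [Nat.lt_succ_iff]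
        apply Nat.floor_le_floor
        gcongr
        linarith
      intro x hx y hy hxy
      obtain ⟨a1, a2⟩ := hb x hx
      obtain ⟨b1, b2⟩ := hb y hy
      have h3 : ⌊(φ x - φ x0 + R) / θ⌋₊ = ⌊(φ y - φ x0 + R) / θ⌋₊ := by
        have := congrArg Fin.val hxy
        simpa [Fin.ofNat, Nat.mod_eq_of_lt a2, Nat.mod_eq_of_lt b2] using this
      have c1 := Nat.floor_le a1
      have c2 := Nat.lt_floor_add_one ((φ x - φ x0 + R) / θ)
      have d1 := Nat.floor_le b1
      have d2 := Nat.lt_floor_add_one ((φ y - φ x0 + R) / θ)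
      rw [h3] at c1 c2
      have h4 : |(φ x - φ x0 + R) / θ - (φ y - φ x0 + R) / θ| ≤ 1 := by
        rw [abs_le]; constructor <;> linarith
      have h5 : (φ x - φ x0 + R) / θ - (φ y - φ x0 + R) / θ = (φ x - φ y) / θ := by ring
      rw [h5, abs_div, abs_of_pos hθ, div_le_one hθ] at h4
      exact h4

theorem grid {X : Type*} {ι : Type} [Fintype ι] (φ : ι → X → ℝ) (D : Set X) (R θ : ι → ℝ)
    (hR : ∀ i, 0 ≤ R i) (hθ : ∀ i, 0 < θ i)
    (hD : ∀ i, ∀ x ∈ D, ∀ y ∈ D, |φ i x - φ i y| ≤ R i) :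
    ∃ (κ : Type) (_ : Fintype κ) (f : X → κ), (Fintype.card κ : ℝ) ≤ ∏ i, (2 * R i / θ i + 1) ∧
      ∀ x ∈ D, ∀ y ∈ D, f x = f y → ∀ i, |φ i x - φ i y| ≤ θ i := by
  classical
  have h := fun i => grid1 (φ i) D (R i) (θ i) (hR i) (hθ i) (hD i)
  choose M f h1 h2 using h
  refine ⟨∀ i, Fin (M i), inferInstance, fun x i => f i x, ?_, ?_⟩
  · rw [Fintype.card_pi]
    push_cast
    refine Finset.prod_le_prod (fun i _ => by positivity) fun i _ => ?_
    simpa using h1 i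
  · intro x hx y hy hxy i
    exact h2 i x hx y hy (congrFun hxy i)

theorem norm_le_sum_onb {n : ℕ} (v : OrthonormalBasis (Fin n) ℝ (Eu n)) (x : Eu n) :
    ‖x‖ ≤ ∑ i, |inner ℝ (v i) x| := by
  conv_lhs => rw [← v.sum_repr' x]
  exact norm_sum_onb_le v _ _

theorem cov_generic {n : ℕ} (hn : 0 < n) (D : Set (Eu n)) (R r : ℝ) (hR : 0 ≤ R) (hr : 0 < r)
    (hD : ∀ x ∈ D, ∀ y ∈ D, ‖x - y‖ ≤ R) : Cov D ((2 * n * (R / r) + 1) ^ n) r := by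
  have hn' : (0:ℝ) < n := by exact_mod_cast hn
  let v : OrthonormalBasis (Fin n) ℝ (Eu n) := EuclideanSpace.basisFun (Fin n) ℝ
  obtain ⟨κ, hκ, f, h1, h2⟩ := grid (fun i x => inner ℝ (v i) x) D (fun _ => R) (fun _ => r / n)
    (fun _ => hR) (fun _ => by positivity) (by
      intro i x hx y hy
      rw [← inner_sub_right]
      exact (inner_onb_le' v i _).trans (hD x hx y hy))
  refine ⟨κ, hκ, f, h1.trans (le_of_eq ?_), ?_⟩
  · simp only [Finset.prod_const, Finset.card_univ, Fintype.card_fin]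
    congr 1
    field_simp
  · intro x hx y hy hxy
    refine (norm_le_sum_onb v _).trans ?_
    calc _ ≤ ∑ i : Fin n, r / n := Finset.sum_le_sum fun i _ => by
            rw [inner_sub_right]; exact h2 x hx y hy hxy i
      _ = r := by simp; field_simp

theorem step_cov {n : ℕ} (hn : 0 < n) (K1 : Set (Fin n → Fin n → Fin n → ℝ)) (hK : IsCompact K1)
    (hsym : ∀ s ∈ K1, SymmArr s) (hbd : ∀ s ∈ K1, ∀ i j k, |s i j k| ≤ 1)
    (σ b : ℕ) (hs : ∀ s ∈ K1, onePlusDimSing s ≤ ((σ : ℕ) : WithBot ℕ∞)) :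
    ∃ C : ℝ, 1 ≤ C ∧ ∀ s ∈ K1, ∀ e g : ℝ, 0 < e → e ≤ g → ∀ D : Set (Eu n),
      (∀ x ∈ D, ∀ y ∈ D, ‖x - y‖ ≤ g) →
      (∀ x ∈ D, ∃ v μ, EigAt s x v μ ∧ (∀ i : Fin n, b ≤ (i : ℕ) → |μ i| ≤ e) ∧
        (e < g → ∀ i : Fin n, (i : ℕ) < b → g / 2 ≤ |μ i|)) →
      Cov D (C * (g / e) ^ (σ + b)) e := by
  have hn' : (1:ℝ) ≤ n := by exact_mod_cast hn
  have hgen : ∀ (e g : ℝ), 0 < e → e ≤ g → ∀ D : Set (Eu n),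
      (∀ x ∈ D, ∀ y ∈ D, ‖x - y‖ ≤ g) → Cov D (((2 * n + 1) * (g / e)) ^ n) e := by
    intro e g he heg D hD
    refine (cov_generic hn D g e (he.le.trans heg) he hD).mono ?_
    have : 1 ≤ g / e := (one_le_div he).mpr heg
    have h0 : 0 ≤ g / e := by linarith
    gcongr
    nlinarith
  by_cases hb : σ + b < n
  swap
  · refine ⟨(2 * n + 1) ^ n, one_le_pow₀ (by linarith), ?_⟩
    intro s _ e g he heg D hD _
    refine (hgen e g he heg D hD).mono ?_
    have : 1 ≤ g / e := (one_le_div he).mpr heg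
    rw [mul_pow]
    gcongr
    omega
  obtain ⟨κ, hκ, hκ2⟩ := exists_kappa K1 hK σ b hb hs
  obtain ⟨Z, hZ⟩ : ∃ Z : ℝ, Z = 4 * ((n:ℝ) ^ 3 * (n + 1) * n * (1 + (n:ℝ) ^ 3)) := ⟨_, rfl⟩
  have hZ0 : 0 < Z := by rw [hZ]; positivity
  obtain ⟨ζ, hζ⟩ : ∃ ζ : ℝ, ζ = min 1 (κ / Z) := ⟨_, rfl⟩
  have hζ0 : 0 < ζ := by rw [hζ]; positivity
  have hζ1 : ζ ≤ 1 := by rw [hζ]; exact min_le_left _ _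
  have hζZ : Z * ζ ≤ κ := by
    have : ζ ≤ κ / Z := by rw [hζ]; exact min_le_right _ _
    rw [le_div_iff₀ hZ0] at this
    linarith
  obtain ⟨C2, hC2⟩ : ∃ C2 : ℝ, C2 = 2 * ((κ + (n : ℝ) ^ 3) * n + 2 * (n:ℝ) ^ 2) / κ := ⟨_, rfl⟩
  have hC20 : 0 < C2 := by rw [hC2]; positivity
  obtain ⟨N1, hN1⟩ : ∃ N1 : ℝ, N1 = (2 * n * (1 / ζ) + 1) ^ n := ⟨_, rfl⟩
  have hN10 : 0 < N1 := by rw [hN1]; positivity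
  obtain ⟨N3, hN3⟩ : ∃ N3 : ℝ, N3 = (2 * n * C2 + 1) ^ n := ⟨_, rfl⟩
  have hN30 : 0 < N3 := by rw [hN3]; positivity
  refine ⟨1 + N1 * (3 ^ (σ + b) * N3) + ((2 * n + 1) * (1 / ζ)) ^ n, ?_, ?_⟩
  · have : 0 ≤ N1 * (3 ^ (σ + b) * N3) := by positivity
    have : 0 ≤ ((2 * (n:ℝ) + 1) * (1 / ζ)) ^ n := by positivity
    linarith
  intro s hsK e g he heg D hD hE
  have hg : 0 < g := lt_of_lt_of_le he heg
  have hq : 1 ≤ g / e := (one_le_div he).mpr heg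
  have hqp : 1 ≤ (g / e) ^ (σ + b) := one_le_pow₀ hq
  have hnn1 : 0 ≤ N1 * (3 ^ (σ + b) * N3) := by positivity
  have hnn2 : 0 ≤ ((2 * (n:ℝ) + 1) * (1 / ζ)) ^ n := by positivity
  by_cases hcase : ζ * g ≤ e
  · refine (hgen e g he heg D hD).mono ?_
    have h1 : g / e ≤ 1 / ζ := by
      rw [div_le_div_iff₀ he hζ0]; linarith
    calc ((2 * (n:ℝ) + 1) * (g / e)) ^ n ≤ ((2 * (n:ℝ) + 1) * (1 / ζ)) ^ n := by gcongr
      _ ≤ (1 + N1 * (3 ^ (σ + b) * N3) + ((2 * n + 1) * (1 / ζ)) ^ n) * 1 := by linarith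
      _ ≤ _ := by gcongr
  push Not at hcase
  have hlt : e < g := lt_of_lt_of_le hcase (by nlinarith)
  have hcov1 : Cov D N1 (ζ * g) := by
    have := cov_generic hn D g (ζ * g) hg.le (by positivity) hD
    refine this.mono (le_of_eq ?_)
    rw [hN1]
    congr 3
    field_simp
  have hcov : Cov D (N1 * ((3 * (g / e)) ^ (σ + b) * N3)) e := by
    refine hcov1.trans (by positivity) ?_
    intro D' hD' hd
    have hcov2 : Cov D' ((3 * (g / e)) ^ (σ + b)) (C2 * e) := by
      rcases D'.eq_empty_or_nonempty with rfl | ⟨x0, hx0⟩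
      · refine ⟨Unit, inferInstance, fun _ => (), ?_, by simp⟩
        simp only [Fintype.card_unit, Nat.cast_one]
        exact one_le_pow₀ (by linarith)
      obtain ⟨β, μ0, h0, h0e, h0g⟩ := hE x0 (hD' hx0)
      obtain ⟨τ, hτ⟩ := exists_T s (σ + b) b hb κ β (fun τ => hκ2 s hsK τ β)
      obtain ⟨ι, hι, f, hf1, hf2⟩ := grid (ι := {i : Fin n // (i : ℕ) < σ + b})
        (fun i x => inner ℝ (τ i) x) D' (fun _ => g) (fun _ => e) (fun _ => hg.le) (fun _ => he) (by
          intro i x hx y hy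
          rw [← inner_sub_right]
          exact (inner_onb_le' τ i _).trans (hD x (hD' hx) y (hD' hy)))
      refine ⟨ι, hι, f, hf1.trans ?_, ?_⟩
      · have hcard : Fintype.card {i : Fin n // (i : ℕ) < σ + b} = σ + b := by
          rw [Fintype.card_subtype]
          have : (Finset.univ.filter fun i : Fin n => (i : ℕ) < σ + b) = Finset.Iio (⟨σ + b, hb⟩ : Fin n) := by
            ext i; simp [Fin.lt_def]
          rw [this, Fin.card_Iio]
        rw [Finset.prod_const, Finset.card_univ, hcard]
        gcongr
        rw [mul_div_assoc]
        linarith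
      · intro x hx y hy hxy
        obtain ⟨v, μ, hx1, hx2, hx3⟩ := hE x (hD' hx)
        obtain ⟨v', μ', hy1, hy2, hy3⟩ := hE y (hD' hy)
        have hη : (n : ℝ) ^ 3 * (n + 1) * (n * ((e + (n : ℝ) ^ 3 * (ζ * g)) / (g / 2))) ≤ κ / 2 := by
          have h1 : (e + (n : ℝ) ^ 3 * (ζ * g)) / (g / 2) ≤ 2 * ζ * (1 + (n : ℝ) ^ 3) := by
            rw [div_le_iff₀ (by positivity)]
            nlinarith
          calc (n : ℝ) ^ 3 * (n + 1) * (n * ((e + (n : ℝ) ^ 3 * (ζ * g)) / (g / 2)))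
              ≤ (n : ℝ) ^ 3 * (n + 1) * (n * (2 * ζ * (1 + (n : ℝ) ^ 3))) := by gcongr
            _ = Z * ζ / 2 := by rw [hZ]; ring
            _ ≤ κ / 2 := by linarith
        have hmain := step_dist (hsym s hsK) (hbd s hsK) b (σ + b) e (g / 2) (ζ * g) κ he.le
          (by positivity) (by positivity) hκ h0 hx1 hy1 h0e hx2 (hx3 hlt) hy2 (hy3 hlt)
          (hd x hx x0 hx0) (hd y hy x0 hx0) hη hτ
        have hsum : (∑ i ∈ Finset.univ.filter (fun i : Fin n => (i : ℕ) < σ + b),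
            |inner ℝ (τ i) (x - y)|) ≤ n * e := by
          refine sum_fin_le _ _ _ he.le fun i hi => ?_
          simp only [Finset.mem_filter, Finset.mem_univ, true_and] at hi
          rw [inner_sub_right]
          exact hf2 x hx y hy hxy ⟨i, hi⟩
        rw [hC2, div_mul_eq_mul_div, le_div_iff₀ hκ]
        have h5 : (κ + (n : ℝ) ^ 3) * (∑ i ∈ Finset.univ.filter (fun i : Fin n => (i : ℕ) < σ + b),
            |inner ℝ (τ i) (x - y)|) ≤ (κ + (n : ℝ) ^ 3) * (n * e) := by gcongr
        nlinarith
    refine hcov2.trans hN30.le ?_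
    intro D'' hD'' hd''
    have := cov_generic hn D'' (C2 * e) e (by positivity) he hd''
    refine this.mono (le_of_eq ?_)
    rw [hN3]
    congr 3
    field_simp
  refine hcov.mono ?_
  rw [mul_pow]
  have : N1 * (3 ^ (σ + b) * (g / e) ^ (σ + b) * N3) = (N1 * (3 ^ (σ + b) * N3)) * (g / e) ^ (σ + b) := by ring
  rw [this]
  gcongr
  linarith

theorem class_cov {n : ℕ} (hn : 0 < n) (K1 : Set (Fin n → Fin n → Fin n → ℝ)) (hK : IsCompact K1)
    (hsym : ∀ s ∈ K1, SymmArr s) (hbd : ∀ s ∈ K1, ∀ i j k, |s i j k| ≤ 1)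
    (σ : ℕ) (hs : ∀ s ∈ K1, onePlusDimSing s ≤ ((σ : ℕ) : WithBot ℕ∞)) :
    ∃ C : ℝ, 1 ≤ C ∧ ∀ s ∈ K1, ∀ G0 : ℝ, ∀ k : Fin n → ℕ, (∀ i j, i ≤ j → k j ≤ k i) →
      1 ≤ G0 → (∀ i, (2:ℝ) ^ k i ≤ G0) → ∀ D : Set (Eu n),
      (∀ x ∈ D, ∀ y ∈ D, ‖x - y‖ ≤ G0) →
      (∀ x ∈ D, ∃ v μ, EigAt s x v μ ∧ (∀ i, |μ i| ≤ 2 ^ k i) ∧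
        (∀ i, k i ≠ 0 → 2 ^ k i / 2 ≤ |μ i|)) →
      Cov D (C * (G0 ^ σ * ∏ i, (2:ℝ) ^ k i)) (1 / 2) := by
  have hn' : (1:ℝ) ≤ n := by exact_mod_cast hn
  have hstep := fun b => step_cov hn K1 hK hsym hbd σ b hs
  choose Cb hCb1 hCb using hstep
  obtain ⟨C, hC⟩ : ∃ C : ℝ, C = 1 + ∑ b ∈ Finset.range n, Cb b := ⟨_, rfl⟩
  have hCle : ∀ b < n, Cb b ≤ C := by
    intro b hb
    have := Finset.single_le_sum (f := Cb) (fun i _ => zero_le_one.trans (hCb1 i)) (Finset.mem_range.mpr hb)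
    rw [hC]; linarith
  have hC1 : 1 ≤ C := by
    have : 0 ≤ ∑ b ∈ Finset.range n, Cb b := Finset.sum_nonneg fun i _ => zero_le_one.trans (hCb1 i)
    rw [hC]; linarith
  refine ⟨C ^ n * (5 * n) ^ n, ?_, ?_⟩
  · exact one_le_mul_of_one_le_of_one_le (one_le_pow₀ hC1) (one_le_pow₀ (by linarith))
  intro s hsK G0 k hk hG0 hkG D hD hE
  let G : ℕ → ℝ := fun j => match j with
    | 0 => G0
    | (j + 1) => if h : j < n then 2 ^ k ⟨j, h⟩ else 1
  have hGz : G 0 = G0 := rfl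
  have hGs : ∀ j (h : j < n), G (j + 1) = 2 ^ k ⟨j, h⟩ := by
    intro j h
    simp only [G, h, dif_pos]
  have hGpos : ∀ j, j ≤ n → 1 ≤ G j := by
    intro j hj
    cases j with
    | zero => exact hG0
    | succ j => rw [hGs j (by omega)]; exact one_le_pow₀ (by norm_num)
  have hGanti : ∀ j, j < n → G (j + 1) ≤ G j := by
    intro j hj
    rw [hGs j hj]
    cases j with
    | zero => exact hkG _
    | succ j =>
      rw [hGs j (by omega)]
      exact pow_le_pow_right₀ (by norm_num) (hk _ _ (by simp [Fin.le_def]))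
  have hind : ∀ j, j ≤ n →
      Cov D (C ^ j * (G0 ^ σ * ∏ i ∈ Finset.range j, G (i + 1)) / G j ^ (σ + j)) (G j) := by
    intro j
    induction j with
    | zero =>
      intro _
      refine ⟨Unit, inferInstance, fun _ => (), ?_, ?_⟩
      · have : G0 ^ σ ≠ 0 := by positivity
        simp [hGz, this]
      · intro x hx y hy _
        exact hD x hx y hy
    | succ j ih =>
      intro hj
      have hj' : j < n := hj
      have hp0 : 0 < G j := lt_of_lt_of_le one_pos (hGpos j (by omega))
      have hp1 : 0 < G (j + 1) := lt_of_lt_of_le one_pos (hGpos (j + 1) hj)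
      have hC0 : 0 < C := lt_of_lt_of_le one_pos hC1
      have := (ih (by omega)).trans (N' := C * (G j / G (j + 1)) ^ (σ + j)) (r' := G (j + 1))
        (by positivity) (by
          intro D' hD' hd
          refine (hCb j s hsK (G (j + 1)) (G j) hp1 (hGanti j hj') D' hd ?_).mono ?_
          · intro x hx
            obtain ⟨v, μ, h1, h2, h3⟩ := hE x (hD' hx)
            refine ⟨v, μ, h1, ?_, ?_⟩
            · intro i hi
              rw [hGs j hj']
              exact (h2 i).trans (pow_le_pow_right₀ (by norm_num) (hk _ _ (by simpa [Fin.le_def] using hi)))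
            · intro hlt i hi
              cases j with
              | zero => omega
              | succ j =>
                rw [hGs _ hj', hGs j (by omega)] at hlt
                rw [hGs j (by omega)]
                have hlt2 := (pow_lt_pow_iff_right₀ (by norm_num : (1:ℝ) < 2)).mp hlt
                have hle : k ⟨j, by omega⟩ ≤ k i := hk _ _ (by rw [Fin.le_def]; simp; omega)
                refine le_trans ?_ (h3 i (by omega))
                gcongr
                norm_num
          · gcongr
            exact hCle j hj')
      refine this.mono (le_of_eq ?_)
      rw [Finset.prod_range_succ, div_pow]
      field_simp
      ring
  have hfin := hind n le_rfl
  have hgn := hGpos n le_rfl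
  have hgn0 : 0 < G n := by linarith
  have hprod : ∏ i ∈ Finset.range n, G (i + 1) = ∏ i, (2:ℝ) ^ k i := by
    rw [Finset.prod_range]
    refine Finset.prod_congr rfl fun i _ => ?_
    rw [hGs i i.2]
  rw [hprod] at hfin
  have hC0 : 0 < C := lt_of_lt_of_le one_pos hC1
  have h2 := hfin.trans (N' := (5 * n * G n) ^ n) (r' := 1 / 2) (by positivity) (by
    intro D' hD' hd
    refine (cov_generic hn D' (G n) (1 / 2) (by positivity) (by norm_num) hd).mono ?_
    gcongr
    nlinarith)
  refine h2.mono ?_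
  have hA : 0 ≤ C ^ n * (5 * n) ^ n * (G0 ^ σ * ∏ i, (2:ℝ) ^ k i) := by positivity
  have hg1 : 1 ≤ G n ^ σ := one_le_pow₀ hgn
  calc C ^ n * (G0 ^ σ * ∏ i, (2:ℝ) ^ k i) / G n ^ (σ + n) * (5 * n * G n) ^ n
      = (C ^ n * (5 * n) ^ n * (G0 ^ σ * ∏ i, (2:ℝ) ^ k i)) / G n ^ σ := by
        rw [mul_pow (5 * (n:ℝ)) (G n), pow_add]
        field_simp
    _ ≤ _ := div_le_self hA hg1

/-- An integer vector seen in Euclidean space. -/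
noncomputable def toEu {n : ℕ} (x : Fin n → ℤ) : Eu n := WithLp.toLp 2 fun i => (x i : ℝ)

theorem toEu_sep {n : ℕ} (x y : Fin n → ℤ) (h : ‖toEu x - toEu y‖ ≤ 1 / 2) : x = y := by
  funext i
  have h1 := (coord_le (toEu x - toEu y) i).trans h
  simp only [toEu, PiLp.sub_apply] at h1
  have h2 : |((x i - y i : ℤ) : ℝ)| < 1 := by push_cast; linarith
  have h3 : |x i - y i| < 1 := by exact_mod_cast h2
  have := Int.abs_lt_one_iff.mp h3
  omega

theorem card_le_of_cov {n : ℕ} (D : Set (Eu n)) (N : ℝ) (h : Cov D N (1 / 2)) (S : Finset (Fin n → ℤ))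
    (hS : ∀ x ∈ S, toEu x ∈ D) : (S.card : ℝ) ≤ N := by
  obtain ⟨ι, hι, f, h1, h2⟩ := h
  refine le_trans ?_ h1
  norm_cast
  refine Finset.card_le_card_of_injOn (fun x => f (toEu x)) (t := Finset.univ) (by intro x _; simp) ?_
  intro x hx y hy hxy
  exact toEu_sep x y (h2 _ (hS x hx) _ (hS y hy) hxy)

theorem card_fiber_le {α β : Type*} [DecidableEq β] (T : Finset α) (f : α → β) (M N : ℝ) (hM : 0 ≤ M)
    (U : Finset β) (hU : ∀ p ∈ T, f p ∈ U) (hN : (U.card : ℝ) ≤ N)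
    (h : ∀ u ∈ U, ((T.filter (fun p => f p = u)).card : ℝ) ≤ M) : (T.card : ℝ) ≤ N * M := by
  rw [Finset.card_eq_sum_card_fiberwise (f := f) (t := U) (fun p hp => hU p hp)]
  push_cast
  calc _ ≤ ∑ u ∈ U, M := Finset.sum_le_sum h
    _ = U.card * M := by simp
    _ ≤ _ := by gcongr

theorem exists_dy (t : ℝ) : ∃ k : ℕ, t ≤ 2 ^ k := by
  obtain ⟨k, hk⟩ := pow_unbounded_of_one_lt t (by norm_num : (1:ℝ) < 2)
  exact ⟨k, hk.le⟩

open Classical in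
/-- Least dyadic exponent dominating `t`. -/
noncomputable def dy (t : ℝ) : ℕ := Nat.find (exists_dy t)

theorem le_dy (t : ℝ) : t ≤ 2 ^ dy t := by
  classical
  exact Nat.find_spec (exists_dy t)

theorem dy_mono {t u : ℝ} (h : t ≤ u) : dy t ≤ dy u := by
  classical
  exact Nat.find_min' (exists_dy t) (h.trans (le_dy u))

theorem dy_half {t : ℝ} (h : dy t ≠ 0) : 2 ^ dy t / 2 ≤ t := by
  classical
  obtain ⟨m, hm⟩ := Nat.exists_eq_succ_of_ne_zero h
  have h1 : ¬ t ≤ 2 ^ m := by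
    refine Nat.find_min (exists_dy t) ?_
    change m < dy t
    omega
  rw [hm, Nat.succ_eq_add_one, pow_succ]
  push Not at h1
  linarith

theorem norm_toEu_le {n : ℕ} (x : Fin n → ℤ) (B : ℝ) (h : ∀ i, |(x i : ℝ)| ≤ B) : ‖toEu x‖ ≤ n * B := by
  refine (norm_le_sum_onb (EuclideanSpace.basisFun (Fin n) ℝ) (toEu x)).trans ?_
  calc _ ≤ ∑ i : Fin n, B := Finset.sum_le_sum fun i _ => by
          simpa [EuclideanSpace.inner_single_left, toEu] using h i
    _ = _ := by simp

theorem y_count {n : ℕ} (hn : 0 < n) (s : Fin n → Fin n → Fin n → ℝ) (x : Eu n)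
    (v : OrthonormalBasis (Fin n) ℝ (Eu n)) (μ : Fin n → ℝ) (hE : EigAt s x v μ) (k : Fin n → ℕ)
    (B c : ℝ) (hB : 1 ≤ B) (hk : ∀ i, k i ≠ 0 → 2 ^ k i / 2 ≤ |μ i|)
    (hkc : ∀ i, (2:ℝ) ^ k i ≤ c * B) (S : Finset (Fin n → ℤ))
    (hS : ∀ y ∈ S, ∀ i, |(y i : ℝ)| ≤ B)
    (hS2 : ∀ y ∈ S, ∀ j, |∑ i, ∑ l, s i j l * x i * (y l : ℝ)| ≤ B) :
    (S.card : ℝ) ≤ (16 * n ^ 2 + c) ^ n * B ^ n / ∏ i, (2:ℝ) ^ k i := by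
  have hn' : (1:ℝ) ≤ n := by exact_mod_cast hn
  have key : ∀ y ∈ S, ∀ i, |inner ℝ (v i) (toEu y)| ≤ 2 * n * B / 2 ^ k i := by
    intro y hy i
    have h1 : |inner ℝ (v i) (toEu y)| ≤ n * B :=
      (inner_onb_le' v i _).trans (norm_toEu_le y B (hS y hy))
    by_cases h0 : k i = 0
    · rw [h0]; simp
      nlinarith
    · have h2 := hE i (toEu y)
      have h3 : |tri s x (v i) (toEu y)| ≤ n * B := by
        have : tri s x (v i) (toEu y) = ∑ j, v i j * ∑ p, ∑ l, s p j l * x p * (y l : ℝ) := by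
          unfold tri
          rw [Finset.sum_comm]
          refine Finset.sum_congr rfl fun j _ => ?_
          rw [Finset.mul_sum]
          refine Finset.sum_congr rfl fun p _ => ?_
          rw [Finset.mul_sum]
          refine Finset.sum_congr rfl fun l _ => ?_
          simp only [toEu]
          ring
        rw [this]
        refine (Finset.abs_sum_le_sum_abs _ _).trans ?_
        calc _ ≤ ∑ j : Fin n, B := Finset.sum_le_sum fun j _ => by
                rw [abs_mul]
                have e1 : |v i j| ≤ 1 := by
                  have := coord_le (v i) j
                  simpa using this
                calc _ ≤ 1 * B := mul_le_mul e1 (hS2 y hy j) (abs_nonneg _) zero_le_one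
                  _ = B := one_mul B
          _ = _ := by simp
      rw [h2, abs_mul] at h3
      have h4 := hk i h0
      rw [le_div_iff₀ (by positivity)]
      have := mul_le_mul_of_nonneg_right h4 (abs_nonneg (inner ℝ (v i) (toEu y)))
      linarith
  obtain ⟨κ, hκ, f, h1, h2⟩ := grid (fun i (z : Eu n) => inner ℝ (v i) z) {z | ∃ y ∈ S, toEu y = z}
    (fun i => 4 * n * B / 2 ^ k i) (fun _ => 1 / (2 * n)) (fun i => by positivity) (fun i => by positivity)
    (by
      rintro i _ ⟨y, hy, rfl⟩ _ ⟨y', hy', rfl⟩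
      have a1 := key y hy i
      have a2 := key y' hy' i
      refine (abs_sub _ _).trans ?_
      calc _ ≤ 2 * n * B / 2 ^ k i + 2 * n * B / 2 ^ k i := add_le_add a1 a2
        _ = _ := by ring)
  have hcov : Cov {z : Eu n | ∃ y ∈ S, toEu y = z} ((16 * n ^ 2 + c) ^ n * B ^ n / ∏ i, (2:ℝ) ^ k i) (1 / 2) := by
    refine ⟨κ, hκ, f, h1.trans ?_, ?_⟩
    · calc _ ≤ ∏ i, ((16 * n ^ 2 + c) * B / 2 ^ k i) := by
            refine Finset.prod_le_prod (fun i _ => by positivity) fun i _ => ?_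
            have hp : (0:ℝ) < 2 ^ k i := by positivity
            have hc1 : 1 ≤ c * B / 2 ^ k i := by rw [le_div_iff₀ hp]; linarith [hkc i]
            calc _ = 16 * n ^ 2 * B / 2 ^ k i + 1 := by field_simp; ring
              _ ≤ 16 * n ^ 2 * B / 2 ^ k i + c * B / 2 ^ k i := by linarith
              _ = _ := by ring
        _ = _ := by
            rw [Finset.prod_div_distrib]
            simp [mul_pow]
    · intro z hz z' hz' he
      refine (norm_le_sum_onb v _).trans ?_
      calc _ ≤ ∑ i : Fin n, 1 / (2 * (n:ℝ)) := Finset.sum_le_sum fun i _ => by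
              rw [inner_sub_right]; exact h2 z hz z' hz' he i
        _ = 1 / 2 := by simp; field_simp
  exact card_le_of_cov _ _ hcov S fun y hy => ⟨y, hy, rfl⟩

theorem log_count (n : ℕ) (hn : 0 < n) (ε : ℝ) (hε : 0 < ε) : ∃ E : ℝ, 0 < E ∧ ∀ G : ℝ, 1 ≤ G →
    ∃ L : ℕ, (∀ k : ℕ, (2:ℝ) ^ k ≤ G → k < L) ∧ (L : ℝ) ^ n ≤ E * G ^ ε := by
  have hn' : (0:ℝ) < n := by exact_mod_cast hn
  have hl2 : 0 < Real.log 2 := Real.log_pos (by norm_num)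
  have hδ : 0 < ε / n := by positivity
  refine ⟨(1 / (ε / n) / Real.log 2 + 1) ^ n, by positivity, fun G hG => ?_⟩
  have hG0 : 0 < G := by linarith
  have hlg : 0 ≤ Real.log G / Real.log 2 := div_nonneg (Real.log_nonneg hG) hl2.le
  refine ⟨⌊Real.log G / Real.log 2⌋₊ + 1, ?_, ?_⟩
  · intro k hk
    rw [Nat.lt_succ_iff, Nat.le_floor_iff hlg, le_div_iff₀ hl2, ← Real.log_pow]
    exact Real.log_le_log (by positivity) hk
  · have h1 : ((⌊Real.log G / Real.log 2⌋₊ + 1 : ℕ) : ℝ) ≤ (1 / (ε / n) / Real.log 2 + 1) * G ^ (ε / n) := by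
      push_cast
      have a1 := Nat.floor_le hlg
      have a2 := Real.log_le_rpow_div hG0.le hδ
      have a3 : 1 ≤ G ^ (ε / n) := Real.one_le_rpow hG hδ.le
      have a4 : Real.log G / Real.log 2 ≤ G ^ (ε / n) / (ε / n) / Real.log 2 := by gcongr
      calc _ ≤ G ^ (ε / n) / (ε / n) / Real.log 2 + G ^ (ε / n) := by linarith
        _ = _ := by ring
    calc _ ≤ ((1 / (ε / n) / Real.log 2 + 1) * G ^ (ε / n)) ^ n := by gcongr
      _ = _ := by
        rw [mul_pow, ← Real.rpow_natCast (G ^ (ε / n)), ← Real.rpow_mul hG0.le]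
        congr 2
        field_simp

theorem core_count {n : ℕ} (hn : 0 < n) (K1 : Set (Fin n → Fin n → Fin n → ℝ)) (hK : IsCompact K1)
    (hsym : ∀ s ∈ K1, SymmArr s) (hbd : ∀ s ∈ K1, ∀ i j k, |s i j k| ≤ 1)
    (σ : ℕ) (hs : ∀ s ∈ K1, onePlusDimSing s ≤ ((σ : ℕ) : WithBot ℕ∞)) (ε : ℝ) (hε : 0 < ε) :
    ∃ Cst : ℝ, 0 < Cst ∧ ∀ s ∈ K1, ∀ B : ℝ, 1 ≤ B → ∀ T : Finset ((Fin n → ℤ) × (Fin n → ℤ)),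
      (∀ p ∈ T, ∀ i, |(p.1 i : ℝ)| ≤ B) → (∀ p ∈ T, ∀ i, |(p.2 i : ℝ)| ≤ B) →
      (∀ p ∈ T, ∀ j, |∑ i, ∑ l, s i j l * (p.1 i : ℝ) * (p.2 l : ℝ)| ≤ B) →
      (T.card : ℝ) ≤ Cst * B ^ ((n : ℝ) + σ + ε) := by
  classical
  have hn' : (1:ℝ) ≤ n := by exact_mod_cast hn
  obtain ⟨C, hC1, hC⟩ := class_cov hn K1 hK hsym hbd σ hs
  obtain ⟨E, hE0, hE⟩ := log_count n hn ε hε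
  obtain ⟨c, hc⟩ : ∃ c : ℝ, c = 2 * n ^ 4 := ⟨_, rfl⟩
  have hn4 : (n:ℝ) ≤ n ^ 4 := le_self_pow₀ hn' (by norm_num)
  have hc1 : 1 ≤ c := by rw [hc]; linarith
  have hc0 : 0 < c := by linarith
  refine ⟨E * c ^ ε * (C * c ^ σ * (16 * n ^ 2 + c) ^ n), by positivity, ?_⟩
  intro s hsK B hB T hT1 hT2 hT3
  have hB0 : 0 < B := by linarith
  have hex := fun x : Fin n → ℤ => exists_eig (hsym s hsK) (toEu x)
  choose v μ hanti heig using hex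
  have hG : 1 ≤ c * B := one_le_mul_of_one_le_of_one_le hc1 hB
  obtain ⟨L, hL1, hL2⟩ := hE (c * B) hG
  let kk : (Fin n → ℤ) → Fin n → ℕ := fun x i => dy |μ x i|
  have hkk : ∀ p ∈ T, ∀ i, (2:ℝ) ^ kk p.1 i ≤ c * B := by
    intro p hp i
    by_cases h0 : kk p.1 i = 0
    · rw [h0]; simpa using hG
    · have h1 := dy_half h0
      have h2 := eig_bound (hbd s hsK) (heig p.1) i
      have h3 := norm_toEu_le p.1 B (hT1 p hp)
      have h4 : (n:ℝ) ^ 3 * ‖toEu p.1‖ ≤ n ^ 3 * (n * B) := by gcongr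
      change (2:ℝ) ^ dy |μ p.1 i| ≤ c * B
      rw [hc]
      nlinarith
  have hmain := card_fiber_le T (fun p => kk p.1)
    ((C * ((c * B) ^ σ)) * ((16 * n ^ 2 + c) ^ n * B ^ n)) (L ^ n) (by positivity)
    (Fintype.piFinset fun _ => Finset.range L)
    (by
      intro p hp
      rw [Fintype.mem_piFinset]
      intro i
      rw [Finset.mem_range]
      exact hL1 _ (hkk p hp i))
    (by rw [Fintype.card_piFinset]; simp)
    (by
      intro k _
      obtain ⟨F, hF⟩ : ∃ F, F = T.filter (fun p => kk p.1 = k) := ⟨_, rfl⟩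
      rw [← hF]
      have hFm : ∀ p ∈ F, p ∈ T ∧ kk p.1 = k := by
        intro p hp; rw [hF] at hp; simpa using hp
      rcases F.eq_empty_or_nonempty with h0 | ⟨p0, hp0⟩
      · rw [h0]; simp; positivity
      have hkc : ∀ i, (2:ℝ) ^ k i ≤ c * B := by
        intro i
        have := hkk p0 (hFm p0 hp0).1 i
        rwa [(hFm p0 hp0).2] at this
      have hkanti : ∀ i j, i ≤ j → k j ≤ k i := by
        intro i j hij
        rw [← (hFm p0 hp0).2]
        exact dy_mono (hanti p0.1 i j hij)
      have hup : ∀ p ∈ F, ∀ i, |μ p.1 i| ≤ 2 ^ k i := by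
        intro p hp i
        rw [← (hFm p hp).2]; exact le_dy _
      have hlow : ∀ p ∈ F, ∀ i, k i ≠ 0 → 2 ^ k i / 2 ≤ |μ p.1 i| := by
        intro p hp i
        rw [← (hFm p hp).2]; exact dy_half
      have hcov := hC s hsK (c * B) k hkanti hG hkc {z | ∃ p ∈ F, toEu p.1 = z}
        (by
          rintro _ ⟨p, hp, rfl⟩ _ ⟨q, hq, rfl⟩
          have a1 := norm_toEu_le p.1 B (hT1 p (hFm p hp).1)
          have a2 := norm_toEu_le q.1 B (hT1 q (hFm q hq).1)
          refine (norm_sub_le _ _).trans ?_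
          rw [hc]
          nlinarith)
        (by
          rintro _ ⟨p, hp, rfl⟩
          exact ⟨v p.1, μ p.1, heig p.1, hup p hp, hlow p hp⟩)
      have hX := card_le_of_cov _ _ hcov (F.image Prod.fst) (by
        intro x hx
        obtain ⟨p, hp, rfl⟩ := Finset.mem_image.mp hx
        exact ⟨p, hp, rfl⟩)
      have hP : (0:ℝ) < ∏ i, (2:ℝ) ^ k i := by positivity
      have := card_fiber_le F Prod.fst ((16 * n ^ 2 + c) ^ n * B ^ n / ∏ i, (2:ℝ) ^ k i) _ (by positivity)
        (F.image Prod.fst) (fun p hp => Finset.mem_image_of_mem _ hp) hX (by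
          intro x hx
          obtain ⟨p, hp, rfl⟩ := Finset.mem_image.mp hx
          have hinj : ((F.filter (fun q => q.1 = p.1)).image Prod.snd).card
              = (F.filter (fun q => q.1 = p.1)).card := by
            refine Finset.card_image_of_injOn ?_
            intro q hq r hr hqr
            simp only [Finset.coe_filter, Set.mem_setOf_eq] at hq hr
            exact Prod.ext (hq.2.trans hr.2.symm) hqr
          rw [← hinj]
          refine y_count hn s (toEu p.1) (v p.1) (μ p.1) (heig p.1) k B c hB (hlow p hp) hkc _ ?_ ?_
          · intro y hy
            obtain ⟨q, hq, rfl⟩ := Finset.mem_image.mp hy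
            exact hT2 q (hFm q (Finset.mem_filter.mp hq).1).1
          · intro y hy
            obtain ⟨q, hq, rfl⟩ := Finset.mem_image.mp hy
            have := hT3 q (hFm q (Finset.mem_filter.mp hq).1).1
            rw [(Finset.mem_filter.mp hq).2] at this
            exact this)
      refine this.trans (le_of_eq ?_)
      field_simp)
  refine hmain.trans ?_
  calc _ ≤ (E * (c * B) ^ ε) * ((C * ((c * B) ^ σ)) * ((16 * n ^ 2 + c) ^ n * B ^ n)) := by gcongr
    _ = _ := by
      rw [Real.rpow_add hB0, Real.rpow_add hB0, Real.rpow_natCast, Real.rpow_natCast,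
        Real.mul_rpow hc0.le hB0.le, mul_pow]
      ring

theorem le_cubicSup {n : ℕ} (a : Fin n → Fin n → Fin n → ℝ) (i j k : Fin n) : |a i j k| ≤ cubicSup a := by
  unfold cubicSup
  refine le_trans ?_ (le_ciSup (Set.finite_range _).bddAbove i)
  refine le_trans ?_ (le_ciSup (Set.finite_range _).bddAbove j)
  exact le_ciSup (f := fun k => |a i j k|) (Set.finite_range _).bddAbove k

theorem cubicSup_eq {n : ℕ} (hn : 0 < n) (a : Fin n → Fin n → Fin n → ℝ) : cubicSup a = ‖a‖ := by
  haveI : Nonempty (Fin n) := ⟨⟨0, hn⟩⟩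
  apply le_antisymm
  · unfold cubicSup
    refine ciSup_le fun i => ciSup_le fun j => ciSup_le fun k => ?_
    exact ((norm_le_pi_norm (a i j) k).trans (norm_le_pi_norm (a i) j)).trans (norm_le_pi_norm a i)
  · have h0 : 0 ≤ cubicSup a := (abs_nonneg _).trans (le_cubicSup a ⟨0, hn⟩ ⟨0, hn⟩ ⟨0, hn⟩)
    rw [pi_norm_le_iff_of_nonneg h0]; intro i
    rw [pi_norm_le_iff_of_nonneg h0]; intro j
    rw [pi_norm_le_iff_of_nonneg h0]; intro k
    exact le_cubicSup a i j k


/-- Proposition 2.4 of the paper: let `𝒦` be a closed cone of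
cubic forms in `n` variables, and let `σ_𝒦 = 1 + max_{c ∈ 𝒦 \ {0}} dim Sing V(c)`.
Then for every `ε > 0` there is a constant `C = C(𝒦, ε)` such that
`N^aux_c(B) ≤ C·B^{n+σ_𝒦+ε}` for all nonzero `c ∈ 𝒦` and all `B ≥ 1`. -/
theorem statement2 (n : ℕ) (K : Set (Fin n → Fin n → Fin n → ℝ))
    (hsymm : ∀ a ∈ K, ∀ i j k, a i j k = a j i k ∧ a i j k = a i k j)
    (hcone : ∀ a ∈ K, ∀ t : ℝ, 0 ≤ t → t • a ∈ K)
    (hclosed : IsClosed K)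
    (σK : ℕ)
    (hmax : ∀ a ∈ K, a ≠ 0 → onePlusDimSing a ≤ ((σK : ℕ) : WithBot ℕ∞))
    (hatt : ∃ a ∈ K, a ≠ 0 ∧ onePlusDimSing a = ((σK : ℕ) : WithBot ℕ∞)) :
    ∀ ε : ℝ, 0 < ε → ∃ Cst : ℝ, 0 < Cst ∧
      ∀ a ∈ K, a ≠ 0 → ∀ B : ℝ, 1 ≤ B →
        (NauxArr a B : ℝ) ≤ Cst * B ^ ((n : ℝ) + σK + ε) := by
  intro ε hε
  have hn : 0 < n := by
    obtain ⟨a, _, ha, _⟩ := hatt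
    rcases Nat.eq_zero_or_pos n with rfl | h
    · exact absurd (Subsingleton.elim a 0) ha
    · exact h
  have hK1 : IsCompact (K ∩ Metric.sphere 0 1) := (isCompact_sphere 0 1).inter_left hclosed
  have hnorm : ∀ s ∈ K ∩ Metric.sphere (0 : Fin n → Fin n → Fin n → ℝ) 1, ‖s‖ = 1 := by
    intro s hs
    simpa using hs.2
  obtain ⟨C, hC0, hC⟩ := core_count hn (K ∩ Metric.sphere 0 1) hK1 (fun s hs => hsymm s hs.1)
    (fun s hs i j k => by
      rw [← hnorm s hs, ← cubicSup_eq hn]; exact le_cubicSup s i j k)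
    σK (fun s hs => hmax s hs.1 (by
      intro h0
      have := hnorm s hs
      rw [h0] at this
      simp at this)) ε hε
  refine ⟨C, hC0, ?_⟩
  intro a ha ha0 B hB
  have hna : 0 < ‖a‖ := norm_pos_iff.mpr ha0
  obtain ⟨s, hs⟩ : ∃ s, s = ‖a‖⁻¹ • a := ⟨_, rfl⟩
  have hsK : s ∈ K := hs ▸ hcone a ha _ (by positivity)
  have hs1 : s ∈ K ∩ Metric.sphere 0 1 := by
    refine ⟨hsK, ?_⟩
    rw [hs]
    simp [norm_smul, hna.ne']
  unfold NauxArr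
  set P : Set ((Fin n → ℤ) × (Fin n → ℤ)) := {p | (∀ i, (|p.1 i| : ℝ) ≤ B) ∧ (∀ i, (|p.2 i| : ℝ) ≤ B) ∧
    (∀ i, |(hessArr a (fun j => (p.1 j : ℝ))).mulVec (fun j => (p.2 j : ℝ)) i| < B)} with hP
  by_cases hfin : P.Finite
  · rw [Set.ncard_eq_toFinset_card P hfin]
    refine hC s hs1 B hB hfin.toFinset ?_ ?_ ?_
    · intro p hp i
      rw [Set.Finite.mem_toFinset] at hp
      simpa using hp.1 i
    · intro p hp i
      rw [Set.Finite.mem_toFinset] at hp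
      simpa using hp.2.1 i
    · intro p hp j
      rw [Set.Finite.mem_toFinset] at hp
      have h := hp.2.2 j
      have he : (hessArr a (fun j => (p.1 j : ℝ))).mulVec (fun j => (p.2 j : ℝ)) j
          = 6 * ∑ i, ∑ l, s i j l * (p.1 i : ℝ) * (p.2 l : ℝ) := by
        rw [Finset.sum_comm, Finset.mul_sum]
        simp only [Matrix.mulVec, dotProduct, hessArr, Matrix.of_apply]
        refine Finset.sum_congr rfl fun l _ => ?_
        rw [cubicSup_eq hn, Finset.mul_sum, Finset.mul_sum, Finset.mul_sum, Finset.sum_mul]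
        refine Finset.sum_congr rfl fun i _ => ?_
        have e1 : a j l i = a i j l := by
          rw [(hsymm a ha j l i).2, (hsymm a ha j i l).1]
        rw [e1, hs]
        simp only [Pi.smul_apply, smul_eq_mul]
        ring
      rw [he, abs_mul, abs_of_pos (by norm_num : (0:ℝ) < 6)] at h
      have := abs_nonneg (∑ i, ∑ l, s i j l * (p.1 i : ℝ) * (p.2 l : ℝ))
      linarith
  · rw [Set.Infinite.ncard hfin]
    simp
    positivity
end

section
/- Let c_1, …, c_R be cubic forms in n variables with integer coefficients which are linearly independent, generate the homogeneous ideal of V(c_1,…,c_R) ⊆ ℙ^{n−1}_ℚ, and define a smooth complete intersection. Then for every ε > 0 there is a constant C depending only on c_1,…,c_R and ε such that for every nonzero β ∈ ℝ^R and every B ≥ 1, N^aux_{β·c}(B) ≤ C·B^{n+R−1+ε}, where β·c = β_1c_1 + … + β_Rc_R. -/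
open MvPolynomial Matrix

/-- `‖c‖ = (1/6)·max_{i,j,k} |∂³c/∂x_i∂x_j∂x_k|` for a cubic form `c`. -/
noncomputable def cubicNorm {n : ℕ} (c : MvPolynomial (Fin n) ℝ) : ℝ :=
  (1 / 6) * ⨆ i : Fin n, ⨆ j : Fin n, ⨆ k : Fin n,
    |MvPolynomial.eval (0 : Fin n → ℝ) (pderiv i (pderiv j (pderiv k c)))|

/-- The normalised Hessian matrix `H_c(x)` with entries `(1/‖c‖)·∂²c(x)/∂x_i∂x_j`. -/
noncomputable def hessMat {n : ℕ} (c : MvPolynomial (Fin n) ℝ) (x : Fin n → ℝ) :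
    Matrix (Fin n) (Fin n) ℝ :=
  Matrix.of fun i j => (cubicNorm c)⁻¹ * MvPolynomial.eval x (pderiv i (pderiv j c))

/-- The counting function `N^aux_c(B)`: the number of pairs `(x, y) ∈ ℤ^n × ℤ^n`
with `‖x‖_∞ ≤ B`, `‖y‖_∞ ≤ B` and `‖H_c(x)·y‖_∞ < B`. -/
noncomputable def Naux {n : ℕ} (c : MvPolynomial (Fin n) ℝ) (B : ℝ) : ℕ :=
  Set.ncard {p : (Fin n → ℤ) × (Fin n → ℤ) |
    (∀ i, (|p.1 i| : ℝ) ≤ B) ∧ (∀ i, (|p.2 i| : ℝ) ≤ B) ∧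
    (∀ i, |(hessMat c (fun j => (p.1 j : ℝ))).mulVec (fun j => (p.2 j : ℝ)) i| < B)}


theorem exists_common_zero {ι : Type} [Fintype ι] {q : ℕ} (f : ι → MvPolynomial (Fin q) ℂ)
    (h0 : ∀ i, aeval (0 : Fin q → ℂ) (f i) = 0) (hq : Fintype.card ι < q) :
    ∃ z : Fin q → ℂ, z ≠ 0 ∧ ∀ i, aeval z (f i) = 0 := by
  classical
  by_contra hcon
  push Not at hcon
  have hdim : ringKrullDim (MvPolynomial (Fin q) ℂ) = (q : WithBot ℕ∞) := by
    rw [MvPolynomial.ringKrullDim_of_isNoetherianRing]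
    simp
  have hfin : FiniteRingKrullDim (MvPolynomial (Fin q) ℂ) := by
    rw [finiteRingKrullDim_iff_ne_bot_and_top, hdim]
    refine ⟨?_, ?_⟩
    · exact WithBot.natCast_ne_bot q
    · have : ((q : ℕ∞) : WithBot ℕ∞) ≠ ((⊤ : ℕ∞) : WithBot ℕ∞) := by
        rw [Ne, WithBot.coe_inj]; exact ENat.coe_ne_top q
      exact this
  obtain ⟨m, hm, hmh⟩ := Ideal.exists_isMaximal_height (R := MvPolynomial (Fin q) ℂ)
  obtain ⟨a, rfl⟩ := eq_vanishingIdeal_singleton_of_isMaximal ℂ hm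
  let g : ι → MvPolynomial (Fin q) ℂ := fun i => aeval (fun j => X j - C (a j)) (f i)
  have hg : ∀ i z, aeval z (g i) = aeval (z - a) (f i) := by
    intro i z
    have : (aeval z).comp (aeval (fun j => (X j - C (a j) : MvPolynomial (Fin q) ℂ)))
      = (aeval (z - a) : MvPolynomial (Fin q) ℂ →ₐ[ℂ] ℂ) := by
      ext j; simp
    exact DFunLike.congr_fun this (f i)
  have hz : zeroLocus ℂ (Ideal.span (Set.range g)) = {a} := by
    rw [zeroLocus_span]
    ext z
    simp only [Set.mem_range, forall_exists_index, forall_apply_eq_imp_iff, Set.mem_setOf_eq,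
      Set.mem_singleton_iff, hg]
    constructor
    · intro h
      by_contra hne
      obtain ⟨i, hi⟩ := hcon (z - a) (sub_ne_zero.2 hne)
      exact hi (h i)
    · rintro rfl i
      rw [sub_self]; exact h0 i
  have hrad := vanishingIdeal_zeroLocus_eq_radical (K := ℂ) (Ideal.span (Set.range g))
  rw [hz] at hrad
  have hmin : vanishingIdeal ℂ {a} ∈ (Ideal.span (Set.range g)).minimalPrimes := by
    rw [← Ideal.radical_minimalPrimes, ← hrad, Ideal.minimalPrimes_eq_subsingleton_self]
    rfl
  have h1 := Ideal.height_le_card_of_mem_minimalPrimes_span (Set.finite_range g) hmin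
  rw [hdim] at hmh
  have h2 : (vanishingIdeal ℂ {a} : Ideal (MvPolynomial (Fin q) ℂ)).height = (q : ℕ∞) := by
    exact_mod_cast hmh
  rw [h2] at h1
  have h3 : q ≤ (Set.range g).ncard := by exact_mod_cast h1
  have h4 : (Set.range g).ncard ≤ Fintype.card ι := by
    rw [← Set.image_univ]
    refine (Set.ncard_image_le Set.finite_univ).trans ?_
    rw [Set.ncard_univ, Nat.card_eq_fintype_card]
  omega

theorem pderiv_comm_aux {n : ℕ} (i j : Fin n) (c : MvPolynomial (Fin n) ℤ) :
    pderiv i (pderiv j c) = pderiv j (pderiv i c) := by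
  have h : ⁅pderiv (R := ℤ) i, pderiv j⁆ = (0 : Derivation ℤ (MvPolynomial (Fin n) ℤ) _) := by
    apply MvPolynomial.derivation_ext
    intro k
    classical
    rw [Derivation.commutator_apply]
    simp [pderiv_X, Pi.single_apply, apply_ite]
  have h2 := DFunLike.congr_fun h c
  rw [Derivation.commutator_apply] at h2
  simpa [sub_eq_zero] using h2

/-- Third derivative tensor of a cubic form. -/
noncomputable def ten {n : ℕ} (c : MvPolynomial (Fin n) ℤ) (i j k : Fin n) : ℤ :=
  coeff 0 (pderiv i (pderiv j (pderiv k c)))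

theorem ten_swap12 {n : ℕ} (c : MvPolynomial (Fin n) ℤ) (i j k : Fin n) :
    ten c i j k = ten c j i k := by
  unfold ten; rw [pderiv_comm_aux]

theorem ten_swap23 {n : ℕ} (c : MvPolynomial (Fin n) ℤ) (i j k : Fin n) :
    ten c i j k = ten c i k j := by
  unfold ten; rw [pderiv_comm_aux j k]

theorem ten_rot {n : ℕ} (c : MvPolynomial (Fin n) ℤ) (i j k : Fin n) :
    ten c k i j = ten c i j k := by
  rw [ten_swap12, ten_swap23]

theorem pderiv3_eq {n : ℕ} {c : MvPolynomial (Fin n) ℤ} (hc : c.IsHomogeneous 3) (i j k : Fin n) :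
    pderiv i (pderiv j (pderiv k c)) = C (ten c i j k) := by
  have h : (pderiv i (pderiv j (pderiv k c))).IsHomogeneous 0 :=
    ((hc.pderiv (i := k)).pderiv (i := j)).pderiv (i := i)
  rw [← totalDegree_zero_iff_isHomogeneous, totalDegree_eq_zero_iff_eq_C] at h
  exact h

theorem aeval_pderiv2 {n : ℕ} {c : MvPolynomial (Fin n) ℤ} (hc : c.IsHomogeneous 3)
    {A : Type*} [CommRing A] (z : Fin n → A) (i j : Fin n) :
    aeval z (pderiv i (pderiv j c)) = ∑ k, (ten c i j k : A) * z k := by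
  have h : (pderiv i (pderiv j c)).IsHomogeneous 1 := (hc.pderiv (i := j)).pderiv (i := i)
  have h2 := congrArg (aeval z) h.sum_X_mul_pderiv
  simp only [pderiv3_eq hc, map_sum, map_mul, aeval_X, one_smul, aeval_C] at h2
  rw [← h2]
  refine Finset.sum_congr rfl fun k _ => ?_
  rw [ten_rot, mul_comm]; simp

theorem aeval_pderiv1 {n : ℕ} {c : MvPolynomial (Fin n) ℤ} (hc : c.IsHomogeneous 3)
    {A : Type*} [CommRing A] (z : Fin n → A) (i : Fin n) :
    2 * aeval z (pderiv i c) = ∑ j, ∑ k, (ten c i j k : A) * z j * z k := by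
  have h : (pderiv i c).IsHomogeneous 2 := (hc.pderiv (i := i))
  have h2 := congrArg (aeval z) h.sum_X_mul_pderiv
  simp only [map_sum, map_mul, aeval_X, aeval_pderiv2 hc, map_nsmul] at h2
  rw [show (2 : A) * aeval z (pderiv i c) = 2 • aeval z (pderiv i c) by simp, ← h2]
  refine Finset.sum_congr rfl fun j _ => ?_
  rw [Finset.mul_sum]
  refine Finset.sum_congr rfl fun k _ => ?_
  rw [ten_swap12 c j i]; ring

theorem aeval_cubic {n : ℕ} {c : MvPolynomial (Fin n) ℤ} (hc : c.IsHomogeneous 3)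
    {A : Type*} [CommRing A] (z : Fin n → A) :
    6 * aeval z c = ∑ i, z i * ∑ j, ∑ k, (ten c i j k : A) * z j * z k := by
  have h2 := congrArg (aeval z) hc.sum_X_mul_pderiv
  simp only [map_sum, map_mul, aeval_X, map_nsmul] at h2
  simp only [← aeval_pderiv1 hc]
  have : (6 : A) * aeval z c = 2 * (3 • aeval z c) := by simp; ring
  rw [this, ← h2, Finset.mul_sum]
  refine Finset.sum_congr rfl fun j _ => ?_
  ring

theorem dot_basis_zero {n : ℕ} {ι : Type*} (b : Module.Basis ι ℝ (Fin n → ℝ)) (g : Fin n → ℂ)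
    (h : ∀ x, ∑ i, (b x i : ℂ) * g i = 0) : g = 0 := by
  have key : ∀ v : Fin n → ℝ, (∀ x, ∑ i, b x i * v i = 0) → v = 0 := by
    intro v hv
    have h1 : (Fintype.linearCombination ℝ v : (Fin n → ℝ) →ₗ[ℝ] ℝ) = 0 := by
      apply b.ext
      intro x
      simpa [Fintype.linearCombination_apply] using hv x
    funext i
    have := LinearMap.congr_fun h1 (Pi.single i 1)
    simpa using this
  have hre := key (fun i => (g i).re) (fun x => by
    have := congrArg Complex.re (h x)
    simpa using this)
  have him := key (fun i => (g i).im) (fun x => by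
    have := congrArg Complex.im (h x)
    simpa using this)
  funext i
  exact Complex.ext (congrFun hre i) (congrFun him i)

theorem complex_comb_ne_zero {n q : ℕ} (y : Fin q → Fin n → ℝ) (hy : LinearIndependent ℝ y)
    (s : Fin q → ℂ) (h : (fun i => ∑ j, s j * (y j i : ℂ)) = 0) : s = 0 := by
  rw [Fintype.linearIndependent_iff] at hy
  have hre := hy (fun j => (s j).re) (by
    funext i
    have := congrArg Complex.re (congrFun h i)
    simpa using this)
  have him := hy (fun j => (s j).im) (by
    funext i
    have := congrArg Complex.im (congrFun h i)
    simpa using this)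
  funext i
  exact Complex.ext (hre i) (him i)

theorem geom {n R : ℕ} (c : Fin R → MvPolynomial (Fin n) ℤ)
    (hdeg : ∀ r, (c r).IsHomogeneous 3)
    (hsmooth : ∀ z : Fin n → ℂ, z ≠ 0 → (∀ r, aeval z (c r) = 0) →
      (Matrix.of fun (r : Fin R) (j : Fin n) => aeval z (pderiv j (c r))).rank = R)
    (β : Fin R → ℝ) (hβ : β ≠ 0) {m q : ℕ} (hmq : n + R ≤ m + q)
    (t : Fin m → Fin n → ℝ) (y : Fin q → Fin n → ℝ) (ht : LinearIndependent ℝ t)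
    (hy : LinearIndependent ℝ y)
    (hv : ∀ a b b', ∑ i, ∑ j, ∑ k, (∑ r, β r * (ten (c r) i j k : ℝ)) * t a i * y b j * y b' k = 0) :
    False := by
  classical
  obtain ⟨r0, hr0⟩ : ∃ r0, β r0 ≠ 0 := by
    by_contra h; push Not at h; exact hβ (funext h)
  let bas := Module.Basis.sumExtend ht
  have hfinI : Fintype (Fin m ⊕ Module.Basis.sumExtendIndex ht) :=
    Module.Basis.fintypeIndexOfRankLtAleph0 bas (by simp)
  have : Finite (Module.Basis.sumExtendIndex ht) :=
    Finite.of_injective (Sum.inr : _ → Fin m ⊕ Module.Basis.sumExtendIndex ht) Sum.inr_injective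
  obtain ⟨w, ⟨e⟩⟩ := Finite.exists_equiv_fin (Module.Basis.sumExtendIndex ht)
  let bas2 := bas.reindex ((Equiv.refl (Fin m)).sumCongr e)
  have hcard : m + w = n := by
    have := Module.finrank_eq_card_basis bas2
    simp at this
    omega
  have hbas2 : ∀ a, bas2 (Sum.inl a) = t a := by
    intro a
    simp [bas2, bas, Module.Basis.sumExtend]
    rfl
  let u : Fin w → Fin n → ℝ := fun l => bas2 (Sum.inr l)
  let G : Fin n → Fin n → Fin n → ℝ := fun i j k => ∑ r, β r * (ten (c r) i j k : ℝ)
  let lin : Fin n → MvPolynomial (Fin q) ℂ := fun i => ∑ j, X j * C (y j i : ℂ)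
  let f : Fin w ⊕ {r : Fin R // r ≠ r0} → MvPolynomial (Fin q) ℂ := fun x => match x with
    | Sum.inl l => ∑ i, C (u l i : ℂ) * ∑ j, ∑ k, C (G i j k : ℂ) * lin j * lin k
    | Sum.inr r => aeval lin (c r)
  have hlin : ∀ s i, aeval s (lin i) = ∑ j, s j * (y j i : ℂ) := by
    intro s i; simp [lin]
  have hcomp : ∀ (s : Fin q → ℂ) (r : Fin R), aeval s (aeval lin (c r)) = aeval (fun i => aeval s (lin i)) (c r) := by
    intro s r
    have : ((aeval s : MvPolynomial (Fin q) ℂ →ₐ[ℂ] ℂ).restrictScalars ℤ).comp (aeval lin)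
      = (aeval (fun i => aeval s (lin i)) : MvPolynomial (Fin n) ℤ →ₐ[ℤ] ℂ) := by
      ext j; simp
    exact DFunLike.congr_fun this (c r)
  have hc0 : ∀ (r) (z : Fin n → ℂ), 
     (∑ i, z i * ∑ j, ∑ k, (ten (c r) i j k : ℂ) * z j * z k = 0) → aeval z (c r) = 0 := by
    intro r z hz
    have h6 := aeval_cubic (hdeg r) z
    rw [hz] at h6
    simpa using h6
  obtain ⟨s, hs, hfs⟩ := exists_common_zero f (by
    rintro (l | r)
    · simp only [f, map_sum, map_mul, hlin]
      simp
    · simp only [f, hcomp]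
      apply hc0
      simp [hlin]) (by
    simp
    have := r0.pos
    omega)
  let z : Fin n → ℂ := fun i => ∑ j, s j * (y j i : ℂ)
  have hz : z ≠ 0 := fun h => hs (complex_comb_ne_zero y hy s h)
  let g : Fin n → ℂ := fun i => ∑ j, ∑ k, (G i j k : ℂ) * z j * z k
  have hg : g = 0 := by
    apply dot_basis_zero bas2
    rintro (a | l)
    · rw [hbas2]
      have h1 : ∀ b b', ∑ i, ∑ j, ∑ k, (G i j k : ℂ) * t a i * y b j * y b' k = 0 := by
        intro b b'
        have := congrArg (fun x : ℝ => (x : ℂ)) (hv a b b')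
        simp only [Complex.ofReal_sum, Complex.ofReal_mul, Complex.ofReal_zero] at this
        simpa [G] using this
      have h2 : ∑ i, (t a i : ℂ) * g i = ∑ b, ∑ b', s b * s b' *
          ∑ i, ∑ j, ∑ k, (G i j k : ℂ) * t a i * y b j * y b' k := by
        simp only [g, z, Finset.mul_sum, Finset.sum_mul]
        simp only [← Fintype.sum_prod_type']
        simp only [Fintype.sum_prod_type]
        have : ∀ F : Fin n → Fin n → Fin n → Fin q → Fin q → ℂ,
          ∑ i, ∑ j, ∑ k, ∑ b', ∑ b, F i j k b b' = ∑ b, ∑ b', ∑ i, ∑ j, ∑ k, F i j k b b' := by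
          intro F
          simp only [← Fintype.sum_prod_type']
          refine Fintype.sum_equiv ⟨fun x => (x.2.2.2.2, x.2.2.2.1, x.1, x.2.1, x.2.2.1),
            fun x => (x.2.2.1, x.2.2.2.1, x.2.2.2.2, x.2.1, x.1), fun _ => rfl, fun _ => rfl⟩ _ _ ?_
          intro x; rfl
        rw [← this]
        refine Finset.sum_congr rfl fun i _ => Finset.sum_congr rfl fun j _ =>
          Finset.sum_congr rfl fun k _ => Finset.sum_congr rfl fun b' _ =>
          Finset.sum_congr rfl fun b _ => ?_
        ring
      rw [h2]
      simp [h1]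
    · have := hfs (Sum.inl l)
      simp only [f, map_sum, map_mul, hlin, aeval_C] at this
      exact this
  have hgi : ∀ i, ∑ r, (β r : ℂ) * ∑ j, ∑ k, (ten (c r) i j k : ℂ) * z j * z k = 0 := by
    intro i
    have h1 := congrFun hg i
    simp only [g, G, Pi.zero_apply, Complex.ofReal_sum, Complex.ofReal_mul, Finset.sum_mul] at h1
    rw [← h1]
    simp only [Finset.mul_sum]
    rw [Finset.sum_comm]
    refine Finset.sum_congr rfl fun j _ => ?_
    rw [Finset.sum_comm]
    refine Finset.sum_congr rfl fun k _ => Finset.sum_congr rfl fun r _ => ?_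
    push_cast
    ring
  have hcne : ∀ r, r ≠ r0 → aeval z (c r) = 0 := by
    intro r hr
    have := hfs (Sum.inr ⟨r, hr⟩)
    simp only [f, hcomp, hlin] at this
    exact this
  have hsum : ∑ r, (β r : ℂ) * (6 * aeval z (c r)) = 0 := by
    simp only [fun r => aeval_cubic (hdeg r) z]
    have : ∀ r, (β r : ℂ) * ∑ i, z i * ∑ j, ∑ k, (ten (c r) i j k : ℂ) * z j * z k
       = ∑ i, z i * ((β r : ℂ) * ∑ j, ∑ k, (ten (c r) i j k : ℂ) * z j * z k) := by
      intro r
      rw [Finset.mul_sum]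
      refine Finset.sum_congr rfl fun i _ => ?_
      ring
    simp only [this]
    rw [Finset.sum_comm]
    refine Finset.sum_eq_zero fun i _ => ?_
    rw [← Finset.mul_sum, hgi, mul_zero]
  have hall : ∀ r, aeval z (c r) = 0 := by
    intro r
    by_cases hr : r = r0
    · subst hr
      rw [Finset.sum_eq_single r] at hsum
      · simpa [hr0] using hsum
      · intro b _ hb
        rw [hcne b hb]; simp
      · simp
    · exact hcne r hr
  have hrank := hsmooth z hz hall
  rw [Matrix.rank_eq_finrank_span_row] at hrank
  have hli : LinearIndependent ℂ
      (Matrix.of fun (r : Fin R) (j : Fin n) => aeval z (pderiv j (c r))).row := by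
    rw [linearIndependent_iff_card_eq_finrank_span, Set.finrank, hrank]; simp
  rw [Fintype.linearIndependent_iff] at hli
  have := hli (fun r => (β r : ℂ)) (by
    funext i
    have h2 : ∑ r, (β r : ℂ) * (2 * aeval z (pderiv i (c r))) = 0 := by
      simp only [fun r => aeval_pderiv1 (hdeg r) z i]
      exact hgi i
    have h3 : 2 * ∑ r, (β r : ℂ) * (aeval z (pderiv i (c r))) = 0 := by
      rw [Finset.mul_sum, ← h2]
      refine Finset.sum_congr rfl fun r _ => ?_
      ring
    simpa [Matrix.row] using h3) r0
  exact hr0 (by exact_mod_cast this)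

/-- Quantitative linear independence. -/
def EtaIndep {n m : ℕ} (η : ℝ) (t : Fin m → EuclideanSpace ℝ (Fin n)) : Prop :=
  ∀ i, ∀ a : Fin m → ℝ, (∀ j, i ≤ j → a j = 0) → η ≤ ‖t i - ∑ j, a j • t j‖

theorem EtaIndep.linearIndependent {n m : ℕ} {η : ℝ} (hη : 0 < η)
    {t : Fin m → EuclideanSpace ℝ (Fin n)} (h : EtaIndep η t) : LinearIndependent ℝ t := by
  classical
  rw [Fintype.linearIndependent_iff]
  intro g hg
  by_contra hne
  push Not at hne
  obtain ⟨i0, hi0⟩ := hne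
  have hs : (Finset.univ.filter fun i => g i ≠ 0).Nonempty := ⟨i0, by simpa using hi0⟩
  set i := (Finset.univ.filter fun i => g i ≠ 0).max' hs with hi
  have hgi : g i ≠ 0 := by
    have := Finset.max'_mem _ hs
    rw [← hi] at this
    simpa using this
  have hgt : ∀ j, i < j → g j = 0 := by
    intro j hj
    by_contra hgj
    have := Finset.le_max' (Finset.univ.filter fun i => g i ≠ 0) j (by simpa using hgj)
    exact absurd this (not_le.2 hj)
  have h1 := h i (fun j => if j = i then 0 else - (g i)⁻¹ * g j) (by
    intro j hj
    by_cases hji : j = i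
    · simp [hji]
    · simp [hji, hgt j (lt_of_le_of_ne hj (Ne.symm hji))])
  have h2 : t i - ∑ j, (if j = i then 0 else - (g i)⁻¹ * g j) • t j = (g i)⁻¹ • ∑ j, g j • t j := by
    rw [Finset.smul_sum, ← Finset.add_sum_erase _ _ (Finset.mem_univ i),
      ← Finset.add_sum_erase Finset.univ (fun j => (g i)⁻¹ • g j • t j) (Finset.mem_univ i)]
    simp only [if_true, zero_smul, zero_add, smul_smul, inv_mul_cancel₀ hgi, one_smul]
    rw [sub_eq_add_neg, ← Finset.sum_neg_distrib]
    congr 1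
    refine Finset.sum_congr rfl fun j hj => ?_
    rw [if_neg (Finset.ne_of_mem_erase hj), ← neg_smul]; simp
  rw [h2, hg] at h1
  simp at h1
  linarith

theorem greedy {n : ℕ} (η : ℝ) (S : Set (EuclideanSpace ℝ (Fin n))) (m : ℕ) :
    (∃ t : Fin m → EuclideanSpace ℝ (Fin n), (∀ i, t i ∈ S) ∧ EtaIndep η t) ∨
    ∃ W : Submodule ℝ (EuclideanSpace ℝ (Fin n)), Module.finrank ℝ W < m ∧
      ∀ s ∈ S, ∃ w ∈ W, ‖s - w‖ < η := by
  induction m with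
  | zero => exact Or.inl ⟨Fin.elim0, fun i => i.elim0, fun i => i.elim0⟩
  | succ m ih =>
    rcases ih with ⟨t, htS, ht⟩ | ⟨W, hW, h⟩
    · by_cases hall : ∀ s ∈ S, ∃ w ∈ Submodule.span ℝ (Set.range t), ‖s - w‖ < η
      · right
        refine ⟨_, ?_, hall⟩
        have := finrank_range_le_card (R := ℝ) t
        rw [Set.finrank] at this
        simp at this
        omega
      · left
        push Not at hall
        obtain ⟨s, hs, hsw⟩ := hall
        refine ⟨Fin.snoc t s, ?_, ?_⟩
        · intro i
          refine Fin.lastCases ?_ (fun j => ?_) i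
          · simpa using hs
          · simpa using htS j
        · intro i
          refine Fin.lastCases ?_ (fun j => ?_) i
          · intro a ha
            rw [Fin.sum_univ_castSucc]
            simp only [Fin.snoc_castSucc, Fin.snoc_last, ha _ le_rfl, zero_smul, add_zero]
            apply hsw
            exact Submodule.sum_mem _ fun j _ => Submodule.smul_mem _ _
              (Submodule.subset_span ⟨j, rfl⟩)
          · intro a ha
            rw [Fin.sum_univ_castSucc]
            simp only [Fin.snoc_castSucc, Fin.snoc_last, ha _ (Fin.le_last _), zero_smul, add_zero]
            apply ht j (fun l => a l.castSucc)
            intro l hl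
            exact ha _ (by simpa using hl)
    · exact Or.inr ⟨W, by omega, h⟩

theorem gap_key {n : ℕ} (T : EuclideanSpace ℝ (Fin n) →ₗ[ℝ] EuclideanSpace ℝ (Fin n))
    (hT : T.IsSymmetric) (e : OrthonormalBasis (Fin n) ℝ (EuclideanSpace ℝ (Fin n)))
    (lam : Fin n → ℝ) (he : ∀ i, T (e i) = lam i • e i) (θ r D : ℝ) (hr : 0 < r) (hθ : 0 ≤ θ)
    (hD : 0 ≤ D)
    (hgap : ∀ i, |lam i| ≤ θ * r ∨ r ≤ θ * |lam i|) (y y' : EuclideanSpace ℝ (Fin n))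
    (hy : ‖y‖ ≤ 1) (hy' : ‖y'‖ ≤ 1) (hTy : ‖T y‖ ≤ D * r) (hTy' : ‖T y'‖ ≤ D * r) :
    |inner ℝ y (T y')| ≤ n * (θ * r * (1 + D ^ 2)) := by
  have hin : ∀ i z, inner ℝ (e i) (T z) = lam i * inner ℝ (e i) z := by
    intro i z
    rw [← hT, he, real_inner_smul_left]
  have hle : ∀ i z, |inner ℝ (e i) z| ≤ ‖z‖ := by
    intro i z
    have := abs_real_inner_le_norm (e i) z
    simpa using this
  rw [← e.sum_inner_mul_inner]
  refine (Finset.abs_sum_le_sum_abs _ _).trans ?_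
  have : ∀ i ∈ Finset.univ, |inner ℝ y (e i) * inner ℝ (e i) (T y')| ≤ θ * r * (1 + D ^ 2) := by
    intro i _
    rw [real_inner_comm, abs_mul]
    have a1 : |inner ℝ (e i) y| ≤ 1 := (hle i y).trans hy
    have a2 : |inner ℝ (e i) y'| ≤ 1 := (hle i y').trans hy'
    have a3 : |inner ℝ (e i) (T y')| ≤ D * r := (hle i _).trans hTy'
    have a4 : |inner ℝ (e i) (T y)| ≤ D * r := (hle i _).trans hTy
    rcases hgap i with h | h
    · have : |inner ℝ (e i) (T y')| ≤ θ * r := by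
        rw [hin, abs_mul]
        calc |lam i| * |inner ℝ (e i) y'| ≤ |lam i| * 1 := by gcongr
          _ ≤ θ * r := by linarith
      calc |inner ℝ (e i) y| * |inner ℝ (e i) (T y')| ≤ 1 * (θ * r) := by gcongr
        _ ≤ θ * r * (1 + D ^ 2) := by nlinarith [mul_nonneg (mul_nonneg hθ hr.le) (sq_nonneg D)]
    · rw [hin, abs_mul] at a4
      have : |inner ℝ (e i) y| ≤ θ * D := by
        have h5 : r * |inner ℝ (e i) y| ≤ r * (θ * D) := by
          calc r * |inner ℝ (e i) y| ≤ θ * |lam i| * |inner ℝ (e i) y| := by gcongr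
            _ = θ * (|lam i| * |inner ℝ (e i) y|) := by ring
            _ ≤ θ * (D * r) := by gcongr
            _ = r * (θ * D) := by ring
        exact le_of_mul_le_mul_left h5 hr
      calc |inner ℝ (e i) y| * |inner ℝ (e i) (T y')| ≤ (θ * D) * (D * r) := by gcongr
        _ ≤ θ * r * (1 + D ^ 2) := by nlinarith [mul_nonneg hθ hr.le]
  refine (Finset.sum_le_sum this).trans ?_
  simp

theorem cover {n : ℕ} (S : Finset (EuclideanSpace ℝ (Fin n))) (x0 : EuclideanSpace ℝ (Fin n))
    (W : Submodule ℝ (EuclideanSpace ℝ (Fin n))) (σ τ ρ r : ℝ) (hσ : 0 < σ) (N : ℕ)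
    (hS : ∀ s ∈ S, ‖s - x0‖ ≤ r) (hW : ∀ s ∈ S, ∃ w ∈ W, ‖(s - x0) - w‖ ≤ τ)
    (hr : r ≤ N * σ) (hρ : n * σ + 2 * τ ≤ ρ) (F : ℕ)
    (hF : ∀ S' ⊆ S, ∀ a, (∀ s ∈ S', ‖s - a‖ ≤ ρ) → S'.card ≤ F) :
    S.card ≤ (2 * N + 1) ^ (Module.finrank ℝ W) * F := by
  classical
  let u := stdOrthonormalBasis ℝ W
  let κ : EuclideanSpace ℝ (Fin n) → Fin (Module.finrank ℝ W) → ℤ :=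
    fun s i => ⌊inner ℝ (u i : EuclideanSpace ℝ (Fin n)) (s - x0) / σ⌋
  let T : Finset (Fin (Module.finrank ℝ W) → ℤ) :=
    Fintype.piFinset fun _ => Finset.Icc (-(N : ℤ)) N
  have hT : T.card = (2 * N + 1) ^ (Module.finrank ℝ W) := by
    simp only [T, Fintype.card_piFinset, Int.card_Icc, Finset.prod_const, Finset.card_univ,
      Fintype.card_fin]
    congr 1
    omega
  have hun : ∀ i, ‖(u i : EuclideanSpace ℝ (Fin n))‖ = 1 := fun i => u.orthonormal.1 i
  rw [← hT, mul_comm]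
  refine Finset.card_le_mul_card_image_of_maps_to (f := κ) ?_ F ?_
  · intro s hs
    rw [Fintype.mem_piFinset]
    intro i
    have h1 : |inner ℝ (u i : EuclideanSpace ℝ (Fin n)) (s - x0)| ≤ N * σ := by
      have := abs_real_inner_le_norm (u i : EuclideanSpace ℝ (Fin n)) (s - x0)
      rw [hun, one_mul] at this
      exact this.trans ((hS s hs).trans hr)
    rw [abs_le] at h1
    rw [Finset.mem_Icc]
    constructor
    · rw [Int.le_floor, le_div_iff₀ hσ]; push_cast; linarith [h1.1]
    · rw [Int.floor_le_iff, div_lt_iff₀ hσ]; push_cast; nlinarith [h1.2]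
  · intro b _
    rcases Finset.eq_empty_or_nonempty (S.filter fun a => κ a = b) with h | ⟨s0, hs0⟩
    · rw [h]; simp
    · refine hF _ (Finset.filter_subset _ _) s0 ?_
      intro s hs
      rw [Finset.mem_filter] at hs hs0
      obtain ⟨w, hw, hsw⟩ := hW s hs.1
      obtain ⟨w0, hw0, hsw0⟩ := hW s0 hs0.1
      set v := s - s0 with hv
      have hcoord : ∀ i, |inner ℝ (u i : EuclideanSpace ℝ (Fin n)) v| ≤ σ := by
        intro i
        have hk : κ s i = κ s0 i := by rw [hs.2, hs0.2]
        have := (Int.abs_sub_lt_one_of_floor_eq_floor hk).le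
        rw [← sub_div, ← inner_sub_right, abs_div, abs_of_pos hσ, div_le_one hσ] at this
        rw [hv, show s - s0 = (s - x0) - (s0 - x0) by abel]
        exact this
      have hP : ‖(W.starProjection v)‖ ≤ n * σ := by
        have h1 : W.starProjection v = ∑ i, inner ℝ (u i : EuclideanSpace ℝ (Fin n)) v •
            (u i : EuclideanSpace ℝ (Fin n)) := by
          rw [Submodule.starProjection_apply, u.orthogonalProjectionOnto_apply_eq_sum]
          simp
        rw [h1]
        refine (norm_sum_le _ _).trans ?_
        have : ∀ i ∈ Finset.univ, ‖inner ℝ (u i : EuclideanSpace ℝ (Fin n)) v •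
            (u i : EuclideanSpace ℝ (Fin n))‖ ≤ σ := by
          intro i _
          rw [norm_smul, hun, mul_one]
          exact hcoord i
        refine (Finset.sum_le_sum this).trans ?_
        simp only [Finset.sum_const, Finset.card_univ, Fintype.card_fin, nsmul_eq_mul]
        have := Submodule.finrank_le W
        rw [finrank_euclideanSpace_fin] at this
        gcongr
      have hQ : ‖v - W.starProjection v‖ ≤ 2 * τ := by
        rw [Submodule.starProjection_minimal]
        refine (ciInf_le ⟨0, ?_⟩ ⟨w - w0, W.sub_mem hw hw0⟩).trans ?_
        · rintro _ ⟨x, rfl⟩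
          exact norm_nonneg _
        · have : v - (w - w0) = ((s - x0) - w) - ((s0 - x0) - w0) := by rw [hv]; abel
          simp only [this]
          refine (norm_sub_le _ _).trans ?_
          linarith
      calc ‖v‖ = ‖W.starProjection v + (v - W.starProjection v)‖ := by congr 1; abel
        _ ≤ _ := norm_add_le _ _
        _ ≤ ρ := by linarith

open Classical in
/-- The exponent of the covering cost at scale `k`. -/
noncomputable def expo {n : ℕ} (R J : ℕ) (p : Fin n → ℕ) (k : ℕ) : ℕ :=
  if (∀ i, p i + 1 + J ≤ k ∨ k + J ≤ p i) then
    (Finset.univ.filter fun i => k < p i).card + (R - 1) else n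

theorem pow_cost {n M d e : ℕ} (hM : 1 ≤ M) (hdn : d ≤ n) (hde : d ≤ e) :
    (2 * (4 * M * (n + 1)) + 1) ^ d ≤ (9 * (n + 1)) ^ n * M ^ e := by
  have h1 : 2 * (4 * M * (n + 1)) + 1 ≤ (9 * (n + 1)) * M := by nlinarith [Nat.zero_le n, Nat.zero_le (M * n)]
  calc _ ≤ ((9 * (n + 1)) * M) ^ d := Nat.pow_le_pow_left h1 d
    _ = (9 * (n + 1)) ^ d * M ^ d := mul_pow _ _ _
    _ ≤ _ := Nat.mul_le_mul (Nat.pow_le_pow_right (by omega) hdn) (Nat.pow_le_pow_right hM hde)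

theorem step {n R M J : ℕ} (hR : 1 ≤ R) (hM : 2 ≤ M)  (C δ : ℝ) (hC : 0 ≤ C)
    (L : EuclideanSpace ℝ (Fin n) →ₗ[ℝ] EuclideanSpace ℝ (Fin n) →ₗ[ℝ] EuclideanSpace ℝ (Fin n))
    (hsym : ∀ x, (L x).IsSymmetric) (hL : ∀ x y, ‖L x y‖ ≤ C * ‖x‖ * ‖y‖)
    (e : EuclideanSpace ℝ (Fin n) → OrthonormalBasis (Fin n) ℝ (EuclideanSpace ℝ (Fin n)))
    (lam : EuclideanSpace ℝ (Fin n) → Fin n → ℝ) (he : ∀ x i, L x (e x i) = lam x i • e x i)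
    (hgood : ∀ b, b ≤ n → ∀ t : Fin (b + R) → EuclideanSpace ℝ (Fin n), (∀ i, ‖t i‖ ≤ 1) →
      EtaIndep (1 / (8 * M)) t → ∀ y : Fin (n - b) → EuclideanSpace ℝ (Fin n), Orthonormal ℝ y →
      ∃ i j k, δ ≤ |inner ℝ (y j) (L (t i) (y k))|)
    (hJ1 : 2 * (M : ℝ) / M ^ J ≤ 1) (hJ2 : 2 * (M : ℝ) / M ^ J * (n * (1 + (1 + C) ^ 2) + 1) < δ)
    (p : Fin n → ℕ) (S : Finset (EuclideanSpace ℝ (Fin n)))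
    (hp1 : ∀ s ∈ S, ∀ i, |lam s i| < (M : ℝ) ^ (p i + 1))
    (hp2 : ∀ s ∈ S, ∀ i, 0 < p i → (M : ℝ) ^ (p i) ≤ |lam s i|)
    (k : ℕ) (a : EuclideanSpace ℝ (Fin n)) (hS : ∀ s ∈ S, ‖s - a‖ ≤ (M : ℝ) ^ (k + 1)) (F : ℕ)
    (hF : ∀ S' ⊆ S, ∀ a', (∀ s ∈ S', ‖s - a'‖ ≤ (M : ℝ) ^ k) → S'.card ≤ F) :
    S.card ≤ (9 * (n + 1)) ^ n * M ^ (expo R J p k) * F := by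
  classical
  rcases S.eq_empty_or_nonempty with rfl | ⟨x0, hx0⟩
  · simp
  have hM0 : (0 : ℝ) < M := by positivity
  have hMk : (0 : ℝ) < (M : ℝ) ^ k := by positivity
  set r : ℝ := 2 * (M : ℝ) ^ (k + 1) with hr
  have hrk : r = 2 * M * (M : ℝ) ^ k := by rw [hr, pow_succ]; ring
  have hr0 : 0 < r := by positivity
  have hSr : ∀ s ∈ S, ‖s - x0‖ ≤ r := by
    intro s hs
    have : s - x0 = (s - a) - (x0 - a) := by abel
    rw [this]
    refine (norm_sub_le _ _).trans ?_
    linarith [hS s hs, hS x0 hx0]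
  have hcov : ∀ (W : Submodule ℝ (EuclideanSpace ℝ (Fin n))) (q : ℕ), Module.finrank ℝ W ≤ q →
      (∀ s ∈ S, ∃ w ∈ W, ‖(s - x0) - w‖ ≤ (M : ℝ) ^ k / 4) →
      S.card ≤ (9 * (n + 1)) ^ n * M ^ q * F := by
    intro W q hWq hW
    have := cover S x0 W ((M : ℝ) ^ k / (2 * (n + 1))) ((M : ℝ) ^ k / 4) ((M : ℝ) ^ k) r
      (by positivity) (4 * M * (n + 1)) hSr hW (by
        rw [hrk]; push_cast; field_simp; norm_num) (by
        have : (n : ℝ) * ((M : ℝ) ^ k / (2 * (n + 1))) ≤ (M : ℝ) ^ k / 2 := by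
          rw [mul_div_assoc', div_le_div_iff₀ (by positivity) (by norm_num)]
          nlinarith
        linarith) F hF
    refine this.trans (Nat.mul_le_mul_right F (pow_cost (by omega) ?_ hWq))
    have := Submodule.finrank_le W
    rwa [finrank_euclideanSpace_fin] at this
  by_cases hgap : ∀ i, p i + 1 + J ≤ k ∨ k + J ≤ p i
  swap
  · rw [expo, if_neg hgap]
    refine hcov ⊤ n ?_ ?_
    · simp
    · intro s _
      exact ⟨s - x0, trivial, by simp; positivity⟩
  rw [expo, if_pos hgap]
  set b := (Finset.univ.filter fun i => k < p i).card with hb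
  have hbn : b ≤ n := by
    have := Finset.card_filter_le (Finset.univ : Finset (Fin n)) (fun i => k < p i)
    simpa using this
  rcases greedy (1 / (8 * (M : ℝ))) ((fun s => (1 / r) • (s - x0)) '' (S : Set _)) (b + R) with
    ⟨t, htS, ht⟩ | ⟨W, hWd, hW⟩
  swap
  · refine hcov W _ (by omega) ?_
    intro s hs
    obtain ⟨w, hw, hsw⟩ := hW _ ⟨s, hs, rfl⟩
    refine ⟨r • w, W.smul_mem _ hw, ?_⟩
    have : (s - x0) - r • w = r • ((1 / r) • (s - x0) - w) := by
      rw [smul_sub, smul_smul, mul_one_div_cancel hr0.ne', one_smul]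
    rw [this, norm_smul, Real.norm_of_nonneg hr0.le]
    calc r * ‖(1 / r) • (s - x0) - w‖ ≤ r * (1 / (8 * M)) := by gcongr
      _ = (M : ℝ) ^ k / 4 := by rw [hrk]; field_simp; norm_num
  exfalso
  set θ : ℝ := 2 * (M : ℝ) / M ^ J with hθ
  have hθ0 : 0 ≤ θ := by positivity
  have hMJ : (0 : ℝ) < (M : ℝ) ^ J := by positivity
  have hsmall : ∀ s ∈ S, ∀ i, p i + 1 + J ≤ k → |lam s i| ≤ θ * r := by
    intro s hs i hi
    have h1 : (M : ℝ) ^ (p i + 1) * M ^ J ≤ M ^ k := by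
      rw [← pow_add]; exact pow_le_pow_right₀ (by exact_mod_cast (by omega : 1 ≤ M)) hi
    have h2 : (M : ℝ) ^ (p i + 1) ≤ M ^ k / M ^ J := by rwa [le_div_iff₀ hMJ]
    refine ((hp1 s hs i).le.trans h2).trans ?_
    rw [hθ, hrk, div_mul_eq_mul_div]
    have hM1 : (1 : ℝ) ≤ M := by exact_mod_cast (by omega : 1 ≤ M)
    gcongr
    nlinarith [mul_le_mul hM1 hM1 (by norm_num) (by linarith)]
  have hgapS : ∀ s ∈ S, ∀ i, |lam s i| ≤ θ * r ∨ r ≤ θ * |lam s i| := by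
    intro s hs i
    rcases hgap i with h | h
    · exact Or.inl (hsmall s hs i h)
    · by_cases hpi : 0 < p i
      · right
        have h1 := hp2 s hs i hpi
        have h2 : (M : ℝ) ^ (k + J) ≤ M ^ (p i) :=
          pow_le_pow_right₀ (by exact_mod_cast (by omega : 1 ≤ M)) h
        calc r = θ * (M : ℝ) ^ (k + J) := by rw [hθ, hrk, pow_add]; field_simp
          _ ≤ θ * |lam s i| := by gcongr; linarith
      · exfalso
        have hJ0 : J = 0 := by omega
        rw [hθ, hJ0, pow_zero, div_one] at hJ1
        have hM1 : (2 : ℝ) ≤ M := by exact_mod_cast hM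
        linarith
  have hcompl : (Finset.univ.filter fun i => ¬ k < p i).card = n - b := by
    have := Finset.card_filter_add_card_filter_not (s := (Finset.univ : Finset (Fin n)))
      (fun i => k < p i)
    simp only [Finset.card_univ, Fintype.card_fin] at this
    omega
  let em := (Finset.univ.filter fun i => ¬ k < p i).orderEmbOfFin hcompl
  have hem : ∀ j, ¬ k < p (em j) := by
    intro j
    have := Finset.orderEmbOfFin_mem (Finset.univ.filter fun i => ¬ k < p i) hcompl j
    exact (Finset.mem_filter.1 this).2
  let y : Fin (n - b) → EuclideanSpace ℝ (Fin n) := fun j => e x0 (em j)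
  have hy : Orthonormal ℝ y := (e x0).orthonormal.comp em em.injective
  have htle : ∀ i, ‖t i‖ ≤ 1 := by
    intro i
    obtain ⟨s, hs, hst⟩ := htS i
    rw [← hst]
    simp only [norm_smul]
    rw [Real.norm_of_nonneg (by positivity), one_div, inv_mul_le_iff₀ hr0, mul_one]
    exact hSr s hs
  obtain ⟨i, j, l, hijl⟩ := hgood b hbn t htle ht y hy
  obtain ⟨s, hs, hst⟩ := htS i
  have hy1 : ∀ j, ‖y j‖ = 1 := hy.1
  have hx0y : ∀ j, ‖L x0 (y j)‖ ≤ θ * r := by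
    intro j
    simp only [y, he, norm_smul, (e x0).norm_eq_one, mul_one]
    refine hsmall x0 hx0 _ ?_
    rcases hgap (em j) with h | h
    · exact h
    · exfalso
      have h1 := hem j
      have hJ0 : J = 0 := by omega
      rw [hθ, hJ0, pow_zero, div_one] at hJ1
      have hM1 : (2 : ℝ) ≤ M := by exact_mod_cast hM
      linarith
  have hsy : ∀ j, ‖L s (y j)‖ ≤ (1 + C) * r := by
    intro j
    have h1 : L s (y j) = L x0 (y j) + L (s - x0) (y j) := by simp
    rw [h1]
    refine (norm_add_le _ _).trans ?_
    have h2 := hL (s - x0) (y j)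
    rw [hy1, mul_one] at h2
    have h3 : C * ‖s - x0‖ ≤ C * r := by gcongr; exact hSr s hs
    have h4 : θ * r ≤ 1 * r := by gcongr
    linarith [hx0y j]
  have key := gap_key (L s) (hsym s) (e s) (lam s) (he s) θ r (1 + C) hr0 hθ0 (by linarith)
    (hgapS s hs) (y j) (y l) (hy1 j).le (hy1 l).le (hsy j) (hsy l)
  have hin : inner ℝ (y j) (L (t i) (y l)) =
      (1 / r) * (inner ℝ (y j) (L s (y l)) - inner ℝ (y j) (L x0 (y l))) := by
    rw [← hst]
    simp only [map_smul, map_sub, LinearMap.smul_apply, LinearMap.sub_apply, inner_smul_right, inner_sub_right]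
  have h0 : |inner ℝ (y j) (L x0 (y l))| ≤ θ * r := by
    refine (abs_real_inner_le_norm _ _).trans ?_
    rw [hy1, one_mul]; exact hx0y l
  rw [hin, abs_mul, abs_of_pos (by positivity : 0 < 1 / r)] at hijl
  have h5 : |inner ℝ (y j) (L s (y l)) - inner ℝ (y j) (L x0 (y l))| ≤
      r * (θ * (n * (1 + (1 + C) ^ 2) + 1)) := by
    refine (abs_sub _ _).trans ?_
    nlinarith
  have h6 : (1 / r) * |inner ℝ (y j) (L s (y l)) - inner ℝ (y j) (L x0 (y l))| ≤
      θ * (n * (1 + (1 + C) ^ 2) + 1) := by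
    rw [one_div, inv_mul_le_iff₀ hr0]; exact h5
  linarith

theorem recur {n R M J : ℕ} (hR : 1 ≤ R) (hM : 2 ≤ M)  (C δ : ℝ) (hC : 0 ≤ C)
    (L : EuclideanSpace ℝ (Fin n) →ₗ[ℝ] EuclideanSpace ℝ (Fin n) →ₗ[ℝ] EuclideanSpace ℝ (Fin n))
    (hsym : ∀ x, (L x).IsSymmetric) (hL : ∀ x y, ‖L x y‖ ≤ C * ‖x‖ * ‖y‖)
    (e : EuclideanSpace ℝ (Fin n) → OrthonormalBasis (Fin n) ℝ (EuclideanSpace ℝ (Fin n)))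
    (lam : EuclideanSpace ℝ (Fin n) → Fin n → ℝ) (he : ∀ x i, L x (e x i) = lam x i • e x i)
    (hgood : ∀ b, b ≤ n → ∀ t : Fin (b + R) → EuclideanSpace ℝ (Fin n), (∀ i, ‖t i‖ ≤ 1) →
      EtaIndep (1 / (8 * M)) t → ∀ y : Fin (n - b) → EuclideanSpace ℝ (Fin n), Orthonormal ℝ y →
      ∃ i j k, δ ≤ |inner ℝ (y j) (L (t i) (y k))|)
    (hJ1 : 2 * (M : ℝ) / M ^ J ≤ 1) (hJ2 : 2 * (M : ℝ) / M ^ J * (n * (1 + (1 + C) ^ 2) + 1) < δ)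
    (p : Fin n → ℕ) (k : ℕ) : ∀ (S : Finset (EuclideanSpace ℝ (Fin n)))
    (_ : ∀ s ∈ S, ∀ s' ∈ S, s ≠ s' → 1 ≤ ‖s - s'‖)
    (_ : ∀ s ∈ S, ∀ i, |lam s i| < (M : ℝ) ^ (p i + 1))
    (_ : ∀ s ∈ S, ∀ i, 0 < p i → (M : ℝ) ^ (p i) ≤ |lam s i|)
    (a : EuclideanSpace ℝ (Fin n)) (_ : ∀ s ∈ S, ‖s - a‖ ≤ (M : ℝ) ^ k),
    S.card ≤ (6 * (n + 1) + 1) ^ n * (((9 * (n + 1)) ^ n) ^ k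
      * M ^ (∑ j ∈ Finset.range k, expo R J p j)) := by
  induction k with
  | zero =>
    intro S hsep _ _ a hS
    have := cover S a ⊤ (1 / (3 * (n + 1))) 0 (1 / 3) 1 (by positivity) (3 * (n + 1))
      (by simpa using hS) (fun s _ => ⟨s - a, trivial, by simp⟩)
      (by push_cast; field_simp; exact le_rfl)
      (by field_simp; ring_nf; linarith) 1 (by
        intro S' hS' a' h
        rw [Finset.card_le_one]
        intro s hs s' hs'
        by_contra hne
        have h1 := hsep s (hS' hs) s' (hS' hs') hne
        have h2 : ‖s - s'‖ ≤ ‖s - a'‖ + ‖s' - a'‖ := by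
          have := norm_sub_le (s - a') (s' - a')
          simpa using this
        linarith [h s hs, h s' hs'])
    rw [finrank_top, finrank_euclideanSpace_fin] at this
    simpa [← mul_assoc] using this
  | succ k ih =>
    intro S hsep h1 h2 a hS
    have := step hR hM C δ hC L hsym hL e lam he hgood hJ1 hJ2 p S h1 h2 k a hS _
      (fun S' hS' a' h => ih S' (fun s hs s' hs' => hsep s (hS' hs) s' (hS' hs'))
        (fun s hs => h1 s (hS' hs)) (fun s hs => h2 s (hS' hs)) a' h)
    refine this.trans (le_of_eq ?_)
    rw [Finset.sum_range_succ, pow_add, pow_succ]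
    ring

theorem expo_sum {n : ℕ} (R J : ℕ) (p : Fin n → ℕ) (K : ℕ) :
    ∑ k ∈ Finset.range K, expo R J p k ≤ ∑ i, p i + K * (R - 1) + n * (n * (2 * J)) := by
  have h1 : ∀ k, expo R J p k ≤ ∑ i, (if k < p i then 1 else 0) + (R - 1)
      + n * ∑ i, (if k ∈ Finset.Ico (p i + 1 - J) (p i + 1 + J) then 1 else 0) := by
    intro k
    unfold expo
    split_ifs with h
    · rw [Finset.card_filter]; omega
    · push Not at h
      obtain ⟨i, hi1, hi2⟩ := h
      have : 1 ≤ ∑ i, (if k ∈ Finset.Ico (p i + 1 - J) (p i + 1 + J) then 1 else 0) := by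
        refine le_trans ?_ (Finset.single_le_sum (fun _ _ => Nat.zero_le _) (Finset.mem_univ i))
        rw [if_pos]
        rw [Finset.mem_Ico]; omega
      have := Nat.mul_le_mul_left n this
      omega
  refine (Finset.sum_le_sum fun k _ => h1 k).trans ?_
  rw [Finset.sum_add_distrib, Finset.sum_add_distrib, ← Finset.mul_sum, Finset.sum_comm,
    Finset.sum_comm (s := Finset.range K)]
  have h2 : ∑ i, ∑ k ∈ Finset.range K, (if k < p i then 1 else 0) ≤ ∑ i, p i := by
    refine Finset.sum_le_sum fun i _ => ?_
    rw [← Finset.card_filter]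
    calc _ ≤ (Finset.range (p i)).card := Finset.card_le_card (by intro k; simp)
      _ = _ := by simp
  have h3 : ∑ i, ∑ k ∈ Finset.range K,
      (if k ∈ Finset.Ico (p i + 1 - J) (p i + 1 + J) then 1 else 0) ≤ n * (2 * J) := by
    calc _ ≤ ∑ i : Fin n, 2 * J := by
          refine Finset.sum_le_sum fun i _ => ?_
          rw [← Finset.card_filter]
          calc _ ≤ (Finset.Ico (p i + 1 - J) (p i + 1 + J)).card :=
                Finset.card_le_card (by intro k hk; exact (Finset.mem_filter.1 hk).2)
            _ ≤ _ := by rw [Nat.card_Ico]; omega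
      _ = _ := by simp
  have h4 : ∑ k ∈ Finset.range K, (R - 1) = K * (R - 1) := by simp
  rw [h4]
  gcongr

theorem ycount {n M : ℕ} (hM : 1 ≤ M) (e : OrthonormalBasis (Fin n) ℝ (EuclideanSpace ℝ (Fin n)))
    (p : Fin n → ℕ) (B C' : ℝ) (hB : 1 ≤ B) (Y : Finset (EuclideanSpace ℝ (Fin n)))
    (hsep : ∀ s ∈ Y, ∀ s' ∈ Y, s ≠ s' → 1 ≤ ‖s - s'‖)
    (h1 : ∀ y ∈ Y, ∀ i, |inner ℝ (e i) y| * (M : ℝ) ^ (p i) ≤ n * B)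
    (h2 : ∀ i, (M : ℝ) ^ (p i) ≤ C' * B) :
    (Y.card : ℝ) * (M : ℝ) ^ (∑ i, p i) ≤ ((2 * n * (n + 1) + 2 * C') * B) ^ n := by
  classical
  have hMp : ∀ i, (0 : ℝ) < (M : ℝ) ^ (p i) := fun i => by positivity
  let T : Fin n → ℝ := fun i => (n + 1) * (n * B) / (M : ℝ) ^ (p i)
  have hT0 : ∀ i, 0 ≤ T i := fun i => by positivity
  let col : EuclideanSpace ℝ (Fin n) → Fin n → ℤ := fun y i => ⌊((n : ℝ) + 1) * inner ℝ (e i) y⌋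
  have hcard : Y.card ≤ (Fintype.piFinset fun i => Finset.Icc ⌊-T i⌋ ⌊T i⌋).card := by
    refine Finset.card_le_card_of_injOn col ?_ ?_
    · intro y hy
      simp only [Finset.mem_coe, Fintype.mem_piFinset, Finset.mem_Icc]
      intro i
      have hle : |((n : ℝ) + 1) * inner ℝ (e i) y| ≤ T i := by
        rw [abs_mul, abs_of_pos (by positivity : (0 : ℝ) < n + 1), le_div_iff₀ (hMp i), mul_assoc]
        exact mul_le_mul_of_nonneg_left (h1 y hy i) (by positivity)
      exact ⟨Int.floor_le_floor (abs_le.1 hle).1, Int.floor_le_floor (abs_le.1 hle).2⟩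
    · intro y hy y' hy' heq
      by_contra hne
      have hs := hsep y hy y' hy' hne
      have hc : ∀ i, |inner ℝ (e i) (y - y')| ≤ 1 / ((n : ℝ) + 1) := by
        intro i
        have := Int.abs_sub_lt_one_of_floor_eq_floor (congrFun heq i)
        rw [← mul_sub, ← inner_sub_right, abs_mul, abs_of_pos (by positivity : (0 : ℝ) < n + 1)]
          at this
        rw [le_div_iff₀ (by positivity)]
        linarith
      have hn : ‖y - y'‖ ≤ n * (1 / ((n : ℝ) + 1)) := by
        rw [← e.sum_repr' (y - y')]
        calc _ ≤ ∑ i, ‖inner ℝ (e i) (y - y') • e i‖ := norm_sum_le _ _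
          _ ≤ ∑ i : Fin n, 1 / ((n : ℝ) + 1) := by
              refine Finset.sum_le_sum fun i _ => ?_
              rw [norm_smul, e.norm_eq_one, mul_one]
              exact hc i
          _ = _ := by simp
      have : (n : ℝ) * (1 / ((n : ℝ) + 1)) < 1 := by
        rw [mul_one_div, div_lt_one (by positivity)]; linarith
      linarith
  rw [Fintype.card_piFinset] at hcard
  have hcard' : (Y.card : ℝ) ≤ ∏ i, (2 * T i + 2) := by
    calc (Y.card : ℝ) ≤ ((∏ i, (Finset.Icc ⌊-T i⌋ ⌊T i⌋).card : ℕ) : ℝ) := by exact_mod_cast hcard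
      _ = ∏ i, ((Finset.Icc ⌊-T i⌋ ⌊T i⌋).card : ℝ) := by push_cast; rfl
      _ ≤ _ := by
        refine Finset.prod_le_prod (fun _ _ => by positivity) fun i _ => ?_
        rw [Int.card_Icc]
        have hle : ⌊-T i⌋ ≤ ⌊T i⌋ + 1 := by
          have : ⌊-T i⌋ ≤ ⌊T i⌋ := Int.floor_le_floor (by linarith [hT0 i])
          omega
        have hz : ((⌊T i⌋ + 1 - ⌊-T i⌋).toNat : ℝ) = ((⌊T i⌋ + 1 - ⌊-T i⌋ : ℤ) : ℝ) := by
          have := Int.toNat_of_nonneg (a := ⌊T i⌋ + 1 - ⌊-T i⌋) (by omega)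
          exact_mod_cast this
        rw [hz]
        push_cast
        have := Int.floor_le (T i)
        have := Int.lt_floor_add_one (-T i)
        linarith
  calc (Y.card : ℝ) * (M : ℝ) ^ (∑ i, p i) ≤ (∏ i, (2 * T i + 2)) * (M : ℝ) ^ (∑ i, p i) := by
        gcongr
    _ = ∏ i, ((2 * T i + 2) * (M : ℝ) ^ (p i)) := by
        rw [Finset.prod_mul_distrib, Finset.prod_pow_eq_pow_sum]
    _ ≤ ∏ i : Fin n, ((2 * n * (n + 1) + 2 * C') * B) := by
        refine Finset.prod_le_prod (fun i _ => by have := hT0 i; positivity) fun i _ => ?_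
        have : T i * (M : ℝ) ^ (p i) = (n + 1) * (n * B) := div_mul_cancel₀ _ (hMp i).ne'
        nlinarith [h2 i]
    _ = _ := by simp

theorem theoremA {n R M J : ℕ} (hR : 1 ≤ R) (hM : 2 ≤ M)  (C δ : ℝ) (hC : 0 ≤ C)
    (L : EuclideanSpace ℝ (Fin n) →ₗ[ℝ] EuclideanSpace ℝ (Fin n) →ₗ[ℝ] EuclideanSpace ℝ (Fin n))
    (hsym : ∀ x, (L x).IsSymmetric) (hL : ∀ x y, ‖L x y‖ ≤ C * ‖x‖ * ‖y‖)
    (hgood : ∀ b, b ≤ n → ∀ t : Fin (b + R) → EuclideanSpace ℝ (Fin n), (∀ i, ‖t i‖ ≤ 1) →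
      EtaIndep (1 / (8 * M)) t → ∀ y : Fin (n - b) → EuclideanSpace ℝ (Fin n), Orthonormal ℝ y →
      ∃ i j k, δ ≤ |inner ℝ (y j) (L (t i) (y k))|)
    (hJ1 : 2 * (M : ℝ) / M ^ J ≤ 1) (hJ2 : 2 * (M : ℝ) / M ^ J * (n * (1 + (1 + C) ^ 2) + 1) < δ)
    (ε : ℝ) (hε : 0 < ε) (hMε : (2 : ℝ) ^ n * (9 * (n + 1)) ^ n ≤ (M : ℝ) ^ ε)
    (B : ℝ) (hB : 1 ≤ B) (X : Finset (EuclideanSpace ℝ (Fin n)))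
    (hX : ∀ s ∈ X, ∀ s' ∈ X, s ≠ s' → 1 ≤ ‖s - s'‖) (hXB : ∀ x ∈ X, ‖x‖ ≤ n * B)
    (Y : EuclideanSpace ℝ (Fin n) → Finset (EuclideanSpace ℝ (Fin n)))
    (hY : ∀ x ∈ X, ∀ s ∈ Y x, ∀ s' ∈ Y x, s ≠ s' → 1 ≤ ‖s - s'‖)
    (hYB : ∀ x ∈ X, ∀ y ∈ Y x, ‖y‖ ≤ n * B) (hLB : ∀ x ∈ X, ∀ y ∈ Y x, ‖L x y‖ ≤ n * B) :
    ((∑ x ∈ X, (Y x).card : ℕ) : ℝ) ≤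
      ((6 * (n + 1) + 1) ^ n * (M : ℝ) ^ (n * (n * (2 * J)))
      * (2 * n * (n + 1) + 2 * (1 + n + C * n)) ^ n * (M * (1 + n + C * n)) ^ ((R : ℝ) - 1 + ε))
      * B ^ ((n : ℝ) + R - 1 + ε) := by
  classical
  have hM1 : (1 : ℝ) < M := by exact_mod_cast (by omega : 1 < M)
  have hM0 : (0 : ℝ) < M := by linarith
  have hfr : Module.finrank ℝ (EuclideanSpace ℝ (Fin n)) = n := finrank_euclideanSpace_fin
  let e : EuclideanSpace ℝ (Fin n) → OrthonormalBasis (Fin n) ℝ (EuclideanSpace ℝ (Fin n)) :=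
    fun x => (hsym x).eigenvectorBasis hfr
  let lam : EuclideanSpace ℝ (Fin n) → Fin n → ℝ := fun x => (hsym x).eigenvalues hfr
  have he : ∀ x i, L x (e x i) = lam x i • e x i := by
    intro x i
    exact (hsym x).apply_eigenvectorBasis hfr i
  set E : ℝ := 1 + n + C * n with hE
  have hE1 : 1 ≤ E := by
    have : 0 ≤ C * n := by positivity
    have : (0 : ℝ) ≤ n := by positivity
    linarith
  have hlam : ∀ x ∈ X, ∀ i, |lam x i| ≤ C * n * B := by
    intro x hx i
    have h := hL x (e x i)
    rw [he, norm_smul, (e x).norm_eq_one, mul_one, mul_one, Real.norm_eq_abs] at h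
    calc _ ≤ C * ‖x‖ := h
      _ ≤ C * (n * B) := by gcongr; exact hXB x hx
      _ = _ := by ring
  let p : EuclideanSpace ℝ (Fin n) → Fin n → ℕ := fun x i => Nat.log M ⌊|lam x i|⌋₊
  have hp1 : ∀ x i, |lam x i| < (M : ℝ) ^ (p x i + 1) := by
    intro x i
    have h1 : ⌊|lam x i|⌋₊ < M ^ (p x i + 1) := Nat.lt_pow_succ_log_self (by omega) _
    have h2 : |lam x i| < ⌊|lam x i|⌋₊ + 1 := Nat.lt_floor_add_one _
    have h3 : ((⌊|lam x i|⌋₊ + 1 : ℕ) : ℝ) ≤ ((M ^ (p x i + 1) : ℕ) : ℝ) := by exact_mod_cast h1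
    push_cast at h3
    linarith
  have hp2 : ∀ x i, 0 < p x i → (M : ℝ) ^ (p x i) ≤ |lam x i| := by
    intro x i h
    have h0 : ⌊|lam x i|⌋₊ ≠ 0 := by
      intro h0
      simp [p, h0] at h
    have h1 : M ^ (p x i) ≤ ⌊|lam x i|⌋₊ := Nat.pow_log_le_self _ h0
    have h2 : (⌊|lam x i|⌋₊ : ℝ) ≤ |lam x i| := Nat.floor_le (abs_nonneg _)
    have h3 : ((M ^ (p x i) : ℕ) : ℝ) ≤ ⌊|lam x i|⌋₊ := by exact_mod_cast h1
    push_cast at h3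
    linarith
  have hpE : ∀ x ∈ X, ∀ i, (M : ℝ) ^ (p x i) ≤ E * B := by
    intro x hx i
    have hn : (0 : ℝ) ≤ n * B := by positivity
    have hcn : (0 : ℝ) ≤ C * n * B := by positivity
    rcases Nat.eq_zero_or_pos (p x i) with h | h
    · rw [h, pow_zero]; nlinarith
    · have := hp2 x i h
      have := hlam x hx i
      rw [hE]; nlinarith
  obtain ⟨K', hK1, hK2⟩ := exists_nat_pow_near (by nlinarith : 1 ≤ E * B) hM1
  set K := K' + 1 with hK
  have hKM : (M : ℝ) ^ K ≤ M * E * B := by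
    rw [hK, pow_succ]; nlinarith
  have hpK : ∀ x ∈ X, ∀ i, p x i < K + 1 := by
    intro x hx i
    have : (M : ℝ) ^ (p x i) < (M : ℝ) ^ K := lt_of_le_of_lt (hpE x hx i) hK2
    have := (pow_lt_pow_iff_right₀ hM1).1 this
    omega
  set P := Fintype.piFinset fun _ : Fin n => Finset.range (K + 1) with hP
  have hPc : P.card = (K + 1) ^ n := by simp [hP]
  have hmaps : ∀ x ∈ X, p x ∈ P := by
    intro x hx
    simp only [hP, Fintype.mem_piFinset, Finset.mem_range]
    exact hpK x hx
  set G : ℝ := (6 * (n + 1) + 1) ^ n with hG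
  set A : ℝ := (9 * (n + 1)) ^ n with hA
  set D : ℝ := 2 * n * (n + 1) + 2 * E with hD
  have hfib : ∀ q ∈ P, (∑ x ∈ X.filter (fun x => p x = q), ((Y x).card : ℝ)) ≤
      G * (A ^ K * (M : ℝ) ^ (K * (R - 1) + n * (n * (2 * J)))) * (D * B) ^ n := by
    intro q hq
    have hY1 : ∀ x ∈ X.filter (fun x => p x = q),
        ((Y x).card : ℝ) ≤ (D * B) ^ n / (M : ℝ) ^ (∑ i, q i) := by
      intro x hx
      obtain ⟨hx, hxq⟩ := Finset.mem_filter.1 hx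
      rw [le_div_iff₀ (by positivity), ← hxq]
      refine ycount (by omega) (e x) (p x) B E hB (Y x) (hY x hx) ?_ (hpE x hx)
      intro y hy i
      rcases Nat.eq_zero_or_pos (p x i) with h | h
      · rw [h, pow_zero, mul_one]
        calc _ ≤ ‖e x i‖ * ‖y‖ := abs_real_inner_le_norm _ _
          _ ≤ _ := by rw [(e x).norm_eq_one, one_mul]; exact hYB x hx y hy
      · calc |inner ℝ (e x i) y| * (M : ℝ) ^ (p x i) ≤ |inner ℝ (e x i) y| * |lam x i| := by
              gcongr; exact hp2 x i h
          _ = |inner ℝ (e x i) (L x y)| := by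
              rw [← hsym x, he, inner_smul_left, abs_mul, mul_comm]; simp
          _ ≤ ‖e x i‖ * ‖L x y‖ := abs_real_inner_le_norm _ _
          _ ≤ _ := by rw [(e x).norm_eq_one, one_mul]; exact hLB x hx y hy
    have hcard := recur hR hM C δ hC L hsym hL e lam he hgood hJ1 hJ2 q K
      (X.filter (fun x => p x = q))
      (fun s hs s' hs' => hX s (Finset.mem_filter.1 hs).1 s' (Finset.mem_filter.1 hs').1)
      (fun s hs i => by rw [← (Finset.mem_filter.1 hs).2]; exact hp1 s i)
      (fun s hs i => by rw [← (Finset.mem_filter.1 hs).2]; exact hp2 s i) 0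
      (fun s hs => by
        rw [sub_zero]
        refine (hXB s (Finset.mem_filter.1 hs).1).trans (le_trans ?_ hK2.le)
        gcongr
        have : 0 ≤ C * n := by positivity
        linarith)
    have hcard' : ((X.filter (fun x => p x = q)).card : ℝ) ≤
        G * (A ^ K * (M : ℝ) ^ (∑ i, q i + (K * (R - 1) + n * (n * (2 * J))))) := by
      calc ((X.filter (fun x => p x = q)).card : ℝ) ≤
          (((6 * (n + 1) + 1) ^ n * (((9 * (n + 1)) ^ n) ^ K
            * M ^ (∑ j ∈ Finset.range K, expo R J q j)) : ℕ) : ℝ) := by exact_mod_cast hcard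
        _ = G * (A ^ K * (M : ℝ) ^ (∑ j ∈ Finset.range K, expo R J q j)) := by
            push_cast; rfl
        _ ≤ _ := by
            have := expo_sum R J q K
            gcongr
            · exact hM1.le
            · omega
    calc _ ≤ ∑ x ∈ X.filter (fun x => p x = q), (D * B) ^ n / (M : ℝ) ^ (∑ i, q i) :=
          Finset.sum_le_sum hY1
      _ = ((X.filter (fun x => p x = q)).card : ℝ) * ((D * B) ^ n / (M : ℝ) ^ (∑ i, q i)) := by
          rw [Finset.sum_const, nsmul_eq_mul]
      _ ≤ (G * (A ^ K * (M : ℝ) ^ (∑ i, q i + (K * (R - 1) + n * (n * (2 * J))))))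
          * ((D * B) ^ n / (M : ℝ) ^ (∑ i, q i)) := by gcongr
      _ = _ := by
          rw [pow_add _ (∑ i, q i)]
          field_simp
  have htot : ((∑ x ∈ X, (Y x).card : ℕ) : ℝ) ≤ (K + 1) ^ n *
      (G * (A ^ K * (M : ℝ) ^ (K * (R - 1) + n * (n * (2 * J)))) * (D * B) ^ n) := by
    push_cast
    rw [← Finset.sum_fiberwise_of_maps_to hmaps]
    refine (Finset.sum_le_sum hfib).trans ?_
    rw [Finset.sum_const, hPc, nsmul_eq_mul]
    push_cast
    exact le_rfl
  have hK2' : ((K : ℝ) + 1) ^ n ≤ (2 ^ n) ^ K := by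
    rw [← pow_mul, mul_comm, pow_mul]
    gcongr
    have : K + 1 ≤ 2 ^ K := Nat.lt_two_pow_self
    exact_mod_cast this
  have hRr : ((R - 1 : ℕ) : ℝ) = (R : ℝ) - 1 := by push_cast [hR]; ring
  have hR0 : (0 : ℝ) ≤ (R : ℝ) - 1 := by rw [← hRr]; positivity
  have hmain : ((K : ℝ) + 1) ^ n * A ^ K * (M : ℝ) ^ (K * (R - 1)) ≤
      (M * E) ^ ((R : ℝ) - 1 + ε) * B ^ ((R : ℝ) - 1 + ε) := by
    calc ((K : ℝ) + 1) ^ n * A ^ K * (M : ℝ) ^ (K * (R - 1))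
        ≤ (2 ^ n) ^ K * A ^ K * (M : ℝ) ^ (K * (R - 1)) := by gcongr
      _ = (2 ^ n * A) ^ K * ((M : ℝ) ^ K) ^ ((R : ℝ) - 1) := by
          rw [← mul_pow, pow_mul, ← hRr, Real.rpow_natCast]
      _ ≤ ((M : ℝ) ^ ε) ^ K * ((M : ℝ) ^ K) ^ ((R : ℝ) - 1) := by gcongr
      _ = ((M : ℝ) ^ K) ^ ((R : ℝ) - 1 + ε) := by
          rw [add_comm ((R : ℝ) - 1), Real.rpow_add (by positivity), ← Real.rpow_natCast,
            ← Real.rpow_mul hM0.le, ← Real.rpow_natCast, ← Real.rpow_mul hM0.le, mul_comm ε]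
          rw [← Real.rpow_mul hM0.le]
      _ ≤ (M * E * B) ^ ((R : ℝ) - 1 + ε) := by gcongr
      _ = _ := by rw [Real.mul_rpow (by positivity) (by positivity)]
  have hBr : B ^ ((n : ℝ) + R - 1 + ε) = B ^ n * B ^ ((R : ℝ) - 1 + ε) := by
    rw [← Real.rpow_natCast, ← Real.rpow_add (by linarith)]
    congr 1; ring
  refine htot.trans ?_
  rw [hBr, pow_add, mul_pow]
  calc _ = (((K : ℝ) + 1) ^ n * A ^ K * (M : ℝ) ^ (K * (R - 1))) *
        (G * (M : ℝ) ^ (n * (n * (2 * J))) * D ^ n * B ^ n) := by ring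
    _ ≤ ((M * E) ^ ((R : ℝ) - 1 + ε) * B ^ ((R : ℝ) - 1 + ε)) *
        (G * (M : ℝ) ^ (n * (n * (2 * J))) * D ^ n * B ^ n) := by
        gcongr
    _ = _ := by ring

theorem compact_good_b {n R : ℕ} (c : Fin R → MvPolynomial (Fin n) ℤ)
    (hdeg : ∀ r, (c r).IsHomogeneous 3)
    (hsmooth : ∀ z : Fin n → ℂ, z ≠ 0 → (∀ r, aeval z (c r) = 0) →
      (Matrix.of fun (r : Fin R) (j : Fin n) => aeval z (pderiv j (c r))).rank = R)
    (η : ℝ) (hη : 0 < η) (b : ℕ) (hb : b ≤ n) :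
    ∃ δ : ℝ, 0 < δ ∧ ∀ β : Fin R → ℝ, ‖β‖ = 1 →
      ∀ t : Fin (b + R) → EuclideanSpace ℝ (Fin n), (∀ i, ‖t i‖ ≤ 1) →
      EtaIndep η t → ∀ y : Fin (n - b) → EuclideanSpace ℝ (Fin n), Orthonormal ℝ y →
      ∃ a j k, δ ≤ |∑ i', ∑ j', ∑ k', (∑ r, β r * (ten (c r) i' j' k' : ℝ))
        * t a i' * y j j' * y k k'| := by
  classical
  let V := (Fin R → ℝ) × (Fin (b + R) → EuclideanSpace ℝ (Fin n)) ×
    (Fin (n - b) → EuclideanSpace ℝ (Fin n))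
  let g : V → Fin (b + R) → Fin (n - b) → Fin (n - b) → ℝ := fun v a j k =>
    |∑ i', ∑ j', ∑ k', (∑ r, v.1 r * (ten (c r) i' j' k' : ℝ))
        * v.2.1 a i' * v.2.2 j j' * v.2.2 k k'|
  let f : V → ℝ := fun v => ∑ a, ∑ j, ∑ k, g v a j k
  let K : Set V := {v | ‖v.1‖ = 1 ∧ (∀ i, ‖v.2.1 i‖ ≤ 1) ∧ EtaIndep η v.2.1 ∧ Orthonormal ℝ v.2.2}
  have hKc : IsCompact K := by
    refine Metric.isCompact_of_isClosed_isBounded ?_ ?_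
    · refine IsClosed.inter (isClosed_eq (by fun_prop) (by fun_prop)) ?_
      refine IsClosed.inter ?_ (IsClosed.inter ?_ ?_)
      · change IsClosed {v : V | ∀ i, ‖v.2.1 i‖ ≤ 1}
        simp only [Set.ofPred_forall]
        exact isClosed_iInter fun i => isClosed_le (by fun_prop) (by fun_prop)
      · change IsClosed {v : V | EtaIndep η v.2.1}
        unfold EtaIndep
        simp only [Set.ofPred_forall]
        refine isClosed_iInter fun i => isClosed_iInter fun a => isClosed_iInter fun _ =>
          isClosed_le (by fun_prop) (by fun_prop)
      · change IsClosed {v : V | Orthonormal ℝ v.2.2}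
        simp only [orthonormal_iff_ite, Set.ofPred_forall]
        exact isClosed_iInter fun i => isClosed_iInter fun j =>
          isClosed_eq (by fun_prop) (by fun_prop)
    · refine (Metric.isBounded_closedBall (x := (0 : V)) (r := 1)).subset ?_
      rintro ⟨β, t, y⟩ ⟨h1, h2, _, h4⟩
      rw [mem_closedBall_zero_iff, Prod.norm_def, Prod.norm_def]
      refine max_le h1.le (max_le ?_ ?_)
      · exact (pi_norm_le_iff_of_nonneg zero_le_one).2 h2
      · exact (pi_norm_le_iff_of_nonneg zero_le_one).2 fun i => (h4.1 i).le
  have hfc : Continuous f := by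
    change Continuous fun v : (Fin R → ℝ) × (Fin (b + R) → EuclideanSpace ℝ (Fin n)) ×
        (Fin (n - b) → EuclideanSpace ℝ (Fin n)) => ∑ a, ∑ j, ∑ k, |∑ i', ∑ j', ∑ k',
      (∑ r, v.1 r * (ten (c r) i' j' k' : ℝ)) * v.2.1 a i' * v.2.2 j j' * v.2.2 k k'|
    fun_prop
  have hlift : ∀ {m : ℕ} (t : Fin m → EuclideanSpace ℝ (Fin n)), LinearIndependent ℝ t →
      LinearIndependent ℝ (fun a => (fun i => t a i : Fin n → ℝ)) := by
    intro m t ht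
    exact ht.map' (WithLp.linearEquiv 2 ℝ (Fin n → ℝ)).toLinearMap (LinearEquiv.ker _)
  have hpos : ∀ v ∈ K, 0 < f v := by
    rintro ⟨β, t, y⟩ ⟨h1, h2, h3, h4⟩
    have hnn : ∀ a j k, 0 ≤ g (β, t, y) a j k := fun a j k => abs_nonneg _
    have h0 : 0 ≤ f (β, t, y) := Finset.sum_nonneg fun a _ => Finset.sum_nonneg fun j _ =>
      Finset.sum_nonneg fun k _ => hnn a j k
    refine lt_of_le_of_ne h0 fun heq => ?_
    have hβ : β ≠ 0 := by
      intro h; simp [h] at h1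
    refine geom c hdeg hsmooth β hβ (m := b + R) (q := n - b) (by omega) _ _
      (hlift t (h3.linearIndependent hη)) (hlift y h4.linearIndependent) ?_
    intro a j k
    have e1 := (Finset.sum_eq_zero_iff_of_nonneg fun a _ => Finset.sum_nonneg fun j _ =>
      Finset.sum_nonneg fun k _ => hnn a j k).1 heq.symm a (Finset.mem_univ _)
    have e2 := (Finset.sum_eq_zero_iff_of_nonneg fun j _ =>
      Finset.sum_nonneg fun k _ => hnn a j k).1 e1 j (Finset.mem_univ _)
    have e3 := (Finset.sum_eq_zero_iff_of_nonneg fun k _ => hnn a j k).1 e2 k (Finset.mem_univ _)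
    exact abs_eq_zero.1 e3
  have hmin : ∃ δ0 : ℝ, 0 < δ0 ∧ ∀ v ∈ K, δ0 ≤ f v := by
    rcases K.eq_empty_or_nonempty with h | h
    · exact ⟨1, one_pos, by simp [h]⟩
    · obtain ⟨v, hv, hmin⟩ := hKc.exists_isMinOn h hfc.continuousOn
      exact ⟨f v, hpos v hv, fun w hw => hmin hw⟩
  obtain ⟨δ0, hδ0, hmin⟩ := hmin
  set N : ℝ := ((b + R : ℕ) : ℝ) * (((n - b : ℕ) : ℝ) * ((n - b : ℕ) : ℝ)) with hN
  have hN0 : 0 ≤ N := by positivity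
  refine ⟨δ0 / (N + 1), by positivity, ?_⟩
  intro β h1 t h2 h3 y h4
  by_contra! hcon
  have hle : f (β, t, y) ≤ N * (δ0 / (N + 1)) := by
    calc f (β, t, y) ≤ ∑ a : Fin (b + R), ∑ j : Fin (n - b), ∑ k : Fin (n - b), δ0 / (N + 1) :=
          Finset.sum_le_sum fun a _ => Finset.sum_le_sum fun j _ => Finset.sum_le_sum fun k _ =>
            (hcon a j k).le
      _ = _ := by simp [hN]; ring
  have h5 := hmin (β, t, y) ⟨h1, h2, h3, h4⟩
  have h6 : N * (δ0 / (N + 1)) < δ0 := by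
    rw [← mul_div_assoc, div_lt_iff₀ (by positivity)]
    nlinarith
  linarith

theorem compact_good {n R : ℕ} (c : Fin R → MvPolynomial (Fin n) ℤ)
    (hdeg : ∀ r, (c r).IsHomogeneous 3)
    (hsmooth : ∀ z : Fin n → ℂ, z ≠ 0 → (∀ r, aeval z (c r) = 0) →
      (Matrix.of fun (r : Fin R) (j : Fin n) => aeval z (pderiv j (c r))).rank = R)
    (η : ℝ) (hη : 0 < η) :
    ∃ δ : ℝ, 0 < δ ∧ ∀ b ≤ n, ∀ β : Fin R → ℝ, 
      ∀ t : Fin (b + R) → EuclideanSpace ℝ (Fin n), (∀ i, ‖t i‖ ≤ 1) →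
      EtaIndep η t → ∀ y : Fin (n - b) → EuclideanSpace ℝ (Fin n), Orthonormal ℝ y → β ≠ 0 → 
      ∃ a j k, ‖β‖ * δ ≤ |∑ i', ∑ j', ∑ k', (∑ r, β r * (ten (c r) i' j' k' : ℝ))
        * t a i' * y j j' * y k k'| := by
  have h : ∀ b : ℕ, ∃ δ : ℝ, 0 < δ ∧ (b ≤ n → ∀ β : Fin R → ℝ, ‖β‖ = 1 →
      ∀ t : Fin (b + R) → EuclideanSpace ℝ (Fin n), (∀ i, ‖t i‖ ≤ 1) →
      EtaIndep η t → ∀ y : Fin (n - b) → EuclideanSpace ℝ (Fin n), Orthonormal ℝ y →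
      ∃ a j k, δ ≤ |∑ i', ∑ j', ∑ k', (∑ r, β r * (ten (c r) i' j' k' : ℝ))
        * t a i' * y j j' * y k k'|) := by
    intro b
    by_cases hb : b ≤ n
    · obtain ⟨δ, h1, h2⟩ := compact_good_b c hdeg hsmooth η hη b hb
      exact ⟨δ, h1, fun _ => h2⟩
    · exact ⟨1, one_pos, fun h => absurd h hb⟩
  choose δ hδ hh using h
  have hne : (Finset.range (n + 1)).Nonempty := ⟨0, by simp⟩
  refine ⟨(Finset.range (n + 1)).inf' hne δ, ?_, ?_⟩
  · rw [Finset.lt_inf'_iff]; exact fun b _ => hδ b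
  · intro b hb β t h2 h3 y h4 hβ
    have hβ' : 0 < ‖β‖ := norm_pos_iff.2 hβ
    obtain ⟨a, j, k, h⟩ := hh b hb (‖β‖⁻¹ • β) (by
      rw [norm_smul, norm_inv, norm_norm, inv_mul_cancel₀ hβ'.ne']) t h2 h3 y h4
    refine ⟨a, j, k, ?_⟩
    have hle : (Finset.range (n + 1)).inf' hne δ ≤ δ b :=
      Finset.inf'_le _ (Finset.mem_range.2 (by omega))
    have e : (∑ i', ∑ j', ∑ k', (∑ r, (‖β‖⁻¹ • β) r * (ten (c r) i' j' k' : ℝ))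
        * t a i' * y j j' * y k k') = ‖β‖⁻¹ * ∑ i', ∑ j', ∑ k',
        (∑ r, β r * (ten (c r) i' j' k' : ℝ)) * t a i' * y j j' * y k k' := by
      simp only [Finset.mul_sum, Finset.sum_mul, Pi.smul_apply, smul_eq_mul, mul_assoc]
    rw [e, abs_mul, abs_of_pos (inv_pos.2 hβ'), le_inv_mul_iff₀ hβ'] at h
    exact (mul_le_mul_of_nonneg_left hle hβ'.le).trans h

/-- The symmetric coefficient tensor of `β·c`. -/
noncomputable def gten {n R : ℕ} (c : Fin R → MvPolynomial (Fin n) ℤ) (β : Fin R → ℝ)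
    (i j k : Fin n) : ℝ := ∑ r, β r * (ten (c r) i j k : ℝ)

theorem gten_swap12 {n R : ℕ} (c : Fin R → MvPolynomial (Fin n) ℤ) (β : Fin R → ℝ)
    (i j k : Fin n) : gten c β i j k = gten c β j i k := by
  simp only [gten, ten_swap12 _ i j k]

theorem gten_swap23 {n R : ℕ} (c : Fin R → MvPolynomial (Fin n) ℤ) (β : Fin R → ℝ)
    (i j k : Fin n) : gten c β i j k = gten c β i k j := by
  simp only [gten, ten_swap23 _ i j k]

theorem eval_map_int {n : ℕ} (x : Fin n → ℝ) (p : MvPolynomial (Fin n) ℤ) :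
    MvPolynomial.eval x (MvPolynomial.map (Int.castRingHom ℝ) p) = aeval x p := by
  rw [eval_map, aeval_def]; rfl

theorem hess_entry {n R : ℕ} (c : Fin R → MvPolynomial (Fin n) ℤ)
    (hdeg : ∀ r, (c r).IsHomogeneous 3) (β : Fin R → ℝ) (x : Fin n → ℝ) (i j : Fin n) :
    MvPolynomial.eval x (pderiv i (pderiv j
      (∑ r, β r • MvPolynomial.map (Int.castRingHom ℝ) (c r)))) = ∑ k, gten c β i j k * x k := by
  simp only [map_sum, Derivation.map_smul, pderiv_map, smul_eval, eval_map_int,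
    aeval_pderiv2 (hdeg _), gten, Finset.sum_mul, Finset.mul_sum, mul_assoc]
  rw [Finset.sum_comm]

theorem third_entry {n R : ℕ} (c : Fin R → MvPolynomial (Fin n) ℤ)
    (hdeg : ∀ r, (c r).IsHomogeneous 3) (β : Fin R → ℝ) (x : Fin n → ℝ) (i j k : Fin n) :
    MvPolynomial.eval x (pderiv i (pderiv j (pderiv k
      (∑ r, β r • MvPolynomial.map (Int.castRingHom ℝ) (c r))))) = gten c β i j k := by
  simp only [map_sum, Derivation.map_smul, pderiv_map, smul_eval, eval_map_int,
    pderiv3_eq (hdeg _), gten]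
  simp

theorem gten_le_norm {n R : ℕ} (c : Fin R → MvPolynomial (Fin n) ℤ)
    (hdeg : ∀ r, (c r).IsHomogeneous 3) (β : Fin R → ℝ) (i j k : Fin n) :
    |gten c β i j k| ≤ 6 * cubicNorm (∑ r, β r • MvPolynomial.map (Int.castRingHom ℝ) (c r)) := by
  unfold cubicNorm
  simp only [third_entry c hdeg]
  have h1 : |gten c β i j k| ≤ ⨆ k, |gten c β i j k| :=
    le_ciSup (f := fun k => |gten c β i j k|) (Set.finite_range _).bddAbove k
  have h2 : (⨆ k, |gten c β i j k|) ≤ ⨆ j, ⨆ k, |gten c β i j k| :=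
    le_ciSup (f := fun j => ⨆ k, |gten c β i j k|) (Set.finite_range _).bddAbove j
  have h3 : (⨆ j, ⨆ k, |gten c β i j k|) ≤ ⨆ i, ⨆ j, ⨆ k, |gten c β i j k| :=
    le_ciSup (f := fun i => ⨆ j, ⨆ k, |gten c β i j k|) (Set.finite_range _).bddAbove i
  linarith

theorem cubicNorm_nonneg {n : ℕ} (f : MvPolynomial (Fin n) ℝ) : 0 ≤ cubicNorm f := by
  unfold cubicNorm
  exact mul_nonneg (by norm_num) (Real.iSup_nonneg fun i => Real.iSup_nonneg fun j =>
    Real.iSup_nonneg fun k => abs_nonneg _)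

theorem le_sum_aux {n : ℕ} (f : Fin n × Fin n × Fin n → ℝ) (hf : ∀ q, 0 ≤ f q)
    (q : Fin n × Fin n × Fin n) : f q ≤ ∑ q, f q :=
  Finset.single_le_sum (fun q _ => hf q) (Finset.mem_univ q)

theorem cubicNorm_le {n R : ℕ} (c : Fin R → MvPolynomial (Fin n) ℤ)
    (hdeg : ∀ r, (c r).IsHomogeneous 3) : ∃ C1 : ℝ, 0 < C1 ∧ ∀ β : Fin R → ℝ,
    cubicNorm (∑ r, β r • MvPolynomial.map (Int.castRingHom ℝ) (c r)) ≤ C1 * ‖β‖ := by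
  obtain ⟨C0, hC0⟩ : ∃ C0 : ℝ, C0 = ∑ q : Fin n × Fin n × Fin n, ∑ r,
      |(ten (c r) q.1 q.2.1 q.2.2 : ℝ)| := ⟨_, rfl⟩
  have hC0' : 0 ≤ C0 := by
    rw [hC0]
    exact Finset.sum_nonneg fun q _ => Finset.sum_nonneg fun r _ => abs_nonneg _
  refine ⟨C0 + 1, by positivity, fun β => ?_⟩
  have h : ∀ i j k, |gten c β i j k| ≤ C0 * ‖β‖ := by
    intro i j k
    calc |gten c β i j k| ≤ ∑ r, |β r * (ten (c r) i j k : ℝ)| := Finset.abs_sum_le_sum_abs _ _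
      _ ≤ ∑ r, |(ten (c r) i j k : ℝ)| * ‖β‖ := by
          refine Finset.sum_le_sum fun r _ => ?_
          rw [abs_mul, mul_comm]
          gcongr
          exact norm_le_pi_norm β r
      _ = (∑ r, |(ten (c r) i j k : ℝ)|) * ‖β‖ := by rw [Finset.sum_mul]
      _ ≤ C0 * ‖β‖ := by
          refine mul_le_mul_of_nonneg_right ?_ (norm_nonneg _)
          rw [hC0]
          exact le_sum_aux (fun q => ∑ r, |(ten (c r) q.1 q.2.1 q.2.2 : ℝ)|)
            (fun q => Finset.sum_nonneg fun r _ => abs_nonneg _) (i, j, k)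
  have h0 : 0 ≤ C0 * ‖β‖ := by positivity
  have hs : (⨆ i, ⨆ j, ⨆ k, |gten c β i j k|) ≤ C0 * ‖β‖ :=
    Real.iSup_le (fun i => Real.iSup_le (fun j => Real.iSup_le (fun k => h i j k) h0) h0) h0
  unfold cubicNorm
  simp only [third_entry c hdeg]
  have := norm_nonneg β
  linarith

theorem cubicNorm_pos {n R : ℕ} (hnR : R ≤ n) (c : Fin R → MvPolynomial (Fin n) ℤ)
    (hdeg : ∀ r, (c r).IsHomogeneous 3)
    (hsmooth : ∀ z : Fin n → ℂ, z ≠ 0 → (∀ r, aeval z (c r) = 0) →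
      (Matrix.of fun (r : Fin R) (j : Fin n) => aeval z (pderiv j (c r))).rank = R)
    (β : Fin R → ℝ) (hβ : β ≠ 0) :
    0 < cubicNorm (∑ r, β r • MvPolynomial.map (Int.castRingHom ℝ) (c r)) := by
  refine lt_of_le_of_ne (cubicNorm_nonneg _) fun h => ?_
  have h0 : ∀ i j k, gten c β i j k = 0 := by
    intro i j k
    have := gten_le_norm c hdeg β i j k
    rw [← h, mul_zero] at this
    exact abs_nonpos_iff.1 this
  have hb : LinearIndependent ℝ (fun i : Fin n => (Pi.single i 1 : Fin n → ℝ)) := by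
    have e : (fun i : Fin n => (Pi.single i 1 : Fin n → ℝ)) = ⇑(Pi.basisFun ℝ (Fin n)) := by
      funext i; exact (Pi.basisFun_apply ℝ (Fin n) i).symm
    rw [e]
    exact (Pi.basisFun ℝ (Fin n)).linearIndependent
  refine geom c hdeg hsmooth β hβ (m := R) (q := n) (by omega) _ _
    (hb.comp (Fin.castLE hnR) (Fin.castLE_injective hnR)) hb ?_
  intro a b b'
  refine Finset.sum_eq_zero fun i _ => Finset.sum_eq_zero fun j _ => Finset.sum_eq_zero fun k _ => ?_
  have := h0 i j k
  unfold gten at this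
  rw [this]; ring

/-- The normalised bilinear map `(x, y) ↦ H(x) y`. -/
noncomputable def Lmap {n : ℕ} (g : Fin n → Fin n → Fin n → ℝ) :
    EuclideanSpace ℝ (Fin n) →ₗ[ℝ] EuclideanSpace ℝ (Fin n) →ₗ[ℝ] EuclideanSpace ℝ (Fin n) :=
  LinearMap.mk₂ ℝ (fun x y => WithLp.toLp 2 fun i => ∑ j, ∑ k, g i j k * x k * y j)
    (by intro x x' y; ext i; simp [mul_add, add_mul, Finset.sum_add_distrib])
    (by intro a x y; ext i; simp only [PiLp.smul_apply, smul_eq_mul, Finset.mul_sum]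
        refine Finset.sum_congr rfl fun j _ => Finset.sum_congr rfl fun k _ => ?_
        ring)
    (by intro x y y'; ext i; simp [mul_add, Finset.sum_add_distrib])
    (by intro a x y; ext i; simp only [PiLp.smul_apply, smul_eq_mul, Finset.mul_sum]
        refine Finset.sum_congr rfl fun j _ => Finset.sum_congr rfl fun k _ => ?_
        ring)

theorem Lmap_apply {n : ℕ} (g : Fin n → Fin n → Fin n → ℝ) (x y : EuclideanSpace ℝ (Fin n))
    (i : Fin n) : Lmap g x y i = ∑ j, ∑ k, g i j k * x k * y j := rfl

theorem euc_norm_le {n : ℕ} (v : EuclideanSpace ℝ (Fin n)) : ‖v‖ ≤ ∑ i, |v i| := by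
  rw [EuclideanSpace.norm_eq]
  refine Real.sqrt_le_iff.2 ⟨by positivity, ?_⟩
  simp only [Real.norm_eq_abs]
  exact Finset.sum_sq_le_sq_sum_of_nonneg fun i _ => abs_nonneg _

theorem Lmap_inner {n : ℕ} (g : Fin n → Fin n → Fin n → ℝ) (x y z : EuclideanSpace ℝ (Fin n)) :
    inner ℝ z (Lmap g x y) = ∑ i, ∑ j, ∑ k, g i j k * x k * y j * z i := by
  simp only [PiLp.inner_apply, Lmap_apply, RCLike.inner_apply, conj_trivial, Finset.sum_mul]

theorem Lmap_symm {n : ℕ} (g : Fin n → Fin n → Fin n → ℝ) (hg : ∀ i j k, g i j k = g j i k)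
    (x : EuclideanSpace ℝ (Fin n)) : (Lmap g x).IsSymmetric := by
  intro y z
  rw [real_inner_comm, Lmap_inner, Lmap_inner, Finset.sum_comm]
  refine Finset.sum_congr rfl fun i _ => Finset.sum_congr rfl fun j _ =>
    Finset.sum_congr rfl fun k _ => ?_
  rw [hg]; ring

theorem Lmap_bound {n : ℕ} (g : Fin n → Fin n → Fin n → ℝ) (hg : ∀ i j k, |g i j k| ≤ 6)
    (x y : EuclideanSpace ℝ (Fin n)) : ‖Lmap g x y‖ ≤ 6 * n ^ 3 * ‖x‖ * ‖y‖ := by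
  refine (euc_norm_le _).trans ?_
  calc ∑ i, |Lmap g x y i| ≤ ∑ i : Fin n, ∑ j : Fin n, ∑ k : Fin n, 6 * ‖x‖ * ‖y‖ := by
        refine Finset.sum_le_sum fun i _ => ?_
        rw [Lmap_apply]
        refine (Finset.abs_sum_le_sum_abs _ _).trans (Finset.sum_le_sum fun j _ => ?_)
        refine (Finset.abs_sum_le_sum_abs _ _).trans (Finset.sum_le_sum fun k _ => ?_)
        rw [abs_mul, abs_mul]
        gcongr
        · exact hg i j k
        · exact PiLp.norm_apply_le x k
        · exact PiLp.norm_apply_le y j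
    _ = _ := by simp; ring

/-- Integer points embedded in Euclidean space. -/
noncomputable def emb {n : ℕ} (x : Fin n → ℤ) : EuclideanSpace ℝ (Fin n) :=
  WithLp.toLp 2 fun i => (x i : ℝ)

theorem emb_apply {n : ℕ} (x : Fin n → ℤ) (i : Fin n) : emb x i = (x i : ℝ) := rfl

theorem emb_inj {n : ℕ} : Function.Injective (emb (n := n)) := by
  intro x y h
  ext i
  have := congrArg (fun v : EuclideanSpace ℝ (Fin n) => v i) h
  simpa [emb_apply] using this

theorem emb_sep {n : ℕ} (x y : Fin n → ℤ) (h : emb x ≠ emb y) : 1 ≤ ‖emb x - emb y‖ := by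
  have hne : x ≠ y := fun h' => h (by rw [h'])
  obtain ⟨i, hi⟩ := Function.ne_iff.1 hne
  refine le_trans ?_ (PiLp.norm_apply_le (emb x - emb y) i)
  rw [PiLp.sub_apply, emb_apply, emb_apply, Real.norm_eq_abs]
  have : 1 ≤ |x i - y i| := Int.one_le_abs (sub_ne_zero.2 hi)
  exact_mod_cast this

theorem euc_norm_le_mul {n : ℕ} (v : EuclideanSpace ℝ (Fin n)) (B : ℝ) (h : ∀ i, |v i| ≤ B) :
    ‖v‖ ≤ n * B := by
  refine (euc_norm_le v).trans ?_
  calc _ ≤ ∑ i : Fin n, B := Finset.sum_le_sum fun i _ => h i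
    _ = _ := by simp

/-- The box of integer points. -/
noncomputable def boxZ (n : ℕ) (B : ℝ) : Finset (Fin n → ℤ) :=
  Fintype.piFinset fun _ => Finset.Icc (-⌊B⌋) ⌊B⌋

theorem mem_boxZ {n : ℕ} (B : ℝ) (x : Fin n → ℤ) : x ∈ boxZ n B ↔ ∀ i, (|x i| : ℝ) ≤ B := by
  simp only [boxZ, Fintype.mem_piFinset, Finset.mem_Icc]
  refine forall_congr' fun i => ?_
  rw [← abs_le, Int.le_floor]
  push_cast
  rfl

theorem Naux_trivial {n : ℕ} (f : MvPolynomial (Fin n) ℝ) (B : ℝ) (hB : 1 ≤ B) :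
    (Naux f B : ℝ) ≤ (3 * B) ^ n * (3 * B) ^ n := by
  have h1 : Naux f B ≤ ((boxZ n B) ×ˢ (boxZ n B)).card := by
    rw [← Set.ncard_coe_finset]
    unfold Naux
    refine Set.ncard_le_ncard ?_ (Finset.finite_toSet _)
    rintro ⟨x, y⟩ ⟨hx, hy, _⟩
    rw [Finset.mem_coe, Finset.mem_product]
    exact ⟨(mem_boxZ B x).2 hx, (mem_boxZ B y).2 hy⟩
  have h2 : ((boxZ n B).card : ℝ) ≤ (3 * B) ^ n := by
    simp only [boxZ, Fintype.card_piFinset, Finset.prod_const, Finset.card_univ, Fintype.card_fin,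
      Int.card_Icc]
    push_cast
    have h0 : 0 ≤ ⌊B⌋ := Int.floor_nonneg.2 (by linarith)
    have hz : ((⌊B⌋ + 1 - -⌊B⌋).toNat : ℝ) = ((⌊B⌋ + 1 - -⌊B⌋ : ℤ) : ℝ) := by
      have := Int.toNat_of_nonneg (a := ⌊B⌋ + 1 - -⌊B⌋) (by omega)
      exact_mod_cast this
    rw [hz]
    push_cast
    have h0' : (0 : ℝ) ≤ ⌊B⌋ := by exact_mod_cast h0
    gcongr
    · linarith
    · linarith [Int.floor_le B]
  rw [Finset.card_product] at h1
  calc (Naux f B : ℝ) ≤ ((boxZ n B).card : ℝ) * (boxZ n B).card := by exact_mod_cast h1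
    _ ≤ _ := by gcongr

theorem Naux_le_sum {n R : ℕ} (c : Fin R → MvPolynomial (Fin n) ℤ)
    (hdeg : ∀ r, (c r).IsHomogeneous 3) (β : Fin R → ℝ) (B : ℝ)
    (g : Fin n → Fin n → Fin n → ℝ)
    (hg : ∀ i j k, g i j k = (cubicNorm (∑ r, β r • MvPolynomial.map (Int.castRingHom ℝ) (c r)))⁻¹
      * gten c β i j k)
    (X : Finset (EuclideanSpace ℝ (Fin n))) (hX : X = (boxZ n B).map ⟨emb, emb_inj⟩)
    (Y : EuclideanSpace ℝ (Fin n) → Finset (EuclideanSpace ℝ (Fin n)))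
    (hY : ∀ x y, y ∈ Y x ↔ y ∈ X ∧ ‖Lmap g x y‖ ≤ n * B) :
    Naux (∑ r, β r • MvPolynomial.map (Int.castRingHom ℝ) (c r)) B ≤ ∑ x ∈ X, (Y x).card := by
  rw [← Finset.card_sigma, ← Set.ncard_coe_finset]
  unfold Naux
  refine Set.ncard_le_ncard_of_injOn (fun p => ⟨emb p.1, emb p.2⟩) ?_ ?_ (Finset.finite_toSet _)
  · rintro ⟨x, y⟩ ⟨hx, hy, hxy⟩
    have hx' : emb x ∈ X := by
      rw [hX, Finset.mem_map]; exact ⟨x, (mem_boxZ B x).2 hx, rfl⟩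
    have hy' : emb y ∈ X := by
      rw [hX, Finset.mem_map]; exact ⟨y, (mem_boxZ B y).2 hy, rfl⟩
    rw [Finset.mem_coe, Finset.mem_sigma, hY]
    refine ⟨hx', hy', euc_norm_le_mul _ _ fun i => ?_⟩
    refine le_trans (le_of_eq ?_) (hxy i).le
    congr 1
    rw [Lmap_apply]
    simp only [Matrix.mulVec, dotProduct, hessMat, Matrix.of_apply, hess_entry c hdeg, emb_apply, hg,
      Finset.mul_sum, Finset.sum_mul, mul_assoc]
  · rintro ⟨x, y⟩ _ ⟨x', y'⟩ _ h
    simp only [Sigma.mk.injEq, heq_eq_eq] at h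
    rw [emb_inj h.1, emb_inj h.2]

theorem exists_M (n : ℕ) (ε : ℝ) (hε : 0 < ε) :
    ∃ M : ℕ, 2 ≤ M ∧ (2 : ℝ) ^ n * (9 * (n + 1)) ^ n ≤ (M : ℝ) ^ ε := by
  have h := (tendsto_rpow_atTop hε).comp tendsto_natCast_atTop_atTop
  obtain ⟨M, h1, h2⟩ := ((Filter.eventually_ge_atTop 2).and
    (h.eventually_ge_atTop ((2 : ℝ) ^ n * (9 * (n + 1)) ^ n))).exists
  exact ⟨M, h1, h2⟩

theorem exists_J (M : ℕ) (hM : 2 ≤ M) (W δ : ℝ) (hδ : 0 < δ) :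
    ∃ J : ℕ, 2 * (M : ℝ) / M ^ J ≤ 1 ∧ 2 * (M : ℝ) / M ^ J * (W + 1) < δ := by
  have hM2 : (2 : ℝ) ≤ M := by exact_mod_cast hM
  have h : Filter.Tendsto (fun J : ℕ => 2 * (M : ℝ) / M ^ J) Filter.atTop (nhds 0) :=
    (tendsto_pow_atTop_atTop_of_one_lt (by linarith)).const_div_atTop _
  have h' : Filter.Tendsto (fun J : ℕ => 2 * (M : ℝ) / M ^ J * (W + 1)) Filter.atTop (nhds 0) := by
    simpa using h.mul_const (W + 1)
  obtain ⟨J, h1, h2⟩ := ((h.eventually_le_const one_pos).and (h'.eventually_lt_const hδ)).exists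
  exact ⟨J, h1, h2⟩

/-- the bound (2.7) of the paper: if the integral cubic forms
`c_1, …, c_R` are linearly independent, generate the homogeneous ideal of
`V(c_1, …, c_R)`, and define a smooth complete intersection, then for every
`ε > 0` there is a constant `C` such that `N^aux_{β·c}(B) ≤ C·B^{n+R−1+ε}` for
every nonzero `β ∈ ℝ^R` and every `B ≥ 1`. -/
theorem statement3 (n R : ℕ)
    (c : Fin R → MvPolynomial (Fin n) ℤ)
    (hdeg : ∀ r, (c r).IsHomogeneous 3)
    (hlin : LinearIndependent ℚ fun r => MvPolynomial.map (Int.castRingHom ℚ) (c r))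
    (hgen : ∀ f : MvPolynomial (Fin n) ℚ,
      (∀ z : Fin n → ℂ, (∀ r, aeval z (c r) = 0) → aeval z f = 0) →
      f ∈ Ideal.span (Set.range fun r => MvPolynomial.map (Int.castRingHom ℚ) (c r)))
    (hsmooth : ∀ z : Fin n → ℂ, z ≠ 0 → (∀ r, aeval z (c r) = 0) →
      (Matrix.of fun (r : Fin R) (j : Fin n) => aeval z (pderiv j (c r))).rank = R)
    (hdim : ringKrullDim (MvPolynomial (Fin n) ℂ ⧸
        Ideal.span (Set.range fun r => MvPolynomial.map (Int.castRingHom ℂ) (c r)))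
      = ((n - R : ℕ) : WithBot ℕ∞)) :
    ∀ ε : ℝ, 0 < ε → ∃ Cst : ℝ, 0 < Cst ∧
      ∀ β : Fin R → ℝ, β ≠ 0 → ∀ B : ℝ, 1 ≤ B →
        (Naux (∑ r, β r • MvPolynomial.map (Int.castRingHom ℝ) (c r)) B : ℝ) ≤
          Cst * B ^ ((n : ℝ) + R - 1 + ε) := by
  intro ε hε
  rcases Nat.eq_zero_or_pos R with hR0 | hR
  · subst hR0
    exact ⟨1, one_pos, fun β hβ => absurd (Subsingleton.elim _ _) hβ⟩
  rcases Nat.lt_or_ge n R with hnR | hnR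
  · refine ⟨9 ^ n, by positivity, fun β hβ B hB => ?_⟩
    have hnR' : (n : ℝ) + 1 ≤ R := by exact_mod_cast hnR
    calc _ ≤ (3 * B) ^ n * (3 * B) ^ n := Naux_trivial _ B hB
      _ = 9 ^ n * B ^ ((n : ℝ) + n) := by
          rw [Real.rpow_add (by linarith), Real.rpow_natCast, ← mul_pow, ← mul_pow, ← mul_pow]
          congr 1; ring
      _ ≤ _ := by
          exact mul_le_mul_of_nonneg_left
            (Real.rpow_le_rpow_of_exponent_le hB (by linarith)) (by positivity)
  obtain ⟨M, hM, hMε⟩ := exists_M n ε hε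
  have hM0 : (0 : ℝ) < M := by exact_mod_cast (by omega : 0 < M)
  obtain ⟨δ0, hδ0, hgood⟩ := compact_good c hdeg hsmooth (1 / (8 * M)) (by positivity)
  obtain ⟨C1, hC1, hcn⟩ := cubicNorm_le c hdeg
  set C : ℝ := 6 * n ^ 3 with hC
  have hC0 : 0 ≤ C := by positivity
  obtain ⟨J, hJ1, hJ2⟩ := exists_J M hM (n * (1 + (1 + C) ^ 2)) (δ0 / C1) (by positivity)
  refine ⟨((6 * (n + 1) + 1) ^ n * (M : ℝ) ^ (n * (n * (2 * J)))
      * (2 * n * (n + 1) + 2 * (1 + n + C * n)) ^ n * (M * (1 + n + C * n)) ^ ((R : ℝ) - 1 + ε)),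
      by positivity, ?_⟩
  intro β hβ B hB
  classical
  set N := cubicNorm (∑ r, β r • MvPolynomial.map (Int.castRingHom ℝ) (c r)) with hN
  have hNpos : 0 < N := cubicNorm_pos hnR c hdeg hsmooth β hβ
  let g : Fin n → Fin n → Fin n → ℝ := fun i j k => N⁻¹ * gten c β i j k
  have hg6 : ∀ i j k, |g i j k| ≤ 6 := by
    intro i j k
    change |N⁻¹ * gten c β i j k| ≤ 6
    rw [abs_mul, abs_of_pos (inv_pos.2 hNpos), inv_mul_le_iff₀ hNpos, mul_comm]
    exact gten_le_norm c hdeg β i j k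
  set X : Finset (EuclideanSpace ℝ (Fin n)) := (boxZ n B).map ⟨emb, emb_inj⟩ with hX
  let Y : EuclideanSpace ℝ (Fin n) → Finset (EuclideanSpace ℝ (Fin n)) := fun x =>
    X.filter fun y => ‖Lmap g x y‖ ≤ n * B
  have hXsep : ∀ s ∈ X, ∀ s' ∈ X, s ≠ s' → 1 ≤ ‖s - s'‖ := by
    intro s hs s' hs'
    obtain ⟨x, _, rfl⟩ := Finset.mem_map.1 hs
    obtain ⟨x', _, rfl⟩ := Finset.mem_map.1 hs'
    exact emb_sep x x'
  have hXB : ∀ x ∈ X, ‖x‖ ≤ n * B := by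
    intro s hs
    obtain ⟨x, hx, rfl⟩ := Finset.mem_map.1 hs
    exact euc_norm_le_mul _ _ ((mem_boxZ B x).1 hx)
  have hcount := Naux_le_sum c hdeg β B g (fun i j k => rfl) X hX Y
    (fun x y => Finset.mem_filter)
  refine le_trans (Nat.cast_le.2 hcount) ?_
  refine theoremA hR hM C (δ0 / C1) hC0 (Lmap g)
    (Lmap_symm g (fun i j k => by
      change N⁻¹ * gten c β i j k = N⁻¹ * gten c β j i k
      rw [gten_swap12])) (Lmap_bound g hg6) ?_ hJ1 hJ2 ε hε hMε B hB X hXsep hXB Y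
    (fun x _ s hs s' hs' => hXsep s (Finset.mem_filter.1 hs).1 s' (Finset.mem_filter.1 hs').1)
    (fun x _ y hy => hXB y (Finset.mem_filter.1 hy).1)
    (fun x _ y hy => (Finset.mem_filter.1 hy).2)
  intro b hb t ht hti y hy
  obtain ⟨a, j, k, h⟩ := hgood b hb β t ht hti y hy hβ
  refine ⟨a, j, k, ?_⟩
  have e : inner ℝ (y j) (Lmap g (t a) (y k)) = N⁻¹ * ∑ i', ∑ j', ∑ k',
      (∑ r, β r * (ten (c r) i' j' k' : ℝ)) * t a i' * y j j' * y k k' := by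
    rw [Lmap_inner, Finset.mul_sum]
    have : ∀ i' : Fin n, ∑ j', ∑ k', g i' j' k' * t a k' * y k j' * y j i'
        = ∑ k', ∑ j', g i' j' k' * t a k' * y k j' * y j i' := fun i' => Finset.sum_comm
    rw [Finset.sum_congr rfl fun i' _ => this i', Finset.sum_comm]
    refine Finset.sum_congr rfl fun i' _ => ?_
    rw [Finset.mul_sum]
    refine Finset.sum_congr rfl fun j' _ => ?_
    rw [Finset.mul_sum]
    refine Finset.sum_congr rfl fun k' _ => ?_
    have hs : g j' k' i' = N⁻¹ * ∑ r, β r * (ten (c r) i' j' k' : ℝ) := by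
      change N⁻¹ * gten c β j' k' i' = N⁻¹ * gten c β i' j' k'
      rw [gten_swap23, gten_swap12]
    rw [hs]; ring
  rw [e, abs_mul, abs_of_pos (inv_pos.2 hNpos), le_inv_mul_iff₀ hNpos]
  refine le_trans ?_ h
  rw [← mul_div_assoc, div_le_iff₀ hC1]
  have := mul_le_mul_of_nonneg_right (hcn β) hδ0.le
  linarith
end

section
/- Let c_1, …, c_R be cubic forms in n variables with integer coefficients which are linearly independent, generate the homogeneous ideal of V(c_1,…,c_R) ⊆ ℙ^{n−1}_ℚ, and define a smooth complete intersection. Then for every nonzero β ∈ ℝ^R, the singular locus of the projective hypersurface V(β·c) ⊆ ℙ^{n−1} cut out by β·c = β_1c_1 + … + β_Rc_R has dimension at most R − 2 (with the convention dim ∅ = −1). -/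
open MvPolynomial Matrix

section helpers

attribute [local instance] MvPolynomial.gradedAlgebra

lemma aux_homComp_mul {σ : Type*} (a h : MvPolynomial σ ℂ) (k d : ℕ)
    (hh : h.IsHomogeneous k) :
    homogeneousComponent d (a * h) =
      if k ≤ d then homogeneousComponent (d - k) a * h else 0 := by
  have key := DirectSum.coe_decompose_mul_of_right_mem (homogeneousSubmodule σ ℂ)
    (a := a) (b := h) (i := k) d ((mem_homogeneousSubmodule _ _).2 hh)
  have e : ∀ (p : MvPolynomial σ ℂ) (i : ℕ),
      (DirectSum.decompose (homogeneousSubmodule σ ℂ) p i : MvPolynomial σ ℂ)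
        = homogeneousComponent i p := fun p i => decomposition.decompose'_apply p i
  rw [e, e] at key
  exact key

lemma aux_krullDim_le_of_isIntegral (A B : Type*) [CommRing A] [CommRing B] [Algebra A B]
    [Algebra.IsIntegral A B] : ringKrullDim B ≤ ringKrullDim A := by
  refine Order.krullDim_le_of_strictMono (PrimeSpectrum.comap (algebraMap A B)) ?_
  intro p q hpq
  have hpq' : p.asIdeal < q.asIdeal := hpq
  obtain ⟨hle, x, hxq, hxp⟩ := SetLike.lt_iff_le_and_exists.1 hpq'
  exact Ideal.comap_lt_comap_of_integral_mem_sdiff hle ⟨hxq, hxp⟩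
    (Algebra.IsIntegral.isIntegral x)

lemma aux_dim {n : ℕ} {ι κ : Type} [Fintype κ]
    (g : ι → MvPolynomial (Fin n) ℂ) (h : κ → MvPolynomial (Fin n) ℂ)
    (e k : ℕ) (hk : 0 < k)
    (hg : ∀ i, (g i).IsHomogeneous e) (hh : ∀ i, (h i).IsHomogeneous k) (N : ℕ)
    (hN : idealOfVars (Fin n) ℂ ^ N ≤ Ideal.span (Set.range g) ⊔ Ideal.span (Set.range h)) :
    ringKrullDim (MvPolynomial (Fin n) ℂ ⧸ Ideal.span (Set.range g)) ≤
      ((Fintype.card κ : ℕ) : WithBot ℕ∞) := by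
  set I := Ideal.span (Set.range g) with hI
  have hIhom : I.IsHomogeneous (homogeneousSubmodule (Fin n) ℂ) := by
    apply Ideal.homogeneous_span
    rintro _ ⟨i, rfl⟩
    exact ⟨e, hg i⟩
  let φ : MvPolynomial κ ℂ →ₐ[ℂ] (MvPolynomial (Fin n) ℂ ⧸ I) :=
    aeval fun r => Ideal.Quotient.mk I (h r)
  let algInst : Algebra (MvPolynomial κ ℂ) (MvPolynomial (Fin n) ℂ ⧸ I) := φ.toRingHom.toAlgebra
  let modInst : Module (MvPolynomial κ ℂ) (MvPolynomial (Fin n) ℂ ⧸ I) := algInst.toModule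
  have hsm : ∀ (p : MvPolynomial κ ℂ) (a : MvPolynomial (Fin n) ℂ ⧸ I), p • a = φ p * a :=
    fun p a => rfl
  have hφX : ∀ r, φ (X r) = Ideal.Quotient.mk I (h r) := fun r => aeval_X _ _
  have hφC : ∀ z, φ (C z) = Ideal.Quotient.mk I (C z) := fun z => φ.commutes z
  let T : Set (Fin n →₀ ℕ) := {s | s.degree < N}
  have hT : T.Finite := by
    have : T ⊆ ⋃ d ∈ Finset.range N, {s | s.degree = d} := by
      intro s hs
      simpa [T] using hs
    refine Set.Finite.subset ?_ this
    refine Set.Finite.biUnion (Finset.finite_toSet _) fun d _ => ?_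
    refine Set.Finite.subset (Finset.finite_toSet (Finset.univ.finsuppAntidiag d)) ?_
    intro s hs
    simp only [Finset.mem_coe, Finset.mem_finsuppAntidiag, Finset.subset_univ, and_true]
    rw [← hs, Finsupp.degree_eq_sum]
  let S : Submodule (MvPolynomial κ ℂ) (MvPolynomial (Fin n) ℂ ⧸ I) :=
    Submodule.span _ ((fun s => Ideal.Quotient.mk I (monomial s 1)) '' T)
  have main : ∀ d : ℕ, ∀ f : MvPolynomial (Fin n) ℂ, f.IsHomogeneous d →
      Ideal.Quotient.mk I f ∈ S := by
    intro d
    induction d using Nat.strong_induction_on with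
    | _ d ih =>
      intro f hf
      by_cases hd : d < N
      · rw [f.as_sum, map_sum]
        refine Submodule.sum_mem _ fun s hs => ?_
        have hs' : s.degree = d := by
          by_contra hne
          exact (mem_support_iff.1 hs) (hf.coeff_eq_zero hne)
        have : Ideal.Quotient.mk I (monomial s (coeff s f)) =
            (C (coeff s f) : MvPolynomial κ ℂ) • Ideal.Quotient.mk I (monomial s 1) := by
          rw [hsm, hφC, ← map_mul, C_mul_monomial, mul_one]
        rw [this]
        refine Submodule.smul_mem _ _ (Submodule.subset_span ⟨s, ?_, rfl⟩)
        change s.degree < N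
        omega
      · have hfJ : f ∈ I ⊔ Ideal.span (Set.range h) := by
          apply hN
          rw [mem_pow_idealOfVars_iff']
          intro x hx
          exact hf.coeff_eq_zero (by omega)
        obtain ⟨i, hi, j, hj, hij⟩ := Submodule.mem_sup.1 hfJ
        obtain ⟨a, ha⟩ := (Ideal.mem_span_range_iff_exists_fun).1 hj
        have h1 : f = homogeneousComponent d i +
            ∑ r, homogeneousComponent d (a r * h r) := by
          rw [← map_sum, ha, ← map_add, hij]
          exact (homogeneousComponent_eq_self hf).symm
        have h2 : Ideal.Quotient.mk I (homogeneousComponent d i) = 0 :=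
          Ideal.Quotient.eq_zero_iff_mem.2 (homogeneousComponent_mem_of_mem hIhom hi d)
        rw [h1, map_add, h2, zero_add, map_sum]
        refine Submodule.sum_mem _ fun r _ => ?_
        rw [aux_homComp_mul _ _ k d (hh r)]
        split_ifs with hkd
        · rw [map_mul, mul_comm, ← hφX, ← hsm]
          exact Submodule.smul_mem _ _
            (ih (d - k) (by omega) _ (homogeneousComponent_isHomogeneous _ _))
        · simp
  have hfin : Module.Finite (MvPolynomial κ ℂ) (MvPolynomial (Fin n) ℂ ⧸ I) := by
    have hS : S.FG := Submodule.fg_def.2 ⟨_, hT.image _, rfl⟩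
    suffices hSt : ⊤ ≤ S by
      exact ⟨top_le_iff.1 hSt ▸ hS⟩
    rintro x -
    obtain ⟨f, rfl⟩ := Ideal.Quotient.mk_surjective x
    rw [← sum_homogeneousComponent f, map_sum]
    exact Submodule.sum_mem _ fun i _ => main i _ (homogeneousComponent_isHomogeneous _ _)
  calc ringKrullDim (MvPolynomial (Fin n) ℂ ⧸ I)
      ≤ ringKrullDim (MvPolynomial κ ℂ) := by
        have : Algebra.IsIntegral (MvPolynomial κ ℂ) (MvPolynomial (Fin n) ℂ ⧸ I) :=
          Algebra.IsIntegral.of_finite _ _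
        exact aux_krullDim_le_of_isIntegral _ _
    _ = ((Fintype.card κ : ℕ) : WithBot ℕ∞) := by
      rw [MvPolynomial.ringKrullDim_of_isNoetherianRing, ringKrullDim_eq_zero_of_field]
      simp

end helpers



/-- If the integral cubic forms `c_1, …, c_R` are linearly
independent, generate the homogeneous ideal of `V(c_1, …, c_R)`, and define a
smooth complete intersection, then for every nonzero `β ∈ ℝ^R` the singular locus
of the projective hypersurface `V(β·c) ⊆ ℙ^{n−1}` over ℂ has dimension at most
`R − 2` (with `dim ∅ = −1`); equivalently, the affine cone over `Sing V(β·c)` —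
whose coordinate ring is the quotient by the ideal generated by the partial
derivatives of `β·c` — has Krull dimension at most `R − 1`. -/
theorem statement4 (n R : ℕ)
    (c : Fin R → MvPolynomial (Fin n) ℤ)
    (hdeg : ∀ r, (c r).IsHomogeneous 3)
    (hlin : LinearIndependent ℚ fun r => MvPolynomial.map (Int.castRingHom ℚ) (c r))
    (hgen : ∀ f : MvPolynomial (Fin n) ℚ,
      (∀ z : Fin n → ℂ, (∀ r, aeval z (c r) = 0) → aeval z f = 0) →
      f ∈ Ideal.span (Set.range fun r => MvPolynomial.map (Int.castRingHom ℚ) (c r)))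
    (hsmooth : ∀ z : Fin n → ℂ, z ≠ 0 → (∀ r, aeval z (c r) = 0) →
      (Matrix.of fun (r : Fin R) (j : Fin n) => aeval z (pderiv j (c r))).rank = R)
    (hdim : ringKrullDim (MvPolynomial (Fin n) ℂ ⧸
        Ideal.span (Set.range fun r => MvPolynomial.map (Int.castRingHom ℂ) (c r)))
      = ((n - R : ℕ) : WithBot ℕ∞)) :
    ∀ β : Fin R → ℝ, β ≠ 0 →
      ringKrullDim (MvPolynomial (Fin n) ℂ ⧸
        Ideal.span (Set.range fun i : Fin n =>
          MvPolynomial.map (algebraMap ℝ ℂ)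
            (pderiv i (∑ r, β r • MvPolynomial.map (Int.castRingHom ℝ) (c r)))))
        ≤ ((R - 1 : ℕ) : WithBot ℕ∞) := by
  intro β hβ
  obtain ⟨r0, hr0⟩ := Function.ne_iff.1 hβ
  simp only [Pi.zero_apply] at hr0
  set F : MvPolynomial (Fin n) ℝ := ∑ r, β r • MvPolynomial.map (Int.castRingHom ℝ) (c r) with hF
  have hFhom : F.IsHomogeneous 3 := by
    refine IsHomogeneous.sum _ _ _ fun r _ => ?_
    rw [smul_eq_C_mul]
    exact ((hdeg r).map _).C_mul _
  let g : Fin n → MvPolynomial (Fin n) ℂ := fun i => MvPolynomial.map (algebraMap ℝ ℂ) (pderiv i F)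
  let h : {r : Fin R // r ≠ r0} → MvPolynomial (Fin n) ℂ :=
    fun r => MvPolynomial.map (Int.castRingHom ℂ) (c r)
  have hcard : Fintype.card {r : Fin R // r ≠ r0} = R - 1 := by
    rw [Fintype.card_subtype_compl]; simp
  -- evaluation of the complex partial derivatives
  have hmapev : ∀ (z : Fin n → ℂ) (p : MvPolynomial (Fin n) ℤ),
      aeval z (MvPolynomial.map (algebraMap ℝ ℂ) (MvPolynomial.map (Int.castRingHom ℝ) p))
        = aeval z p := by
    intro z p
    rw [MvPolynomial.map_map, aeval_def, aeval_def, eval₂_map]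
    congr 1
  have hmapev' : ∀ (z : Fin n → ℂ) (p : MvPolynomial (Fin n) ℤ),
      aeval z (MvPolynomial.map (Int.castRingHom ℂ) p) = aeval z p := by
    intro z p
    rw [aeval_def, aeval_def, eval₂_map]
    congr 1
  have hgev : ∀ (z : Fin n → ℂ) i,
      aeval z (g i) = ∑ r, (β r : ℂ) * aeval z (pderiv i (c r)) := by
    intro z i
    simp only [g, hF, map_sum, smul_eq_C_mul, pderiv_C_mul, map_mul, map_C, pderiv_map]
    refine Finset.sum_congr rfl fun r _ => ?_
    rw [hmapev]
    simp
  have hFev : ∀ (z : Fin n → ℂ), aeval z (MvPolynomial.map (algebraMap ℝ ℂ) F)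
      = ∑ r, (β r : ℂ) * aeval z (c r) := by
    intro z
    simp only [hF, map_sum, smul_eq_C_mul, map_mul, map_C]
    refine Finset.sum_congr rfl fun r _ => ?_
    rw [hmapev]
    simp
  have hzero : ∀ z : Fin n → ℂ, (∀ i, aeval z (g i) = 0) → (∀ r, aeval z (h r) = 0) → z = 0 := by
    intro z hz1 hz2
    by_contra hz
    have hF0 : ∑ r, (β r : ℂ) * aeval z (c r) = 0 := by
      have he := (hFhom.map (algebraMap ℝ ℂ)).sum_X_mul_pderiv
      have he' := congrArg (aeval z) he
      rw [map_nsmul, hFev, map_sum] at he'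
      have : ∑ i, aeval z (X i * pderiv i (MvPolynomial.map (algebraMap ℝ ℂ) F)) = 0 := by
        refine Finset.sum_eq_zero fun i _ => ?_
        rw [map_mul, pderiv_map]
        have := hz1 i
        simp only [g] at this
        rw [this, mul_zero]
      rw [this] at he'
      have h3 := he'.symm
      simpa using h3
    have hother : ∀ r, r ≠ r0 → aeval z (c r) = 0 := by
      intro r hr
      have := hz2 ⟨r, hr⟩
      simp only [h] at this
      rwa [hmapev'] at this
    have hc0 : aeval z (c r0) = 0 := by
      rw [Finset.sum_eq_single r0 (fun r _ hr => by rw [hother r hr, mul_zero])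
        (by simp)] at hF0
      rcases mul_eq_zero.1 hF0 with h0 | h0
      · exact absurd (by exact_mod_cast h0) hr0
      · exact h0
    have hall : ∀ r, aeval z (c r) = 0 := by
      intro r
      by_cases hr : r = r0
      · rw [hr, hc0]
      · exact hother r hr
    have hrank := hsmooth z hz hall
    have hli : LinearIndependent ℂ
        (Matrix.of fun (r : Fin R) (j : Fin n) => aeval z (pderiv j (c r))).row := by
      rw [linearIndependent_iff_card_eq_finrank_span, Set.finrank,
        ← Matrix.rank_eq_finrank_span_row, hrank, Fintype.card_fin]
    have := Fintype.linearIndependent_iff.1 hli (fun r => (β r : ℂ)) (by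
      ext j
      have := hz1 j
      rw [hgev] at this
      simpa [Finset.sum_apply, Matrix.row] using this) r0
    exact hr0 (by exact_mod_cast this)
  have hrad : idealOfVars (Fin n) ℂ ≤
      (Ideal.span (Set.range g) ⊔ Ideal.span (Set.range h)).radical := by
    rw [← vanishingIdeal_zeroLocus_eq_radical (K := ℂ)]
    refine Ideal.span_le.2 ?_
    rintro _ ⟨i, rfl⟩
    refine mem_vanishingIdeal_iff.2 fun z hz => ?_
    rw [mem_zeroLocus_iff] at hz
    have : z = 0 := hzero z
      (fun i => hz _ (Ideal.mem_sup_left (Ideal.subset_span ⟨i, rfl⟩)))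
      (fun r => hz _ (Ideal.mem_sup_right (Ideal.subset_span ⟨r, rfl⟩)))
    simp [this]
  obtain ⟨N, hN⟩ := Ideal.exists_pow_le_of_le_radical_of_fg hrad (idealOfVars_fg _ _)
  have := aux_dim g h 2 3 (by norm_num) (fun i => (hFhom.pderiv (i := i)).map _)
    (fun r => (hdeg r).map _) N hN
  rw [hcard] at this
  exact this
end
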